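/- Let f be a dominant pseudo polynomial of degree θ > 3 and let ξ be a real number. Then for every ε > 0 there is a constant C = C(f, ξ, ε) such that for all sufficiently large X, the minimum over primes p with 2 ≤ p ≤ X of ‖ξ·⌊f(p)⌋‖ is at most C·X^(−ρ_d + ε), where ρ_d = 1/(3(8θ² + 12θ + 10)). -/

import Mathlib

open Finset Filter

noncomputable section

/-- Distance from `x` to the nearest integer. -/
def nearestIntDist (x : ℝ) : ℝ := |x - round x|

/-- `f` is a dominant pseudo polynomial of degree `Θ`: it has the form
`f x = ∑ j, α j * x ^ θ j` with positive coefficients, strictly increasing exponents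
`1 ≤ θ 0 < θ 1 < ⋯`, and the largest exponent equals `Θ` and is not an integer. -/
def IsDominantPseudoPoly (f : ℝ → ℝ) (Θ : ℝ) : Prop :=
  ∃ (d : ℕ) (α θ : Fin (d + 1) → ℝ),
    (∀ j, 0 < α j) ∧ StrictMono θ ∧ 1 ≤ θ 0 ∧
    θ (Fin.last d) = Θ ∧ (∀ z : ℤ, (z : ℝ) ≠ Θ) ∧
    ∀ x : ℝ, f x = ∑ j, α j * x ^ θ j

namespace PseudoPoly

section

/-- The additive character `x ↦ exp (2 * π * i * x)`. -/
def e (x : ℝ) : ℂ := Complex.exp (2 * Real.pi * Complex.I * x)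

lemma e_add (x y : ℝ) : e (x + y) = e x * e y := by
  unfold e; rw [← Complex.exp_add]; push_cast; ring_nf

@[simp] lemma e_zero : e 0 = 1 := by simp [e]

@[simp] lemma norm_e (x : ℝ) : ‖e x‖ = 1 := by
  unfold e
  rw [show (2 * Real.pi * Complex.I * x : ℂ) = ((2 * Real.pi * x : ℝ) : ℂ) * Complex.I by
    push_cast; ring]
  exact Complex.norm_exp_ofReal_mul_I _

@[simp] lemma e_int (n : ℤ) : e n = 1 := by
  unfold e
  rw [Complex.exp_eq_one_iff]
  exact ⟨n, by push_cast; ring⟩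

lemma conj_e (x : ℝ) : starRingEnd ℂ (e x) = e (-x) := by
  have : starRingEnd ℂ 2 = 2 := map_ofNat _ 2
  unfold e; rw [← Complex.exp_conj]; congr 1; simp [this]

lemma e_add_int (x : ℝ) (n : ℤ) : e (x + n) = e x := by
  rw [e_add, e_int, mul_one]

section Classes

open Classical in
/-- The classes of `S` modulo `q`, according to the position `pt`. -/
def classes {ι : Type} (S : Finset ι) (pt : ι → ℤ) (q : ℕ) : Finset (Finset ι) :=
  S.image fun i => S.filter fun j => (q : ℤ) ∣ pt j - pt i

variable {ι : Type} {S : Finset ι} {pt : ι → ℤ} {q : ℕ}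

lemma mem_classes {A : Finset ι} :
    A ∈ classes S pt q ↔ ∃ i ∈ S, S.filter (fun j => (q : ℤ) ∣ pt j - pt i) = A := by
  simp [classes]

lemma filter_mem_classes {i : ι} (hi : i ∈ S) :
    S.filter (fun j => (q : ℤ) ∣ pt j - pt i) ∈ classes S pt q :=
  mem_classes.2 ⟨i, hi, rfl⟩

lemma classes_subset {A : Finset ι} (hA : A ∈ classes S pt q) : A ⊆ S := by
  obtain ⟨i, -, rfl⟩ := mem_classes.1 hA
  exact filter_subset _ _

lemma classes_nonempty {A : Finset ι} (hA : A ∈ classes S pt q) : A.Nonempty := by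
  obtain ⟨i, hi, rfl⟩ := mem_classes.1 hA
  exact ⟨i, by simp [hi]⟩

lemma dvd_of_mem_classes {A : Finset ι} (hA : A ∈ classes S pt q) {i j : ι}
    (hi : i ∈ A) (hj : j ∈ A) : (q : ℤ) ∣ pt j - pt i := by
  obtain ⟨s, hs, rfl⟩ := mem_classes.1 hA
  simp only [mem_filter] at hi hj
  have := dvd_sub hj.2 hi.2
  simpa using this

lemma class_eq_filter {A : Finset ι} (hA : A ∈ classes S pt q) {i : ι} (hi : i ∈ A) :
    A = S.filter (fun j => (q : ℤ) ∣ pt j - pt i) := by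
  obtain ⟨s, hs, rfl⟩ := mem_classes.1 hA
  simp only [mem_filter] at hi
  ext j
  simp only [mem_filter, and_congr_right_iff]
  intro _
  constructor
  · intro h; have := dvd_sub h hi.2; simpa using this
  · intro h; have := dvd_add h hi.2; simpa using this

lemma classes_congr {q' : ℕ} {pt' : ι → ℤ}
    (h : ∀ i ∈ S, ∀ j ∈ S, ((q : ℤ) ∣ pt j - pt i ↔ (q' : ℤ) ∣ pt' j - pt' i)) :
    classes S pt q = classes S pt' q' := by
  ext A
  rw [mem_classes, mem_classes]
  refine exists_congr fun i => and_congr_right fun hi => ?_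
  rw [filter_congr fun j hj => h i hi j hj]

lemma classes_biUnion [DecidableEq ι] {q' : ℕ} (hq : q ∣ q') :
    classes S pt q' = (classes S pt q).biUnion fun A => classes A pt q' := by
  have hq : (q : ℤ) ∣ q' := by exact_mod_cast hq
  ext B
  simp only [mem_biUnion]
  constructor
  · intro hB
    obtain ⟨i, hi, rfl⟩ := mem_classes.1 hB
    refine ⟨_, filter_mem_classes hi, mem_classes.2 ⟨i, by simp [hi], ?_⟩⟩
    ext j
    simp only [mem_filter, and_assoc, and_congr_right_iff, and_iff_right_iff_imp]
    intro _ h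
    exact hq.trans h
  · rintro ⟨A, hA, hB⟩
    obtain ⟨i, hi, rfl⟩ := mem_classes.1 hB
    refine mem_classes.2 ⟨i, classes_subset hA hi, ?_⟩
    rw [class_eq_filter hA hi]
    ext j
    simp only [mem_filter, and_assoc, and_congr_right_iff]
    intro _
    exact ⟨fun h => ⟨hq.trans h, h⟩, fun h => h.2⟩

lemma classes_eq_of_mem {A B : Finset ι} (hA : A ∈ classes S pt q) (hB : B ∈ classes S pt q)
    {i : ι} (hiA : i ∈ A) (hiB : i ∈ B) : A = B := by
  rw [class_eq_filter hA hiA, class_eq_filter hB hiB]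

lemma sum_classes_refine {M : Type*} [AddCommMonoid M] {q' : ℕ} (hq : q ∣ q')
    (g : Finset ι → M) :
    ∑ B ∈ classes S pt q', g B = ∑ A ∈ classes S pt q, ∑ B ∈ classes A pt q', g B := by
  classical
  rw [classes_biUnion hq, sum_biUnion]
  intro A hA A' hA' hne
  rw [Function.onFun, disjoint_left]
  intro B hB hB'
  obtain ⟨i, hi⟩ := classes_nonempty hB
  exact hne (classes_eq_of_mem hA hA' (classes_subset hB hi) (classes_subset hB' hi))

lemma sum_classes {M : Type*} [AddCommMonoid M] (S : Finset ι) (pt : ι → ℤ) (q : ℕ)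
    (g : ι → M) : ∑ i ∈ S, g i = ∑ A ∈ classes S pt q, ∑ i ∈ A, g i := by
  classical
  have : S = (classes S pt q).biUnion id := by
    ext i
    simp only [mem_biUnion, id]
    exact ⟨fun hi => ⟨_, filter_mem_classes (q := q) (pt := pt) hi, by simp [hi]⟩,
      fun ⟨A, hA, hi⟩ => classes_subset hA hi⟩
  conv_lhs => rw [this]
  rw [sum_biUnion]
  · rfl
  intro A hA A' hA' hne
  rw [Function.onFun, disjoint_left]
  intro i hi hi'
  exact hne (classes_eq_of_mem hA hA' hi hi')

lemma card_classes_le (S : Finset ι) (pt : ι → ℤ) (hq : 0 < q) : #(classes S pt q) ≤ q := by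
  classical
  have hq' : (0 : ℤ) < q := by exact_mod_cast hq
  let r : Finset ι → ℕ := fun A => if h : A.Nonempty then (pt h.choose % q).toNat else 0
  have := card_le_card_of_injOn (s := classes S pt q) (t := range q) r ?_ ?_
  · simpa using this
  · intro A hA
    have h := classes_nonempty hA
    simp only [r, dif_pos h, coe_range, Set.mem_Iio]
    have := Int.emod_lt_of_pos (pt h.choose) hq'
    have := Int.emod_nonneg (pt h.choose) hq'.ne'
    lia
  · intro A hA B hB hAB
    have hA' := classes_nonempty hA
    have hB' := classes_nonempty hB
    simp only [r, dif_pos hA', dif_pos hB'] at hAB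
    have h1 := Int.emod_nonneg (pt hA'.choose) hq'.ne'
    have h2 := Int.emod_nonneg (pt hB'.choose) hq'.ne'
    have h3 : pt hA'.choose % q = pt hB'.choose % q := by lia
    have h4 : (q : ℤ) ∣ pt hB'.choose - pt hA'.choose := Int.ModEq.dvd h3
    refine classes_eq_of_mem hA hB (i := hB'.choose) ?_ hB'.choose_spec
    rw [class_eq_filter hA hA'.choose_spec]
    simp [h4, classes_subset hB hB'.choose_spec]

end Classes

lemma pow_sum_le_card_mul {ι : Type*} {s : Finset ι} {f : ι → ℝ} (hf : ∀ i ∈ s, 0 ≤ f i)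
    (m : ℕ) : (∑ i ∈ s, f i) ^ (m + 1) ≤ (#s : ℝ) ^ m * ∑ i ∈ s, f i ^ (m + 1) := by
  rcases s.eq_empty_or_nonempty with rfl | hs
  · simp
  · have : (0 : ℝ) < (#s : ℝ) ^ m := by have := hs.card_pos; positivity
    rw [mul_comm, ← div_le_iff₀ this]
    exact pow_sum_div_card_le_sum_pow hf m

section Systems

open Polynomial

/-- `∑_ω w(ω) |F(ω)|^m`. -/
def mom {Ω : Type} [Fintype Ω] (w : Ω → ℝ) (m : ℕ) (F : Ω → ℂ) : ℝ := ∑ ω, w ω * ‖F ω‖ ^ m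

/-- Partial sums of a family of functions. -/
def psum {Ω ι : Type} (f : ι → Ω → ℂ) (A : Finset ι) (ω : Ω) : ℂ := ∑ i ∈ A, f i ω

/-- The curve `γ` is congruent to a unit multiple of the moment curve modulo `p`. -/
def Good (p : ℕ) {k : ℕ} (γ : Fin k → ℤ[X]) : Prop :=
  ∃ d : ℤ, ¬ (p : ℤ) ∣ d ∧ ∀ j, ∃ g : ℤ[X], γ j = C d * X ^ (j.val + 1) + C (p : ℤ) * g

/-- The family `f` behaves like the characters with frequencies `γ (pt i) / p ^ N`:
it is translation equivariant. -/
def IsSys (p N : ℕ) {k : ℕ} (γ : Fin k → ℤ[X]) {Ω ι : Type} (w : Ω → ℝ)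
    (S : Finset ι) (pt : ι → ℤ) (f : ι → Ω → ℂ) : Prop :=
  ∀ t : Fin k → ℤ, ∃ τ : Equiv.Perm Ω, (∀ ω, w (τ ω) = w ω) ∧ ∃ c : ℂ, ‖c‖ = 1 ∧
    ∀ i ∈ S, ∀ ω, f i (τ ω) =
      c * e (((∑ j, t j * (γ j).eval (pt i) : ℤ) : ℝ) / (p : ℝ) ^ N) * f i ω

/-- Decoupling inequality with loss `p ^ (lam * n)`. -/
def Dec (p k : ℕ) (lam : ℝ) : Prop :=
  ∃ C : ℝ, 1 ≤ C ∧ ∀ (n : ℕ) (γ : Fin k → ℤ[X]), Good p γ →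
    ∀ (Ω ι : Type) [Fintype Ω] (w : Ω → ℝ) (S : Finset ι) (pt : ι → ℤ) (f : ι → Ω → ℂ),
      (∀ ω, 0 ≤ w ω) → IsSys p (k * n) γ w S pt f →
        mom w (k * (k + 1)) (psum f S) ≤
          C * (p : ℝ) ^ ((lam + (k * (k + 1) : ℝ) / 2 - 1) * n) *
            ∑ J ∈ classes S pt (p ^ n), mom w (k * (k + 1)) (psum f J)

variable {Ω ι : Type} {w : Ω → ℝ}

lemma mom_nonneg [Fintype Ω] (hw : ∀ ω, 0 ≤ w ω) (m : ℕ) (F : Ω → ℂ) : 0 ≤ mom w m F :=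
  sum_nonneg fun ω _ => mul_nonneg (hw ω) (by positivity)

lemma psum_classes (f : ι → Ω → ℂ) (S : Finset ι) (pt : ι → ℤ) (q : ℕ) (ω : Ω) :
    psum f S ω = ∑ A ∈ classes S pt q, psum f A ω :=
  sum_classes S pt q _

lemma IsSys.mono {p N k : ℕ} {γ : Fin k → ℤ[X]} {S A : Finset ι} {pt : ι → ℤ}
    {f : ι → Ω → ℂ} (h : IsSys p N γ w S pt f) (hA : A ⊆ S) : IsSys p N γ w A pt f := by
  intro t
  obtain ⟨τ, h1, c, h2, h3⟩ := h t
  exact ⟨τ, h1, c, h2, fun i hi => h3 i (hA hi)⟩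

lemma Dec.mono {p k : ℕ} (hp : 1 ≤ p) {lam lam' : ℝ} (h : Dec p k lam) (hl : lam ≤ lam') :
    Dec p k lam' := by
  obtain ⟨C, hC, H⟩ := h
  refine ⟨C, hC, fun n γ hγ Ω ι _ w S pt f hw hs => (H n γ hγ Ω ι w S pt f hw hs).trans ?_⟩
  have : 0 ≤ ∑ J ∈ classes S pt (p ^ n), mom w (k * (k + 1)) (psum f J) :=
    sum_nonneg fun _ _ => mom_nonneg hw _ _
  gcongr
  exact_mod_cast hp

/-- Trivial decoupling from Hölder's inequality. -/
lemma mom_psum_le [Fintype Ω] (hw : ∀ ω, 0 ≤ w ω) (f : ι → Ω → ℂ) (S : Finset ι) (pt : ι → ℤ)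
    {q : ℕ} (hq : 0 < q) (m : ℕ) :
    mom w (m + 1) (psum f S) ≤ (q : ℝ) ^ m * ∑ A ∈ classes S pt q, mom w (m + 1) (psum f A) := by
  unfold mom
  rw [sum_comm, mul_sum]
  refine sum_le_sum fun ω _ => ?_
  rw [← mul_sum, mul_left_comm]
  refine mul_le_mul_of_nonneg_left ?_ (hw ω)
  rw [psum_classes f S pt q ω]
  calc ‖∑ A ∈ classes S pt q, psum f A ω‖ ^ (m + 1)
      ≤ (∑ A ∈ classes S pt q, ‖psum f A ω‖) ^ (m + 1) := by
        gcongr; exact norm_sum_le _ _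
    _ ≤ (#(classes S pt q) : ℝ) ^ m * ∑ A ∈ classes S pt q, ‖psum f A ω‖ ^ (m + 1) :=
        pow_sum_le_card_mul (fun _ _ => norm_nonneg _) m
    _ ≤ _ := by
        gcongr
        exact card_classes_le S pt hq

end Systems

end

section

open Polynomial

section TaylorDet

variable {p : ℕ} [hp : Fact p.Prime]

/-- Over `𝔽_p`, the truncated Taylor coefficients of `X^(m+1), …, X^(m+l)` at `v` are
linearly independent. -/
lemma taylor_indep {m l : ℕ} (hpk : m + l < p) {v : ZMod p} (hv : m = 0 ∨ v ≠ 0)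
    {c : Fin l → ZMod p}
    (h : ∀ j < l, (taylor v (∑ i, C (c i) * X ^ (m + i.val + 1))).coeff (j + 1) = 0) :
    c = 0 := by
  set q : (ZMod p)[X] := ∑ i, C (c i) * X ^ (m + i.val + 1) with hq
  set s : (ZMod p)[X] := ∑ i, C (c i * (m + i.val + 1 : ℕ)) * X ^ i.val with hs
  have hder : derivative q = X ^ m * s := by
    rw [hq, hs, derivative_sum, mul_sum]
    refine sum_congr rfl fun i _ => ?_
    rw [derivative_C_mul_X_pow]
    rw [show m + i.val + 1 - 1 = m + i.val by omega, pow_add]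
    ring
  have hdvd : (X - C v) ^ l ∣ derivative q := by
    have h1 : X ^ l ∣ taylor v (derivative q) := by
      rw [X_pow_dvd_iff]
      intro j hj
      have : taylor v (derivative q) = derivative (taylor v q) := by
        simp [taylor_apply, derivative_comp]
      rw [this, coeff_derivative, h j hj, zero_mul]
    obtain ⟨r, hr⟩ := h1
    refine ⟨taylor (-v) r, ?_⟩
    have h2 := congrArg (taylor (-v)) hr
    rw [taylor_taylor] at h2
    simp only [taylor_zero, taylor_mul, taylor_pow, taylor_X, neg_add_cancel] at h2
    rw [h2]; simp [sub_eq_add_neg]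
  have hdvd' : (X - C v) ^ l ∣ s := by
    rw [hder] at hdvd
    rcases hv with rfl | hv
    · simpa using hdvd
    · refine IsCoprime.dvd_of_dvd_mul_left ?_ hdvd
      refine IsCoprime.pow ?_
      have := isCoprime_X_sub_C_of_isUnit_sub (a := v) (b := 0) (by simpa using hv)
      simpa using this
  have hs0 : s = 0 := by
    by_contra hne
    have h1 := degree_le_of_dvd hdvd' hne
    rw [degree_pow, degree_X_sub_C] at h1
    have h2 : s.degree < l := by
      rw [hs]
      refine (degree_sum_fin_lt fun i : Fin l => c i * (m + i.val + 1 : ℕ))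
    simp only [nsmul_eq_mul, mul_one] at h1
    exact absurd h1 (not_le.2 h2)
  funext i
  have h1 : s.coeff i = c i * (m + i.val + 1 : ℕ) := by
    rw [hs, finsetSum_coeff]
    simp only [coeff_C_mul, coeff_X_pow]
    rw [sum_eq_single i]
    · simp
    · intro b _ hb
      rw [if_neg (fun h => hb (Fin.ext h.symm)), mul_zero]
    · simp
  rw [hs0, coeff_zero] at h1
  have h2 : ((m + i.val + 1 : ℕ) : ZMod p) ≠ 0 := by
    rw [Ne, ZMod.natCast_eq_zero_iff]
    intro hd
    have := Nat.le_of_dvd (by omega) hd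
    have := i.2
    omega
  exact (mul_eq_zero.1 h1.symm).resolve_right h2

/-- The matrix of Taylor coefficients of order `1, …, l` at `v`. -/
def taylorMat {l : ℕ} (h : Fin l → ℤ[X]) (v : ℤ) : Matrix (Fin l) (Fin l) ℤ :=
  Matrix.of fun i j => (taylor v (h i)).coeff (j.val + 1)

lemma taylorMat_det {m l : ℕ} (hpk : m + l < p) {v : ℤ} (hv : m = 0 ∨ ¬ (p : ℤ) ∣ v)
    {D : ℤ} (hD : ¬ (p : ℤ) ∣ D) {h : Fin l → ℤ[X]}
    (hh : ∀ i, ∃ g : ℤ[X], h i = C D * X ^ (m + i.val + 1) + C (p : ℤ) * g) :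
    ¬ (p : ℤ) ∣ (taylorMat h v).det := by
  intro hdvd
  have h0 : ((taylorMat h v).map (Int.castRingHom (ZMod p))).det = 0 := by
    rw [← RingHom.mapMatrix_apply, ← RingHom.map_det]
    exact (ZMod.intCast_zmod_eq_zero_iff_dvd _ _).2 hdvd
  obtain ⟨c, hc, hc0⟩ := Matrix.exists_vecMul_eq_zero_iff.2 h0
  have hD' : (D : ZMod p) ≠ 0 := fun h => hD ((ZMod.intCast_zmod_eq_zero_iff_dvd _ _).1 h)
  have key := taylor_indep (p := p) (m := m) (l := l) hpk (v := (v : ZMod p))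
    (c := fun i => c i * D) ?_ ?_
  · apply hc
    funext i
    have := congrFun key i
    simpa [hD'] using this
  · refine hv.imp id fun hv h => hv ((ZMod.intCast_zmod_eq_zero_iff_dvd _ _).1 h)
  · intro j hj
    have h1 := congrFun hc0 ⟨j, hj⟩
    rw [Matrix.vecMul, dotProduct] at h1
    rw [map_sum, finsetSum_coeff]
    rw [Pi.zero_apply] at h1
    rw [← h1]
    refine sum_congr rfl fun i _ => ?_
    obtain ⟨g, hg⟩ := hh i
    have h2 : (h i).map (Int.castRingHom (ZMod p)) = C (D : ZMod p) * X ^ (m + i.val + 1) := by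
      rw [hg]; simp
    have h3 : (Int.castRingHom (ZMod p)) ((taylor v (h i)).coeff (j + 1)) =
        (taylor (v : ZMod p) (C (D : ZMod p) * X ^ (m + i.val + 1))).coeff (j + 1) := by
      rw [← coeff_map, ← h2, map_taylor]; simp
    simp only [taylorMat, Matrix.map_apply, Matrix.of_apply]
    rw [h3, C_mul, mul_assoc, taylor_mul, taylor_C, coeff_C_mul]

/-- Normalisation of a curve near the point `v`. -/
lemma exists_normalize {m l : ℕ} (hpk : m + l < p) {v : ℤ} (hv : m = 0 ∨ ¬ (p : ℤ) ∣ v)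
    {D : ℤ} (hD : ¬ (p : ℤ) ∣ D) {h : Fin l → ℤ[X]}
    (hh : ∀ i, ∃ g : ℤ[X], h i = C D * X ^ (m + i.val + 1) + C (p : ℤ) * g)
    (a : ℕ) (ha : m = 0 ∨ 1 ≤ a) :
    ∃ (A : Fin l → Fin l → ℤ) (c : Fin l → ℤ) (γ : Fin l → ℤ[X]), Good p γ ∧
      (∀ r, X ^ (r.val + 1) ∣ γ r) ∧
      ∀ r u, ∑ i, A r i * (h i).eval (v + p ^ a * u) =
        c r + p ^ (a * (r.val + 1)) * (γ r).eval u := by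
  set M := taylorMat h v with hM
  set d := M.det with hd
  have key : ∀ r : Fin l, ∃ (c : ℤ) (q : ℤ[X]), taylor v (∑ i, C (M.adjugate r i) * h i) =
      C c + C d * X ^ (r.val + 1) + X ^ (l + 1) * q ∧ (m = 0 → ∃ q', q = C (p : ℤ) * q') := by
    intro r
    set G := taylor v (∑ i, C (M.adjugate r i) * h i) with hG
    have hco : ∀ j (hj : j < l), G.coeff (j + 1) = if r.val = j then d else 0 := by
      intro j hj
      have h1 : (M.adjugate * M) r ⟨j, hj⟩ = (d • (1 : Matrix (Fin l) (Fin l) ℤ)) r ⟨j, hj⟩ := by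
        rw [Matrix.adjugate_mul]
      rw [Matrix.mul_apply, Matrix.smul_apply, Matrix.one_apply] at h1
      rw [hG, map_sum, finsetSum_coeff]
      simp only [taylor_mul, taylor_C, coeff_C_mul]
      rw [show (if r.val = j then d else 0) = d • (if r = ⟨j, hj⟩ then (1 : ℤ) else 0) by
        simp [Fin.ext_iff]]
      exact h1
    have hdv : X ^ (l + 1) ∣ G - (C (G.coeff 0) + C d * X ^ (r.val + 1)) := by
      rw [X_pow_dvd_iff]
      intro j hj
      rcases j with _ | j
      · simp
      · rw [coeff_sub, coeff_add, hco j (by omega), coeff_C_mul, coeff_X_pow, coeff_C]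
        by_cases hrj : r.val = j <;> simp [hrj]
        intro h; omega
    obtain ⟨q, hq⟩ := hdv
    refine ⟨G.coeff 0, q, by rw [← hq]; ring, ?_⟩
    rintro rfl
    have hq2 : ∀ n, (p : ℤ) ∣ q.coeff n := by
      intro n
      have h1 : q.coeff n = G.coeff (n + (l + 1)) := by
        have h2 := congrArg (fun P => coeff P (n + (l + 1))) hq
        simp only [coeff_X_pow_mul, coeff_sub, coeff_add, coeff_C_mul, coeff_X_pow, coeff_C] at h2
        have h3 := r.2
        rw [if_neg (by omega), if_neg (by omega)] at h2
        rw [← h2]; ring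
      rw [h1, hG, map_sum, finsetSum_coeff]
      refine dvd_sum fun i _ => ?_
      rw [taylor_mul, taylor_C, coeff_C_mul]
      refine Dvd.dvd.mul_left ?_ _
      obtain ⟨g, hg⟩ := hh i
      rw [hg, map_add, taylor_mul, taylor_mul, taylor_C, taylor_C, coeff_add, coeff_C_mul,
        coeff_C_mul]
      refine dvd_add (Dvd.dvd.mul_left ?_ _) (dvd_mul_right _ _)
      have h4 : (taylor v (X ^ (0 + i.val + 1) : ℤ[X])).coeff (n + (l + 1)) = 0 := by
        apply coeff_eq_zero_of_natDegree_lt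
        rw [natDegree_taylor, natDegree_X_pow]
        have := i.2
        omega
      rw [h4]; exact dvd_zero _
    exact (C_dvd_iff_dvd_coeff _ _).2 hq2
  choose c q hq hq0 using key
  refine ⟨M.adjugate, c, fun r => C d * X ^ (r.val + 1) +
    C ((p : ℤ) ^ (a * (l - r.val))) * (X ^ (l + 1) * (q r).comp (C ((p : ℤ) ^ a) * X)),
    ⟨d, ?_, ?_⟩, ?_, ?_⟩
  · exact taylorMat_det hpk hv hD hh
  · intro r
    rcases ha with ha | ha
    · obtain ⟨q', hq'⟩ := hq0 r ha
      refine ⟨C ((p : ℤ) ^ (a * (l - r.val))) * (X ^ (l + 1) * q'.comp (C ((p : ℤ) ^ a) * X)), ?_⟩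
      beta_reduce
      rw [hq', mul_comp, C_comp]
      ring
    · have h1 : 1 ≤ a * (l - r.val) := Nat.one_le_iff_ne_zero.2 (by
        have := r.2
        exact Nat.mul_ne_zero (by omega) (by omega))
      obtain ⟨b, hb⟩ := Nat.exists_eq_add_of_le h1
      refine ⟨C ((p : ℤ) ^ b) * (X ^ (l + 1) * (q r).comp (C ((p : ℤ) ^ a) * X)), ?_⟩
      beta_reduce
      rw [hb, pow_add (p : ℤ), pow_one, C_mul]
      ring
  · intro r
    refine dvd_add (dvd_mul_left _ _) (Dvd.dvd.mul_left (Dvd.dvd.mul_right ?_ _) _)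
    exact pow_dvd_pow _ (by have := r.2; omega)
  · intro r u
    have h1 := congrArg (eval ((p : ℤ) ^ a * u)) (hq r)
    rw [taylor_eval, eval_finsetSum] at h1
    simp only [eval_mul, eval_C, eval_add, eval_pow, eval_X] at h1
    rw [add_comm v, h1]
    simp only [eval_mul, eval_C, eval_add, eval_pow, eval_X, eval_comp]
    have h2 : (p : ℤ) ^ (a * (r.val + 1)) * p ^ (a * (l - r.val)) = p ^ (a * (l + 1)) := by
      rw [← pow_add, ← mul_add]
      congr 2
      have := r.2
      omega
    rw [mul_add, ← mul_assoc _ ((p : ℤ) ^ (a * (l - r.val))), h2, mul_pow, mul_pow, ← pow_mul,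
      ← pow_mul]
    ring

end TaylorDet

end

section

open Polynomial

section Rescale

variable {p : ℕ} [hp : Fact p.Prime] {Ω ι : Type} {w : Ω → ℝ}

lemma e_split {N M : ℕ} (hM : M ≤ N) (K Z : ℤ) :
    e (((K + p ^ M * Z : ℤ) : ℝ) / (p : ℝ) ^ N) =
      e ((K : ℝ) / (p : ℝ) ^ N) * e ((Z : ℝ) / (p : ℝ) ^ (N - M)) := by
  have hp0 : (p : ℝ) ≠ 0 := by exact_mod_cast hp.out.ne_zero
  rw [← e_add]
  congr 1
  obtain ⟨L, rfl⟩ := Nat.exists_eq_add_of_le hM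
  rw [Nat.add_sub_cancel_left, pow_add]
  push_cast
  field_simp

lemma IsSys.rescale {m l : ℕ} (hpk : m + l < p) {v : ℤ} (hv : m = 0 ∨ ¬ (p : ℤ) ∣ v)
    {D : ℤ} (hD : ¬ (p : ℤ) ∣ D) {h : Fin l → ℤ[X]}
    (hh : ∀ i, ∃ g : ℤ[X], h i = C D * X ^ (m + i.val + 1) + C (p : ℤ) * g)
    {a : ℕ} (ha : m = 0 ∨ 1 ≤ a) {N : ℕ} (hN : l * a ≤ N) {S : Finset ι} {pt u : ι → ℤ}
    {f : ι → Ω → ℂ} (hs : IsSys p N h w S pt f) (hu : ∀ i ∈ S, pt i = v + p ^ a * u i) :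
    ∃ γ : Fin l → ℤ[X], Good p γ ∧ (∀ r, X ^ (r.val + 1) ∣ γ r) ∧
      IsSys p (N - l * a) γ w S u f := by
  obtain ⟨A, c, γ, hγ, hX, H⟩ := exists_normalize hpk hv hD hh a ha
  refine ⟨γ, hγ, hX, fun t => ?_⟩
  obtain ⟨τ, hτ, c', hc', hf⟩ := hs fun i => ∑ r, t r * p ^ (a * (l - 1 - r.val)) * A r i
  set K : ℤ := ∑ r, t r * p ^ (a * (l - 1 - r.val)) * c r with hK
  refine ⟨τ, hτ, c' * e ((K : ℝ) / (p : ℝ) ^ N), by simp [hc'], fun i hi ω => ?_⟩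
  rw [hf i hi ω, mul_assoc c' (e _) (e _), ← e_split hN]
  congr 4
  rw [Int.cast_inj, hK, mul_sum, ← sum_add_distrib]
  simp only [sum_mul]
  rw [sum_comm]
  refine sum_congr rfl fun r _ => ?_
  simp only [mul_assoc]
  rw [← mul_sum, ← mul_sum, hu i hi, H r (u i)]
  have h2 : (p : ℤ) ^ (l * a) = p ^ (a * (l - 1 - r.val)) * p ^ (a * (r.val + 1)) := by
    rw [← pow_add, ← mul_add]
    congr 1
    have := r.2
    rw [mul_comm]
    congr 1
    omega
  rw [h2]
  ring

lemma IsSys.project {m l N N' b q : ℕ} (hN : N' ≤ N) (hb : N' ≤ (m + 1) * b)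
    {γ : Fin (m + l) → ℤ[X]} (hX : ∀ r, X ^ (r.val + 1) ∣ γ r) {S A B : Finset ι} {pt : ι → ℤ}
    {f : ι → Ω → ℂ} (hs : IsSys p N γ w S pt f) (hA : A ⊆ S) (hB : B ⊆ S)
    (hBb : ∀ j ∈ B, ((p ^ b : ℕ) : ℤ) ∣ pt j) :
    IsSys p N' (fun i : Fin l => γ (Fin.natAdd m i)) (fun ω => w ω * ‖psum f B ω‖ ^ q) A pt f := by
  intro t
  obtain ⟨τ, hτ, c, hc, hf⟩ := hs (Fin.addCases (fun _ => 0) fun i => p ^ (N - N') * t i)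
  have key : ∀ i ∈ S, ∀ ω, f i (τ ω) = c * e (((∑ j, t j * (γ (Fin.natAdd m j)).eval (pt i) : ℤ) : ℝ)
      / (p : ℝ) ^ N') * f i ω := by
    intro i hi ω
    rw [hf i hi ω]
    have h1 := e_split (p := p) (show N - N' ≤ N by omega) 0
      (∑ j, t j * (γ (Fin.natAdd m j)).eval (pt i))
    rw [Nat.sub_sub_self hN] at h1
    simp only [Int.cast_zero, zero_div, e_zero, one_mul] at h1
    rw [← h1, Fin.sum_univ_add]
    simp only [Fin.addCases_left, Fin.addCases_right, zero_mul, sum_const_zero, mul_sum,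
      mul_assoc]
  refine ⟨τ, fun ω => ?_, c, hc, fun i hi ω => key i (hA hi) ω⟩
  have : psum f B (τ ω) = c * psum f B ω := by
    unfold psum
    rw [mul_sum]
    refine sum_congr rfl fun i hi => ?_
    rw [key i (hB hi) ω]
    have h2 : ((p ^ N' : ℕ) : ℤ) ∣ ∑ j, t j * (γ (Fin.natAdd m j)).eval (pt i) := by
      refine dvd_sum fun j _ => Dvd.dvd.mul_left ?_ _
      obtain ⟨g, hg⟩ := hX (Fin.natAdd m j)
      rw [hg, eval_mul, eval_pow, eval_X]
      refine Dvd.dvd.mul_right ?_ _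
      refine dvd_trans ?_ (pow_dvd_pow_of_dvd (hBb i hi) _)
      rw [← Nat.cast_pow, ← pow_mul]
      refine Int.natCast_dvd_natCast.2 (pow_dvd_pow p (hb.trans ?_))
      rw [mul_comm b]
      gcongr
      simp
    obtain ⟨z, hz⟩ := h2
    have hp0 : (p : ℝ) ≠ 0 := by exact_mod_cast hp.out.ne_zero
    rw [hz]
    push_cast
    rw [mul_div_cancel_left₀ _ (by positivity), e_int, mul_one]
  beta_reduce
  rw [this, norm_mul, hc, one_mul, hτ]

end Rescale

end

section

open Polynomial

section Steps

variable {p : ℕ} [hp : Fact p.Prime]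

lemma dvd_rescale {a n : ℕ} (han : a ≤ n) {x y v ux uy : ℤ} (hx : x = v + p ^ a * ux)
    (hy : y = v + p ^ a * uy) :
    ((p ^ (n - a) : ℕ) : ℤ) ∣ uy - ux ↔ ((p ^ n : ℕ) : ℤ) ∣ y - x := by
  have hp0 : (p : ℤ) ^ a ≠ 0 := pow_ne_zero _ (by exact_mod_cast hp.out.ne_zero)
  have h1 : y - x = p ^ a * (uy - ux) := by rw [hx, hy]; ring
  have h2 : ((p ^ n : ℕ) : ℤ) = p ^ a * (p ^ (n - a) : ℕ) := by
    push_cast; rw [← pow_add]; congr 1; omega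
  rw [h1, h2, mul_dvd_mul_iff_left hp0]

lemma Dec.classes {k : ℕ} (hk : k < p) {lam : ℝ} (h : Dec p k lam) :
    ∃ C : ℝ, 1 ≤ C ∧ ∀ (n : ℕ) (γ : Fin k → ℤ[X]), Good p γ →
    ∀ (Ω ι : Type) [Fintype Ω] (w : Ω → ℝ) (S : Finset ι) (pt : ι → ℤ) (f : ι → Ω → ℂ),
      (∀ ω, 0 ≤ w ω) → IsSys p (k * n) γ w S pt f → ∀ b ≤ n, ∀ A ∈ classes S pt (p ^ b),
        mom w (k * (k + 1)) (psum f A) ≤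
          C * (p : ℝ) ^ ((lam + (k * (k + 1) : ℝ) / 2 - 1) * (n - b)) *
            ∑ J ∈ PseudoPoly.classes A pt (p ^ n), mom w (k * (k + 1)) (psum f J) := by
  obtain ⟨C₀, hC, H⟩ := h
  refine ⟨C₀, hC, fun n γ hγ Ω ι _ w S pt f hw hs b hb A hA => ?_⟩
  obtain ⟨i₀, hi₀⟩ := classes_nonempty hA
  obtain ⟨D, hD, hh⟩ := hγ
  have hdiv : ∀ i ∈ A, pt i = pt i₀ + (p : ℤ) ^ b * ((pt i - pt i₀) / p ^ b) := by
    intro i hi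
    have := dvd_of_mem_classes hA hi₀ hi
    rw [Nat.cast_pow] at this
    rw [Int.mul_ediv_cancel' this]; ring
  obtain ⟨γ', hγ', -, hs'⟩ := (hs.mono (classes_subset hA)).rescale (m := 0) (by omega)
    (Or.inl rfl) hD (by simpa using hh) (a := b) (Or.inl rfl) (Nat.mul_le_mul_left k hb) hdiv
  rw [← Nat.mul_sub] at hs'
  have key := H (n - b) γ' hγ' Ω ι w A _ f hw hs'
  rw [Nat.cast_sub hb] at key
  rwa [classes_congr (q' := p ^ n) (pt' := pt)
    fun i hi j hj => dvd_rescale hb (hdiv i hi) (hdiv j hj)] at key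

lemma Dec.lower {m l : ℕ} (hk : m + l < p) {lam : ℝ} (h : Dec p l lam) :
    ∃ C : ℝ, 1 ≤ C ∧ ∀ (N : ℕ) (γ : Fin (m + l) → ℤ[X]), Good p γ →
    ∀ (Ω ι : Type) [Fintype Ω] (w : Ω → ℝ) (S : Finset ι) (pt : ι → ℤ) (f : ι → Ω → ℂ),
      (∀ ω, 0 ≤ w ω) → IsSys p N γ w S pt f →
      ∀ (a a' b q : ℕ) (η : ℤ) (A B : Finset ι), A ⊆ S → B ⊆ S → A.Nonempty →
        (∀ j ∈ B, ((p ^ b : ℕ) : ℤ) ∣ pt j - η) →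
        (∀ i ∈ A, ∀ j ∈ A, ((p ^ a : ℕ) : ℤ) ∣ pt j - pt i) →
        (∀ i ∈ A, ¬ (p : ℤ) ∣ pt i - η) →
        1 ≤ a → a ≤ a' → l * a' = (m + 1) * b → (m + 1) * b ≤ N →
        mom (fun ω => w ω * ‖psum f B ω‖ ^ q) (l * (l + 1)) (psum f A) ≤
          C * (p : ℝ) ^ ((lam + (l * (l + 1) : ℝ) / 2 - 1) * (a' - a)) *
            ∑ J ∈ PseudoPoly.classes A pt (p ^ a'),
              mom (fun ω => w ω * ‖psum f B ω‖ ^ q) (l * (l + 1)) (psum f J) := by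
  obtain ⟨C₀, hC, H⟩ := h
  refine ⟨C₀, hC, fun N γ hγ Ω ι _ w S pt f hw hs a a' b q η A B hAS hBS hne hB hA hsep ha haa'
    hab hN => ?_⟩
  obtain ⟨D, hD, hh⟩ := hγ
  obtain ⟨γ₁, ⟨D₁, hD₁, hh₁⟩, hX₁, hs₁⟩ := hs.rescale (m := 0) (by omega)
    (Or.inl rfl) hD (by simpa using hh) (a := 0) (Or.inl rfl) (by simp) (v := η)
    (u := fun i => pt i - η) (fun i _ => by simp)
  simp only [mul_zero, Nat.sub_zero] at hs₁
  have hs₂ := hs₁.project (N' := (m + 1) * b) (b := b) (q := q) hN le_rfl hX₁ hAS hBS hB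
  obtain ⟨i₀, hi₀⟩ := hne
  have hdiv : ∀ i ∈ A, pt i - η = (pt i₀ - η) + (p : ℤ) ^ a * ((pt i - pt i₀) / p ^ a) := by
    intro i hi
    have := hA i₀ hi₀ i hi
    rw [Nat.cast_pow] at this
    rw [Int.mul_ediv_cancel' this]; ring
  have hla : l * a ≤ (m + 1) * b := by rw [← hab]; exact Nat.mul_le_mul_left l haa'
  obtain ⟨γ₃, hγ₃, -, hs₃⟩ := hs₂.rescale (m := m) hk (Or.inr (hsep i₀ hi₀)) hD₁
    (fun i => by simpa using hh₁ (Fin.natAdd m i)) (a := a) (Or.inr ha) hla hdiv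
  rw [← hab, ← Nat.mul_sub] at hs₃
  have key := H (a' - a) γ₃ hγ₃ Ω ι _ A _ f (fun ω => mul_nonneg (hw ω) (by positivity)) hs₃
  rw [Nat.cast_sub haa'] at key
  rwa [classes_congr (q' := p ^ a') (pt' := fun i => pt i - η)
      fun i hi j hj => dvd_rescale haa' (hdiv i hi) (hdiv j hj),
    classes_congr (q' := p ^ a') (pt' := pt) fun i hi j hj => by simp] at key

lemma sum_e_eq_zero_aux {α : ℝ} {c : ℂ} (h : e α * c = c) (hα : e α ≠ 1) : c = 0 := by
  have : (e α - 1) * c = 0 := by rw [sub_mul, h, one_mul, sub_self]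
  exact (mul_eq_zero.1 this).resolve_left (sub_ne_zero.2 hα)

lemma e_div_ne_one {q : ℕ} (hq : 0 < q) {z : ℤ} (hz : ¬ (q : ℤ) ∣ z) :
    e ((z : ℝ) / q) ≠ 1 := by
  intro h
  unfold e at h
  rw [Complex.exp_eq_one_iff] at h
  obtain ⟨n, hn⟩ := h
  apply hz
  refine ⟨n, ?_⟩
  have h1 : (2 * Real.pi * Complex.I : ℂ) ≠ 0 := Complex.two_pi_I_ne_zero
  have h2 : (((z : ℝ) / q : ℝ) : ℂ) = n := by
    apply mul_left_cancel₀ h1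
    rw [hn]; ring
  have h3 : (z : ℝ) / q = n := by exact_mod_cast h2
  have hq' : (q : ℝ) ≠ 0 := by positivity
  field_simp at h3
  exact_mod_cast h3

open Classical in
/-- Orthogonality: the one-dimensional case. -/
lemma dec_one : Dec p 1 0 := by
  refine ⟨1, le_rfl, fun n γ hγ Ω ι _ w S pt f hw hs => ?_⟩
  obtain ⟨D, hD, hh⟩ := hγ
  obtain ⟨g, hg⟩ := hh 0
  have hq : 0 < p ^ n := pow_pos hp.out.pos n
  -- `γ 0` preserves and reflects congruences
  have hcong : ∀ x y : ℤ, ((p ^ n : ℕ) : ℤ) ∣ (γ 0).eval y - (γ 0).eval x →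
      ((p ^ n : ℕ) : ℤ) ∣ y - x := by
    intro x y hxy
    obtain ⟨r, hr⟩ : (y - x) ∣ g.eval y - g.eval x := sub_dvd_eval_sub _ _ _
    have h1 : (γ 0).eval y - (γ 0).eval x = (D + p * r) * (y - x) := by
      rw [hg]; simp; linear_combination (p : ℤ) * hr
    rw [h1] at hxy
    refine IsCoprime.dvd_of_dvd_mul_left ?_ hxy
    rw [Nat.cast_pow]
    refine IsCoprime.pow_left ?_
    rw [IsCoprime.add_mul_left_right_iff]
    exact (Prime.coprime_iff_not_dvd (Nat.prime_iff_prime_int.1 hp.out)).2 hD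
  have horth : ∀ A ∈ classes S pt (p ^ n), ∀ B ∈ classes S pt (p ^ n), A ≠ B →
      ∑ ω, (w ω : ℂ) * (psum f A ω * starRingEnd ℂ (psum f B ω)) = 0 := by
    intro A hA B hB hAB
    have : ∀ i ∈ A, ∀ j ∈ B, ∑ ω, (w ω : ℂ) * (f i ω * starRingEnd ℂ (f j ω)) = 0 := by
      intro i hi j hj
      have hiS := classes_subset hA hi
      have hjS := classes_subset hB hj
      have hnd : ¬ ((p ^ n : ℕ) : ℤ) ∣ (γ 0).eval (pt i) - (γ 0).eval (pt j) := by
        intro hd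
        have hd' := hcong _ _ hd
        apply hAB
        refine classes_eq_of_mem hA hB (i := i) hi ?_
        rw [class_eq_filter hB hj]
        simp only [mem_filter]
        exact ⟨hiS, hd'⟩
      obtain ⟨τ, hτ, c, hc, hf⟩ := hs fun _ => 1
      refine sum_e_eq_zero_aux ?_ (e_div_ne_one hq hnd)
      conv_rhs => rw [← Equiv.sum_comp τ]
      rw [mul_sum]
      refine sum_congr rfl fun ω _ => ?_
      have hcc : c * starRingEnd ℂ c = 1 := by
        rw [Complex.mul_conj, Complex.normSq_eq_norm_sq, hc]; simp
      have hee : ∀ x y : ℝ, e x * starRingEnd ℂ (e y) = e (x - y) := by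
        intro x y
        rw [conj_e, ← e_add, sub_eq_add_neg]
      rw [hτ, hf i hiS, hf j hjS]
      simp only [map_mul, univ_unique, Fin.default_eq_zero, one_mul, sum_singleton]
      have h5 := hee (((γ 0).eval (pt i) : ℤ) / (p : ℝ) ^ (1 * n))
        (((γ 0).eval (pt j) : ℤ) / (p : ℝ) ^ (1 * n))
      rw [← sub_div, one_mul] at h5
      push_cast
      rw [← h5]
      linear_combination (-(w ω : ℂ) * f i ω * starRingEnd ℂ (f j ω) *
        e (((γ 0).eval (pt i) : ℤ) / (p : ℝ) ^ n) *
        starRingEnd ℂ (e (((γ 0).eval (pt j) : ℤ) / (p : ℝ) ^ n))) * hcc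
    calc ∑ ω, (w ω : ℂ) * (psum f A ω * starRingEnd ℂ (psum f B ω))
        = ∑ i ∈ A, ∑ j ∈ B, ∑ ω, (w ω : ℂ) * (f i ω * starRingEnd ℂ (f j ω)) := by
          simp only [psum, map_sum, sum_mul_sum]
          simp only [mul_sum]
          rw [sum_comm]
          exact sum_congr rfl fun i _ => sum_comm
      _ = 0 := sum_eq_zero fun i hi => sum_eq_zero fun j hj => this i hi j hj
  have hsq : ∀ F : Ω → ℂ, ((mom w 2 F : ℝ) : ℂ) = ∑ ω, (w ω : ℂ) * (F ω * starRingEnd ℂ (F ω)) := by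
    intro F
    unfold mom
    push_cast
    refine sum_congr rfl fun ω _ => ?_
    rw [Complex.mul_conj, Complex.normSq_eq_norm_sq]
    push_cast; ring
  have hfin : mom w 2 (psum f S) = ∑ J ∈ classes S pt (p ^ n), mom w 2 (psum f J) := by
    have : ((mom w 2 (psum f S) : ℝ) : ℂ) =
        ((∑ J ∈ classes S pt (p ^ n), mom w 2 (psum f J) : ℝ) : ℂ) := by
      rw [hsq]
      push_cast
      simp only [psum_classes f S pt (p ^ n), map_sum, sum_mul_sum]
      simp only [mul_sum]
      rw [sum_comm]
      refine sum_congr rfl fun A hA => ?_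
      rw [sum_comm]
      rw [sum_eq_single A, hsq]
      · intro B hB hBA
        exact horth A hA B hB hBA.symm
      · exact fun h => absurd hA h
    exact_mod_cast this
  norm_num
  exact hfin.le

end Steps

end

section

open Polynomial

/-- A translation equivariant family, bundled. -/
structure Sys (p k : ℕ) where
  n : ℕ
  γ : Fin k → ℤ[X]
  good : Good p γ
  Ω : Type
  ι : Type
  fin : Fintype Ω
  w : Ω → ℝ
  S : Finset ι
  pt : ι → ℤ
  f : ι → Ω → ℂ
  nonneg : ∀ ω, 0 ≤ w ω
  sys : IsSys p (k * n) γ w S pt f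

namespace Sys

attribute [instance] Sys.fin

variable {p k : ℕ}

/-- The classes modulo `p ^ a`. -/
def cl (σ : Sys p k) (a : ℕ) : Finset (Finset σ.ι) := classes σ.S σ.pt (p ^ a)

/-- The moment of the partial sum over `A`. -/
def m (σ : Sys p k) (s : ℕ) (A : Finset σ.ι) : ℝ := mom σ.w s (psum σ.f A)

/-- The right-hand side of the decoupling inequality. -/
def E (σ : Sys p k) : ℝ := ∑ J ∈ σ.cl σ.n, σ.m (k * (k + 1)) J

/-- Separation modulo `p`. -/
def Sep (σ : Sys p k) (A B : Finset σ.ι) : Prop :=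
  ∀ i ∈ A, ∀ j ∈ B, ¬ (p : ℤ) ∣ σ.pt i - σ.pt j

/-- A mixed moment. -/
def mix (σ : Sys p k) (s t : ℕ) (A B : Finset σ.ι) : ℝ :=
  ∑ ω, σ.w ω * (‖psum σ.f A ω‖ ^ s * ‖psum σ.f B ω‖ ^ t)

open Classical in
/-- The bilinear sum over separated classes. -/
def U (σ : Sys p k) (s t a b : ℕ) : ℝ :=
  ∑ A ∈ σ.cl a, ∑ B ∈ σ.cl b, if σ.Sep A B then σ.mix s t A B else 0

variable (σ : Sys p k)

lemma m_nonneg (s : ℕ) (A : Finset σ.ι) : 0 ≤ σ.m s A := mom_nonneg σ.nonneg _ _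

lemma E_nonneg : 0 ≤ σ.E := sum_nonneg fun _ _ => σ.m_nonneg _ _

lemma mix_nonneg (s t : ℕ) (A B : Finset σ.ι) : 0 ≤ σ.mix s t A B :=
  sum_nonneg fun ω _ => mul_nonneg (σ.nonneg ω) (by positivity)

lemma U_nonneg (s t a b : ℕ) : 0 ≤ σ.U s t a b := by
  refine sum_nonneg fun A _ => sum_nonneg fun B _ => ?_
  split_ifs
  exacts [σ.mix_nonneg _ _ _ _, le_rfl]

lemma Sep.symm {σ : Sys p k} {A B : Finset σ.ι} (h : σ.Sep A B) : σ.Sep B A :=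
  fun i hi j hj hd => h j hj i hi (by rwa [← Int.dvd_neg, neg_sub])

lemma Sep.mono {σ : Sys p k} {A B A' B' : Finset σ.ι} (h : σ.Sep A B) (hA : A' ⊆ A)
    (hB : B' ⊆ B) : σ.Sep A' B' := fun i hi j hj => h i (hA hi) j (hB hj)

lemma mix_symm (s t : ℕ) (A B : Finset σ.ι) : σ.mix s t A B = σ.mix t s B A := by
  unfold mix; simp only [mul_comm]

lemma U_symm (s t a b : ℕ) : σ.U s t a b = σ.U t s b a := by
  classical
  unfold U
  rw [sum_comm]
  refine sum_congr rfl fun B _ => sum_congr rfl fun A _ => ?_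
  rw [σ.mix_symm]
  exact if_congr ⟨Sep.symm, Sep.symm⟩ rfl rfl

lemma holder_geom {α : Type*} (s : Finset α) {F G : α → ℝ} (hF : ∀ x ∈ s, 0 ≤ F x)
    (hG : ∀ x ∈ s, 0 ≤ G x) {θ : ℝ} (h0 : 0 < θ) (h1 : θ < 1) :
    ∑ x ∈ s, F x ^ θ * G x ^ (1 - θ) ≤ (∑ x ∈ s, F x) ^ θ * (∑ x ∈ s, G x) ^ (1 - θ) := by
  have h2 : 0 < 1 - θ := by linarith
  have hpq : (1 / θ).HolderConjugate (1 / (1 - θ)) := by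
    rw [Real.holderConjugate_iff]
    refine ⟨by rw [lt_div_iff₀ h0]; linarith, ?_⟩
    simp
  have := Real.inner_le_Lp_mul_Lq_of_nonneg s hpq (f := fun x => F x ^ θ)
    (g := fun x => G x ^ (1 - θ)) (fun x hx => Real.rpow_nonneg (hF x hx) _)
    (fun x hx => Real.rpow_nonneg (hG x hx) _)
  refine this.trans (le_of_eq ?_)
  simp only [one_div_one_div]
  congr 2
  · refine sum_congr rfl fun x hx => ?_
    rw [← Real.rpow_mul (hF x hx), mul_one_div, div_self h0.ne', Real.rpow_one]
  · refine sum_congr rfl fun x hx => ?_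
    rw [← Real.rpow_mul (hG x hx), mul_one_div, div_self h2.ne', Real.rpow_one]

/-- Hölder's inequality for the bilinear sums. -/
lemma U_holder {s t s₁ t₁ s₂ t₂ : ℕ} {θ : ℝ} (h0 : 0 < θ) (h1 : θ < 1)
    (hs : (s : ℝ) = θ * s₁ + (1 - θ) * s₂) (ht : (t : ℝ) = θ * t₁ + (1 - θ) * t₂) (a b : ℕ) :
    σ.U s t a b ≤ σ.U s₁ t₁ a b ^ θ * σ.U s₂ t₂ a b ^ (1 - θ) := by
  classical
  have hU : ∀ s t, σ.U s t a b = ∑ x ∈ σ.cl a ×ˢ σ.cl b ×ˢ (univ : Finset σ.Ω),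
      (if σ.Sep x.1 x.2.1 then σ.w x.2.2 else 0) *
        (‖psum σ.f x.1 x.2.2‖ ^ s * ‖psum σ.f x.2.1 x.2.2‖ ^ t) := by
    intro s t
    rw [sum_product]
    refine sum_congr rfl fun A _ => ?_
    rw [sum_product]
    refine sum_congr rfl fun B _ => ?_
    split_ifs
    · rfl
    · simp
  rw [hU, hU, hU]
  refine le_trans (sum_le_sum ?_) (holder_geom _ (fun x _ => ?_) (fun x _ => ?_) h0 h1)
  · intro x _
    set c : ℝ := if σ.Sep x.1 x.2.1 then σ.w x.2.2 else 0
    have hc : 0 ≤ c := by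
      simp only [c]; split_ifs
      exacts [σ.nonneg _, le_rfl]
    refine le_of_eq ?_
    have hX := norm_nonneg (psum σ.f x.1 x.2.2)
    have hY := norm_nonneg (psum σ.f x.2.1 x.2.2)
    generalize ‖psum σ.f x.1 x.2.2‖ = X at *
    generalize ‖psum σ.f x.2.1 x.2.2‖ = Y at *
    have h2 : 0 < 1 - θ := by linarith
    have hpow : ∀ {Z : ℝ}, 0 ≤ Z → ∀ {u u₁ u₂ : ℕ}, (u : ℝ) = θ * u₁ + (1 - θ) * u₂ →
        Z ^ u = (Z ^ u₁) ^ θ * (Z ^ u₂) ^ (1 - θ) := by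
      intro Z hZ u u₁ u₂ hu
      rw [← Real.rpow_natCast, ← Real.rpow_natCast, ← Real.rpow_natCast, ← Real.rpow_mul hZ,
        ← Real.rpow_mul hZ, hu, Real.rpow_add_of_nonneg hZ (by positivity) (by positivity)]
      ring_nf
    have hcc : c = c ^ θ * c ^ (1 - θ) := by
      rw [← Real.rpow_add_of_nonneg hc h0.le h2.le]; simp
    rw [Real.mul_rpow hc (by positivity), Real.mul_rpow (by positivity) (by positivity),
      Real.mul_rpow hc (by positivity), Real.mul_rpow (by positivity) (by positivity),
      hpow hX hs, hpow hY ht]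
    conv_lhs => rw [hcc]
    ring
  all_goals
    refine mul_nonneg ?_ (by positivity)
    split_ifs
    exacts [σ.nonneg _, le_rfl]

lemma mix_zero (t : ℕ) (A B : Finset σ.ι) : σ.mix 0 t A B = σ.m t B := by
  simp [mix, m, mom]

lemma mix_le (s t : ℕ) (A B : Finset σ.ι) : σ.mix s t A B ≤ σ.m (s + t) A + σ.m (s + t) B := by
  unfold mix m mom
  rw [← sum_add_distrib]
  refine sum_le_sum fun ω _ => ?_
  rw [← mul_add]
  refine mul_le_mul_of_nonneg_left ?_ (σ.nonneg ω)
  have hX := norm_nonneg (psum σ.f A ω)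
  have hY := norm_nonneg (psum σ.f B ω)
  rw [pow_add, pow_add]
  rcases le_total ‖psum σ.f A ω‖ ‖psum σ.f B ω‖ with h | h
  · have : ‖psum σ.f A ω‖ ^ s * ‖psum σ.f B ω‖ ^ t ≤
        ‖psum σ.f B ω‖ ^ s * ‖psum σ.f B ω‖ ^ t := by gcongr
    have : 0 ≤ ‖psum σ.f A ω‖ ^ s * ‖psum σ.f A ω‖ ^ t := by positivity
    linarith
  · have : ‖psum σ.f A ω‖ ^ s * ‖psum σ.f B ω‖ ^ t ≤
        ‖psum σ.f A ω‖ ^ s * ‖psum σ.f A ω‖ ^ t := by gcongr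
    have : 0 ≤ ‖psum σ.f B ω‖ ^ s * ‖psum σ.f B ω‖ ^ t := by positivity
    linarith

variable [hp : Fact p.Prime]

lemma card_cl_le (a : ℕ) : (#(σ.cl a) : ℝ) ≤ (p : ℝ) ^ a := by
  exact_mod_cast card_classes_le σ.S σ.pt (pow_pos hp.out.pos a)

/-- Rescaled decoupling, summed over the classes modulo `p ^ b`. -/
lemma exists_sum_m_le (hk : k < p) {lam : ℝ} (h : Dec p k lam) :
    ∃ C : ℝ, 1 ≤ C ∧ ∀ (σ : Sys p k), ∀ b ≤ σ.n, ∑ B ∈ σ.cl b, σ.m (k * (k + 1)) B ≤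
      C * (p : ℝ) ^ ((lam + (k * (k + 1) : ℝ) / 2 - 1) * (σ.n - b)) * σ.E := by
  obtain ⟨C, hC, H⟩ := h.classes hk
  refine ⟨C, hC, fun σ b hb => ?_⟩
  unfold E cl
  rw [sum_classes_refine (pow_dvd_pow p hb), mul_sum]
  refine sum_le_sum fun A hA => ?_
  exact H σ.n σ.γ σ.good σ.Ω σ.ι σ.w σ.S σ.pt σ.f σ.nonneg σ.sys b hb A hA

lemma U_zero_le (t a b : ℕ) : σ.U 0 t a b ≤ (p : ℝ) ^ a * ∑ B ∈ σ.cl b, σ.m t B := by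
  classical
  unfold U
  calc _ ≤ ∑ A ∈ σ.cl a, ∑ B ∈ σ.cl b, σ.m t B := by
        refine sum_le_sum fun A _ => sum_le_sum fun B _ => ?_
        split_ifs
        · rw [mix_zero]
        · exact σ.m_nonneg _ _
    _ = #(σ.cl a) * ∑ B ∈ σ.cl b, σ.m t B := by simp
    _ ≤ _ := by
        gcongr
        · exact sum_nonneg fun _ _ => σ.m_nonneg _ _
        · exact σ.card_cl_le a

lemma U_le_add (s t a b : ℕ) : σ.U s t a b ≤
    (p : ℝ) ^ b * ∑ A ∈ σ.cl a, σ.m (s + t) A + (p : ℝ) ^ a * ∑ B ∈ σ.cl b, σ.m (s + t) B := by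
  classical
  unfold U
  calc _ ≤ ∑ A ∈ σ.cl a, ∑ B ∈ σ.cl b, (σ.m (s + t) A + σ.m (s + t) B) := by
        refine sum_le_sum fun A _ => sum_le_sum fun B _ => ?_
        split_ifs
        · exact σ.mix_le s t A B
        · exact add_nonneg (σ.m_nonneg _ _) (σ.m_nonneg _ _)
    _ = #(σ.cl b) * ∑ A ∈ σ.cl a, σ.m (s + t) A + #(σ.cl a) * ∑ B ∈ σ.cl b, σ.m (s + t) B := by
        simp [sum_add_distrib, mul_sum]
    _ ≤ _ := by
        gcongr
        · exact sum_nonneg fun _ _ => σ.m_nonneg _ _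
        · exact σ.card_cl_le b
        · exact sum_nonneg fun _ _ => σ.m_nonneg _ _
        · exact σ.card_cl_le a

/-- Refining the first family of classes by lower-dimensional decoupling. -/
lemma exists_U_lower {l r : ℕ} (hkl : r + l = k) (hk : k < p) {lam : ℝ}
    (h : Dec p l lam) :
    ∃ C : ℝ, 1 ≤ C ∧ ∀ (σ : Sys p k) (a a' b t : ℕ), 1 ≤ a → 1 ≤ b → a ≤ a' →
      l * a' = (r + 1) * b → (r + 1) * b ≤ k * σ.n →
      σ.U (l * (l + 1)) t a b ≤ C * (p : ℝ) ^ ((lam + (l * (l + 1) : ℝ) / 2 - 1) * (a' - a)) *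
        σ.U (l * (l + 1)) t a' b := by
  subst hkl
  classical
  obtain ⟨C, hC, H⟩ := h.lower hk
  refine ⟨C, hC, fun σ a a' b t ha hb haa' hab hbn => ?_⟩
  have hmix : ∀ A B, σ.mix (l * (l + 1)) t A B =
      mom (fun ω => σ.w ω * ‖psum σ.f B ω‖ ^ t) (l * (l + 1)) (psum σ.f A) := by
    intro A B
    unfold mix mom
    refine sum_congr rfl fun ω _ => by ring
  set K := C * (p : ℝ) ^ ((lam + (l * (l + 1) : ℝ) / 2 - 1) * (a' - a)) with hK
  have hK0 : 0 ≤ K := by positivity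
  have hmain : ∀ A ∈ σ.cl a, ∀ B ∈ σ.cl b, (if σ.Sep A B then σ.mix (l * (l + 1)) t A B else 0) ≤
      K * ∑ J ∈ classes A σ.pt (p ^ a'), if σ.Sep J B then σ.mix (l * (l + 1)) t J B else 0 := by
    intro A hA B hB
    split_ifs with hsep
    · obtain ⟨j₀, hj₀⟩ := classes_nonempty hB
      have := H (( r + l) * σ.n) σ.γ σ.good σ.Ω σ.ι σ.w σ.S σ.pt σ.f σ.nonneg σ.sys a a' b t
        (σ.pt j₀) A B (classes_subset hA) (classes_subset hB) (classes_nonempty hA)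
        (fun j hj => dvd_of_mem_classes hB hj₀ hj) (fun i hi j hj => dvd_of_mem_classes hA hi hj)
        (fun i hi => hsep i hi j₀ hj₀) ha haa' hab hbn
      rw [hmix]
      refine this.trans (le_of_eq ?_)
      rw [hK]
      congr 1
      refine sum_congr rfl fun J hJ => ?_
      rw [if_pos (hsep.mono (classes_subset hJ) le_rfl), hmix]
    · refine mul_nonneg hK0 (sum_nonneg fun J _ => ?_)
      split_ifs
      exacts [σ.mix_nonneg _ _ _ _, le_rfl]
  have hU : σ.U (l * (l + 1)) t a' b = ∑ A ∈ σ.cl a, ∑ B ∈ σ.cl b,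
      ∑ J ∈ classes A σ.pt (p ^ a'), if σ.Sep J B then σ.mix (l * (l + 1)) t J B else 0 := by
    unfold U cl
    rw [sum_classes_refine (pow_dvd_pow p haa')]
    exact sum_congr rfl fun A _ => sum_comm
  rw [hU, U, mul_sum]
  refine sum_le_sum fun A hA => ?_
  rw [mul_sum]
  exact sum_le_sum fun B hB => hmain A hA B hB

/-- Trivial refinement of the second family of classes. -/
lemma U_refine {b b' : ℕ} (hb : b ≤ b') (s t a : ℕ) :
    σ.U s (t + 1) a b ≤ (p : ℝ) ^ (b' * t) * σ.U s (t + 1) a b' := by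
  classical
  have hU : σ.U s (t + 1) a b' = ∑ A ∈ σ.cl a, ∑ B ∈ σ.cl b,
      ∑ J ∈ classes B σ.pt (p ^ b'), if σ.Sep A J then σ.mix s (t + 1) A J else 0 := by
    unfold U cl
    refine sum_congr rfl fun A _ => ?_
    rw [sum_classes_refine (pow_dvd_pow p hb)]
  rw [hU, U, mul_sum]
  refine sum_le_sum fun A hA => ?_
  rw [mul_sum]
  refine sum_le_sum fun B hB => ?_
  have hnn : ∀ J, 0 ≤ if σ.Sep A J then σ.mix s (t + 1) A J else 0 := by
    intro J
    split_ifs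
    exacts [σ.mix_nonneg _ _ _ _, le_rfl]
  split_ifs with hsep
  · have h1 := mom_psum_le (w := fun ω => σ.w ω * ‖psum σ.f A ω‖ ^ s)
      (fun ω => mul_nonneg (σ.nonneg ω) (by positivity)) σ.f B σ.pt (pow_pos hp.out.pos b') t
    have h2 : ∀ J, σ.mix s (t + 1) A J =
        mom (fun ω => σ.w ω * ‖psum σ.f A ω‖ ^ s) (t + 1) (psum σ.f J) := by
      intro J
      unfold mix mom
      refine sum_congr rfl fun ω _ => by ring
    rw [h2]
    refine h1.trans (le_of_eq ?_)
    rw [Nat.cast_pow, ← pow_mul]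
    congr 1
    refine sum_congr rfl fun J hJ => ?_
    rw [if_pos (hsep.mono le_rfl (classes_subset hJ)), h2]
  · exact mul_nonneg (by positivity) (sum_nonneg fun J _ => hnn J)

end Sys

end

section

namespace Sys

variable {p k : ℕ} [hp : Fact p.Prime]

/-- The exponent of square-root cancellation for the bilinear sums. -/
def nu (n a b s t : ℝ) : ℝ := a + b + (n - a) * s / 2 + (n - b) * t / 2 - n

/-- The bilinear sums with `l * a = (k - l + 1) * b` gain a factor `p ^ (-y * b)`. -/
def Gain (p k M l : ℕ) (lam y : ℝ) : Prop :=
  ∀ ε > (0 : ℝ), ∃ C : ℝ, 1 ≤ C ∧ ∀ (σ : Sys p k) (a b : ℕ), 1 ≤ b →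
    l * a = (k - l + 1) * b → k.factorial ^ M ∣ b → k ^ M * b ≤ σ.n →
    σ.U (l * (l + 1)) (k * (k + 1) - l * (l + 1)) a b ≤
      C * (p : ℝ) ^ (nu σ.n a b (l * (l + 1)) (k * (k + 1) - l * (l + 1)) +
        lam * σ.n - y * b + ε * σ.n) * σ.E

lemma holder_bound {q E V₁ V₂ C₁ C₂ e₁ e₂ θ : ℝ} (hq : 0 < q) (hE : 0 ≤ E) (hV₁ : 0 ≤ V₁)
    (hV₂ : 0 ≤ V₂) (hC₁ : 1 ≤ C₁) (hC₂ : 1 ≤ C₂) (h0 : 0 < θ) (h1 : θ < 1)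
    (h₁ : V₁ ≤ C₁ * q ^ e₁ * E) (h₂ : V₂ ≤ C₂ * q ^ e₂ * E) :
    V₁ ^ θ * V₂ ^ (1 - θ) ≤ C₁ * C₂ * q ^ (θ * e₁ + (1 - θ) * e₂) * E := by
  have h2 : 0 < 1 - θ := by linarith
  have hC₁' : C₁ ^ θ ≤ C₁ := by
    simpa using Real.rpow_le_rpow_of_exponent_le hC₁ h1.le
  have hC₂' : C₂ ^ (1 - θ) ≤ C₂ := by
    simpa using Real.rpow_le_rpow_of_exponent_le hC₂ (show 1 - θ ≤ 1 by linarith)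
  calc V₁ ^ θ * V₂ ^ (1 - θ)
      ≤ (C₁ * q ^ e₁ * E) ^ θ * (C₂ * q ^ e₂ * E) ^ (1 - θ) := by gcongr
    _ = C₁ ^ θ * C₂ ^ (1 - θ) * (q ^ (e₁ * θ) * q ^ (e₂ * (1 - θ))) * (E ^ θ * E ^ (1 - θ)) := by
        rw [Real.mul_rpow (by positivity) hE, Real.mul_rpow (by positivity) (by positivity),
          Real.mul_rpow (by positivity) hE, Real.mul_rpow (by positivity) (by positivity),
          ← Real.rpow_mul hq.le, ← Real.rpow_mul hq.le]
        ring
    _ = C₁ ^ θ * C₂ ^ (1 - θ) * q ^ (θ * e₁ + (1 - θ) * e₂) * E := by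
        rw [← Real.rpow_add hq, ← Real.rpow_add_of_nonneg hE h0.le h2.le]
        simp only [add_sub_cancel, Real.rpow_one]
        ring_nf
    _ ≤ _ := by gcongr

lemma one_lt_p : (1 : ℝ) < p := by exact_mod_cast hp.out.one_lt

lemma Gain.mono {M l : ℕ} {lam y y' : ℝ} (h : Gain p k M l lam y) (hy : y' ≤ y) :
    Gain p k M l lam y' := by
  intro ε hε
  obtain ⟨C, hC, H⟩ := h ε hε
  refine ⟨C, hC, fun σ a b hb hab hd hn => (H σ a b hb hab hd hn).trans ?_⟩
  have := σ.E_nonneg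
  have := (one_lt_p (p := p)).le
  gcongr

lemma gain_base (hk : k < p) {lam : ℝ} (hlam : 0 ≤ lam) (h : Dec p k lam) {l : ℕ} (hl : 1 ≤ l)
    (hlk : l < k) : Gain p k 1 l lam (-(k * (k * (k + 1)))) := by
  intro ε hε
  obtain ⟨C, hC, H⟩ := exists_sum_m_le hk h
  refine ⟨2 * C, by linarith, fun σ a b hb hab _ hn => ?_⟩
  rw [pow_one] at hn
  have hak : a ≤ k * b := by
    have h1 : a ≤ l * a := Nat.le_mul_of_pos_left a hl
    have h2 : (k - l + 1) * b ≤ k * b := Nat.mul_le_mul_right b (by omega)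
    omega
  have hbk : b ≤ k * b := Nat.le_mul_of_pos_left b (by omega)
  have hU := σ.U_le_add (l * (l + 1)) (k * (k + 1) - l * (l + 1)) a b
  have hle : l * (l + 1) ≤ k * (k + 1) := Nat.mul_le_mul hlk.le (by omega)
  rw [Nat.add_sub_cancel' hle] at hU
  have hq := one_lt_p (p := p)
  have hE := σ.E_nonneg
  have hHa := H σ a (by omega)
  have hHb := H σ b (by omega)
  set e₀ := nu σ.n a b (l * (l + 1)) (k * (k + 1) - l * (l + 1)) +
        lam * σ.n - -(k * (k * (k + 1))) * b + ε * σ.n with he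
  have hka : (a : ℝ) ≤ k * b := by exact_mod_cast hak
  have hle' : (l * (l + 1) : ℝ) ≤ k * (k + 1) := by exact_mod_cast hle
  have hk1 : (1 : ℝ) ≤ k := by exact_mod_cast (by omega : 1 ≤ k)
  have hl1 : (1 : ℝ) ≤ l := by exact_mod_cast hl
  have hP : (2 : ℝ) ≤ k * (k + 1) := by nlinarith
  have ha0 : (0 : ℝ) ≤ a := by positivity
  have hb0 : (0 : ℝ) ≤ b := by positivity
  have hn0 : (0 : ℝ) ≤ σ.n := by positivity
  have hbk' : (b : ℝ) ≤ k * b := by nlinarith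
  have hbound : (a : ℝ) * (l * (l + 1)) / 2 + b * (k * (k + 1) - l * (l + 1)) / 2 ≤
      k * (k * (k + 1)) * b := by
    have h1 : (a : ℝ) * (l * (l + 1)) ≤ (k * b) * (k * (k + 1)) := by gcongr
    have h2 : (b : ℝ) * (k * (k + 1) - l * (l + 1)) ≤ (k * b) * (k * (k + 1)) := by
      have : (0 : ℝ) ≤ l * (l + 1) := by positivity
      have h3 : (b : ℝ) * (k * (k + 1) - l * (l + 1)) ≤ b * (k * (k + 1)) := by
        gcongr; linarith
      have h4 : (b : ℝ) * (k * (k + 1)) ≤ (k * b) * (k * (k + 1)) := by gcongr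
      linarith
    linarith
  have hεn : 0 ≤ ε * σ.n := by positivity
  have e1 : (b : ℝ) + (lam + (k * (k + 1) : ℝ) / 2 - 1) * (σ.n - a) ≤ e₀ := by
    rw [he]; unfold nu
    have : 0 ≤ lam * a := by positivity
    have : 0 ≤ ((k * (k + 1) : ℝ) / 2 - 1) * a := mul_nonneg (by linarith) ha0
    linarith
  have e2 : (a : ℝ) + (lam + (k * (k + 1) : ℝ) / 2 - 1) * (σ.n - b) ≤ e₀ := by
    rw [he]; unfold nu
    have : 0 ≤ lam * b := by positivity
    have : 0 ≤ ((k * (k + 1) : ℝ) / 2 - 1) * b := mul_nonneg (by linarith) hb0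
    linarith
  have key : ∀ x y z : ℝ, x + y ≤ e₀ → ∀ T, T ≤ C * (p : ℝ) ^ y * σ.E →
      (p : ℝ) ^ x * T ≤ C * (p : ℝ) ^ e₀ * σ.E := by
    intro x y z hxy T hT
    calc (p : ℝ) ^ x * T ≤ (p : ℝ) ^ x * (C * (p : ℝ) ^ y * σ.E) := by gcongr
      _ = C * (p : ℝ) ^ (x + y) * σ.E := by rw [Real.rpow_add (by linarith)]; ring
      _ ≤ _ := by gcongr; exact hq.le
  have k1 := key b _ 0 e1 _ hHa
  have k2 := key a _ 0 e2 _ hHb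
  rw [Real.rpow_natCast] at k1 k2
  linarith

/-- The arithmetic of one Hölder step. -/
lemma exists_step {M l m : ℕ} (hM : 1 ≤ M) (hl : 1 ≤ l) (hm : 1 ≤ m) {n a b : ℕ}
    (hab : l * a = (m + 1) * b) (hd : (l + m).factorial ^ (M + 1) ∣ b)
    (hn : (l + m) ^ (M + 1) * b ≤ n) :
    (l + m).factorial ^ M ∣ a ∧ a ≤ (l + m) * b ∧ (l + m) ^ M * a ≤ n ∧
      ∃ a', m * a' = (l + 1) * a ∧ b ≤ a' ∧ a' ≤ n := by
  have h1 : (l + m).factorial ^ M ∣ a := by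
    obtain ⟨c, rfl⟩ := hd
    obtain ⟨r, hr⟩ : l ∣ (l + m).factorial := Nat.dvd_factorial hl (by omega)
    refine ⟨(m + 1) * r * c, Nat.eq_of_mul_eq_mul_left hl ?_⟩
    rw [hab, pow_succ]
    conv_lhs => rw [mul_assoc ((l + m).factorial ^ M)]; enter [2, 2, 1]; rw [hr]
    ring
  have h2 : a ≤ (l + m) * b := by
    have h1 : a ≤ l * a := Nat.le_mul_of_pos_left a hl
    have h2 : (m + 1) * b ≤ (l + m) * b := Nat.mul_le_mul_right b (by omega)
    omega
  have h3 : (l + m) ^ M * a ≤ n := by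
    refine le_trans ?_ hn
    rw [pow_succ, mul_assoc]
    exact Nat.mul_le_mul_left _ h2
  obtain ⟨c, hc⟩ : m ∣ a :=
    (Nat.dvd_factorial hm (by omega)).trans ((dvd_pow_self _ (by omega)).trans h1)
  refine ⟨h1, h2, h3, (l + 1) * c, by rw [hc]; ring, ?_, ?_⟩
  · have h5 : (l * m) * b ≤ (l * m) * ((l + 1) * c) := by
      have : (l * m) * ((l + 1) * c) = (l + 1) * (l * a) := by rw [hc]; ring
      rw [this, hab, ← mul_assoc]
      exact Nat.mul_le_mul_right b (by nlinarith)
    exact Nat.le_of_mul_le_mul_left h5 (by positivity)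
  · have h6 : (l + 1) * c ≤ (l + m) * a := by
      have : c ≤ a := by rw [hc]; exact Nat.le_mul_of_pos_left c hm
      exact Nat.mul_le_mul (by omega) this
    refine h6.trans (le_trans ?_ h3)
    exact Nat.mul_le_mul_right a (Nat.le_self_pow (by omega) _)

end Sys

end

section

namespace Sys

variable {p : ℕ} [hp : Fact p.Prime]

lemma bound_mono {q e₁ e₂ C E : ℝ} (hq : 1 ≤ q) (hC : 0 ≤ C) (hE : 0 ≤ E) (h : e₁ ≤ e₂) :
    C * q ^ e₁ * E ≤ C * q ^ e₂ * E :=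
  mul_le_mul_of_nonneg_right (mul_le_mul_of_nonneg_left
    (Real.rpow_le_rpow_of_exponent_le hq h) hC) hE

/-- A bound for the bilinear sums of index `l` used as input in the Hölder step. -/
def GainLow (p k M l : ℕ) (lam y : ℝ) : Prop :=
  ∀ ε > (0 : ℝ), ∃ C : ℝ, 1 ≤ C ∧ ∀ (σ : Sys p k) (a b : ℕ), 1 ≤ b →
    (l + 1) * a = (k - l) * b → k.factorial ^ M ∣ b → k ^ M * b ≤ σ.n →
    σ.U (l * (l + 1)) (k * (k + 1) - l * (l + 1)) a b ≤
      C * (p : ℝ) ^ (nu σ.n a b (l * (l + 1)) (k * (k + 1) - l * (l + 1)) +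
        lam * σ.n - y * b + ε * σ.n) * σ.E

lemma gainLow_zero {k M : ℕ} (hk0 : 1 ≤ k) (hk : k < p) {lam : ℝ} (h : Dec p k lam) :
    GainLow p k M 0 lam lam := by
  intro ε hε
  obtain ⟨C, hC, H⟩ := exists_sum_m_le hk h
  refine ⟨C, hC, fun σ a b hb hab _ hn => ?_⟩
  have hbn : b ≤ σ.n := le_trans (Nat.le_mul_of_pos_left b (by positivity)) hn
  have hq := one_lt_p (p := p)
  have hE := σ.E_nonneg
  have hU := σ.U_zero_le (k * (k + 1)) a b
  have hHb := H σ b hbn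
  simp only [zero_mul, Nat.sub_zero]
  refine hU.trans ?_
  calc (p : ℝ) ^ a * ∑ B ∈ σ.cl b, σ.m (k * (k + 1)) B
      ≤ (p : ℝ) ^ a * (C * (p : ℝ) ^ ((lam + (k * (k + 1) : ℝ) / 2 - 1) * (σ.n - b)) * σ.E) := by
        gcongr
    _ = C * (p : ℝ) ^ (a + (lam + (k * (k + 1) : ℝ) / 2 - 1) * (σ.n - b)) * σ.E := by
        rw [Real.rpow_add (by linarith), Real.rpow_natCast]; ring
    _ ≤ _ := by
        refine bound_mono hq.le (by linarith) hE ?_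
        unfold nu
        have : 0 ≤ ε * σ.n := by positivity
        push_cast
        linarith

lemma gainLow_of_gain {M l m : ℕ} (hM : 1 ≤ M) (hl : 1 ≤ l) (hm : 1 ≤ m) (hk : l + 1 + m < p)
    (hdec : ∀ ε > (0 : ℝ), Dec p l ε) {lam y : ℝ} (h : Gain p (l + 1 + m) M l lam y) :
    GainLow p (l + 1 + m) M l lam y := by
  intro ε hε
  obtain ⟨C₁, hC₁, H₁⟩ := exists_U_lower (k := l + 1 + m) (l := l) (r := m + 1) (by omega) hk
    (hdec (ε / 2) (by positivity))
  obtain ⟨C₂, hC₂, H₂⟩ := h (ε / 2) (by positivity)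
  refine ⟨C₁ * C₂, by nlinarith, fun σ a b hb hab hd hn => ?_⟩
  have hkl : l + 1 + m - l = m + 1 := by omega
  rw [hkl] at H₂ hab
  have hq := one_lt_p (p := p)
  have hE := σ.E_nonneg
  obtain ⟨c, hc⟩ : l ∣ b :=
    (Nat.dvd_factorial hl (by omega)).trans ((dvd_pow_self _ (by omega)).trans hd)
  have hac : l * ((m + 2) * c) = (m + 1 + 1) * b := by rw [hc]; ring
  have ha1 : 1 ≤ a := by
    rcases Nat.eq_zero_or_pos a with rfl | h
    · simp at hab; omega
    · exact h
  have haa' : a ≤ (m + 2) * c := by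
    have h5 : (l * (l + 1)) * a ≤ (l * (l + 1)) * ((m + 2) * c) := by
      calc (l * (l + 1)) * a = l * ((m + 1) * b) := by rw [← hab]; ring
        _ = l * (m + 1) * b := by ring
        _ ≤ (l + 1) * (m + 2) * b := Nat.mul_le_mul_right b (by nlinarith)
        _ = (l * (l + 1)) * ((m + 2) * c) := by rw [hc]; ring
    exact Nat.le_of_mul_le_mul_left h5 (by positivity)
  have hbn : (l + 1 + m) * b ≤ σ.n :=
    le_trans (Nat.mul_le_mul_right b (Nat.le_self_pow (by omega) _)) hn
  have hbn' : (m + 1 + 1) * b ≤ σ.n :=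
    (Nat.mul_le_mul_right b (by omega)).trans hbn
  have hcn : (m + 2) * c ≤ σ.n := by
    refine le_trans (Nat.mul_le_mul_left _ ?_) hbn'
    rw [hc]; exact Nat.le_mul_of_pos_left c hl
  have h1 := H₁ σ a ((m + 2) * c) b ((l + 1 + m) * (l + 1 + m + 1) - l * (l + 1)) ha1 hb haa' hac
    (hbn'.trans (Nat.le_mul_of_pos_left _ (by omega)))
  have h2 := H₂ σ ((m + 2) * c) b hb hac hd hn
  refine h1.trans ?_
  refine (mul_le_mul_of_nonneg_left h2 (by positivity)).trans ?_
  rw [show ∀ x y z w v : ℝ, x * y * (z * w * v) = x * z * (y * w) * v by intros; ring,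
    ← Real.rpow_add (by linarith)]
  refine bound_mono hq.le (by nlinarith) hE ?_
  unfold nu
  have h3 : (((m + 2) * c : ℕ) : ℝ) ≤ σ.n := by exact_mod_cast hcn
  have h4 : (0 : ℝ) ≤ a := by positivity
  have h5 : ε / 2 * ((((m + 2) * c : ℕ) : ℝ) - a) ≤ ε / 2 * σ.n :=
    mul_le_mul_of_nonneg_left (by linarith) (by positivity)
  linarith

lemma gain_step {M l m : ℕ} (hM : 1 ≤ M) (hl : 1 ≤ l) (hm : 1 ≤ m) (hk : l + m < p)
    (hdec : ∀ ε > (0 : ℝ), Dec p m ε) {lam y₁ y₂ : ℝ} (h₁ : Gain p (l + m) M m lam y₁)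
    (h₂ : GainLow p (l + m) (M + 1) (l - 1) lam y₂) :
    Gain p (l + m) (M + 1) l lam (y₁ / l + m / (m + 1) * y₂) := by
  intro ε hε
  obtain ⟨C₀, hC₀, H₀⟩ := exists_U_lower (k := l + m) (l := m) (r := l) (by omega) hk
    (hdec (ε / 2) (by positivity))
  obtain ⟨C₁, hC₁, H₁⟩ := h₁ (ε / 2) (by positivity)
  obtain ⟨C₂, hC₂, H₂⟩ := h₂ ε (by positivity)
  refine ⟨(C₀ * C₁) * C₂, by nlinarith [mul_le_mul hC₀ hC₁ zero_le_one (by linarith)],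
    fun σ a b hb hab hd hn => ?_⟩
  have hq := one_lt_p (p := p)
  have hE := σ.E_nonneg
  rw [show l + m - l + 1 = m + 1 by omega] at hab
  obtain ⟨hda, hak, han, a', ha', hba', han'⟩ := exists_step hM hl hm hab hd hn
  have ha1 : 1 ≤ a := by
    rcases Nat.eq_zero_or_pos a with rfl | h
    · simp at hab; omega
    · exact h
  have hbn2 : (l + 1) * a ≤ (l + m) * σ.n := by
    refine Nat.mul_le_mul (by omega) (le_trans ?_ han)
    exact Nat.le_mul_of_pos_left a (by positivity)
  have k0 := H₀ σ b a' a ((l + m) * (l + m + 1) - m * (m + 1)) hb ha1 hba' ha' hbn2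
  have k1 := H₁ σ a' a ha1 (by rw [ha', show l + m - m + 1 = l + 1 by omega]) hda han
  have k2 := H₂ σ a b hb (by
    rw [show l - 1 + 1 = l by omega, show l + m - (l - 1) = m + 1 by omega, hab]) hd hn
  have hV₁ : σ.U ((l + m) * (l + m + 1) - m * (m + 1)) (m * (m + 1)) a b ≤
      (C₀ * C₁) * (p : ℝ) ^ (nu σ.n b a (m * (m + 1)) ((l + m) * (l + m + 1) - m * (m + 1)) +
        lam * σ.n - y₁ * a + ε * σ.n) * σ.E := by
    rw [U_symm]
    refine k0.trans ?_
    refine (mul_le_mul_of_nonneg_left k1 (by positivity)).trans ?_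
    rw [show ∀ x y z w v : ℝ, x * y * (z * w * v) = x * z * (y * w) * v by intros; ring,
      ← Real.rpow_add (by linarith)]
    refine bound_mono hq.le (by nlinarith) hE ?_
    unfold nu
    have h3 : (a' : ℝ) ≤ σ.n := by exact_mod_cast han'
    have h4 : (0 : ℝ) ≤ b := by positivity
    have h5 : ε / 2 * ((a' : ℝ) - b) ≤ ε / 2 * σ.n :=
      mul_le_mul_of_nonneg_left (by linarith) (by positivity)
    push_cast
    linarith
  have hl0 : (0 : ℝ) < l := by exact_mod_cast hl
  have hm0 : (0 : ℝ) < m := by exact_mod_cast hm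
  have hlc : ((l - 1 : ℕ) : ℝ) = l - 1 := by push_cast [hl]; ring
  set θ : ℝ := 1 / (m + 1) with hθ
  have hθ' : 1 - θ = m / (m + 1) := by rw [hθ]; field_simp; ring
  have h0 : 0 < θ := by positivity
  have h1 : θ < 1 := by
    have : 0 < 1 - θ := by rw [hθ']; positivity
    linarith
  have hle : l * (l + 1) ≤ (l + m) * (l + m + 1) := Nat.mul_le_mul (by omega) (by omega)
  have hle1 : (l - 1) * (l - 1 + 1) ≤ (l + m) * (l + m + 1) := Nat.mul_le_mul (by omega) (by omega)
  have hle2 : m * (m + 1) ≤ (l + m) * (l + m + 1) := Nat.mul_le_mul (by omega) (by omega)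
  have hs : ((l * (l + 1) : ℕ) : ℝ) = θ * (((l + m) * (l + m + 1) - m * (m + 1) : ℕ) : ℝ) +
      (1 - θ) * (((l - 1) * (l - 1 + 1) : ℕ) : ℝ) := by
    rw [hθ', Nat.cast_sub hle2, hθ]
    push_cast [hlc]
    field_simp
    ring
  have ht : (((l + m) * (l + m + 1) - l * (l + 1) : ℕ) : ℝ) = θ * ((m * (m + 1) : ℕ) : ℝ) +
      (1 - θ) * (((l + m) * (l + m + 1) - (l - 1) * (l - 1 + 1) : ℕ) : ℝ) := by
    rw [hθ', Nat.cast_sub hle1, Nat.cast_sub hle, hθ]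
    push_cast [hlc]
    field_simp
    ring
  refine (σ.U_holder h0 h1 hs ht a b).trans ?_
  refine (holder_bound (by linarith) hE (σ.U_nonneg _ _ _ _) (σ.U_nonneg _ _ _ _)
    (by nlinarith) hC₂ h0 h1 hV₁ k2).trans (le_of_eq ?_)
  congr 3
  have hab' : (a : ℝ) = (m + 1) * b / l := by
    rw [eq_div_iff hl0.ne', mul_comm]
    exact_mod_cast hab
  unfold nu
  rw [hθ', hθ, hab', hlc]
  push_cast
  field_simp
  ring

end Sys

end

section

namespace Sys

variable {p : ℕ} [hp : Fact p.Prime]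

lemma gain_succ {k M : ℕ} (hM : 1 ≤ M) (hk : k < p)
    (hdec : ∀ l, 1 ≤ l → l < k → ∀ ε > (0 : ℝ), Dec p l ε) {lam x : ℝ} (h : Dec p k lam)
    (hx : ∀ m : ℕ, 1 ≤ m → m < k → Gain p k M m lam (x * m * (k - m))) :
    ∀ l : ℕ, 1 ≤ l → l < k → Gain p k (M + 1) l lam (x * l * (k - l) + (k - l) * lam / k) := by
  intro l hl
  induction l, hl using Nat.le_induction with
  | base =>
    intro h1
    obtain ⟨m, rfl⟩ : ∃ m, k = 1 + m := ⟨k - 1, by omega⟩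
    have hm : 1 ≤ m := by omega
    have hm0 : (0 : ℝ) < m := by exact_mod_cast hm
    have := gain_step hM le_rfl hm hk (hdec m hm (by omega)) (hx m hm (by omega))
      (gainLow_zero (M := M + 1) (by omega) hk h)
    refine this.mono (le_of_eq ?_)
    push_cast
    field_simp
    ring
  | succ l hl ih =>
    intro h1
    obtain ⟨m, rfl⟩ : ∃ m, k = l + 1 + m := ⟨k - (l + 1), by omega⟩
    have hm : 1 ≤ m := by omega
    have hm0 : (0 : ℝ) < m := by exact_mod_cast hm
    have hl0 : (0 : ℝ) < l := by exact_mod_cast hl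
    have := gain_step hM (by omega : 1 ≤ l + 1) hm hk (hdec m hm (by omega)) (hx m hm (by omega))
      (gainLow_of_gain (by omega) hl hm hk (hdec l hl (by omega)) (ih (by omega)))
    refine this.mono (le_of_eq ?_)
    push_cast
    field_simp
    ring

lemma gain_iterate {k : ℕ} (hk : k < p)
    (hdec : ∀ l, 1 ≤ l → l < k → ∀ ε > (0 : ℝ), Dec p l ε) {lam : ℝ} (hlam : 0 ≤ lam)
    (h : Dec p k lam) (M : ℕ) :
    ∀ l : ℕ, 1 ≤ l → l < k → Gain p k (M + 1) l lam
      ((-(k * (k * (k + 1))) + M * (lam / k ^ 2)) * l * (k - l)) := by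
  induction M with
  | zero =>
    intro l hl hlk
    refine (gain_base hk hlam h hl hlk).mono ?_
    have h1 : (1 : ℝ) ≤ l := by exact_mod_cast hl
    have h2 : (1 : ℝ) ≤ k - l := by
      have : (l : ℝ) + 1 ≤ k := by exact_mod_cast hlk
      linarith
    have h3 : (1 : ℝ) ≤ l * (k - l) := by nlinarith
    have h4 : (0 : ℝ) ≤ k * (k * (k + 1)) := by positivity
    push_cast
    nlinarith
  | succ M ih =>
    intro l hl hlk
    refine (gain_succ (by omega) hk hdec h ih l hl hlk).mono ?_
    have hk0 : (0 : ℝ) < k := by exact_mod_cast (by omega : 0 < k)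
    have h2 : (0 : ℝ) ≤ k - l := by
      have : (l : ℝ) + 1 ≤ k := by exact_mod_cast hlk
      linarith
    have h1 : lam / k ^ 2 * (l * (k - l)) ≤ (k - l) * lam / k := by
      rw [div_mul_eq_mul_div, div_le_div_iff₀ (by positivity) hk0]
      have : 0 ≤ lam * (k - l) * k * (k - l) := by positivity
      nlinarith
    push_cast
    linarith

lemma exists_gain {k : ℕ} (hk2 : 2 ≤ k) (hk : k < p)
    (hdec : ∀ l, 1 ≤ l → l < k → ∀ ε > (0 : ℝ), Dec p l ε) {ε : ℝ} (hε : 0 < ε) {Y : ℝ}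
    (hY : 0 ≤ Y) :
    ∃ M : ℕ, 1 ≤ M ∧ ∀ lam : ℝ, ε ≤ lam → Dec p k lam → Gain p k M 1 lam Y := by
  have hk0 : (2 : ℝ) ≤ k := by exact_mod_cast hk2
  obtain ⟨M, hM⟩ := exists_nat_ge ((Y + k * (k * (k + 1))) / (ε / k ^ 2))
  rw [div_le_iff₀ (by positivity)] at hM
  refine ⟨M + 1, by omega, fun lam hlam h => ?_⟩
  refine (gain_iterate hk hdec (hε.le.trans hlam) h M 1 le_rfl (by omega)).mono ?_
  have h1 : M * (ε / k ^ 2) ≤ M * (lam / k ^ 2) := by gcongr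
  push_cast
  nlinarith

end Sys

end

section

namespace Sys

variable {p : ℕ} [hp : Fact p.Prime]

lemma exists_U_one_le {k : ℕ} (hk2 : 2 ≤ k) (hk : k < p)
    (hdec : ∀ l, 1 ≤ l → l < k → ∀ ε > (0 : ℝ), Dec p l ε) {ε : ℝ} (hε : 0 < ε) :
    ∃ κ > (0 : ℝ), κ ≤ ε ∧ ∀ lam : ℝ, ε ≤ lam → Dec p k lam → ∃ C : ℝ, 1 ≤ C ∧ ∃ n₀ : ℕ,
      ∀ σ : Sys p k, n₀ ≤ σ.n → σ.U 2 (k * (k + 1) - 2) 1 1 ≤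
        C * (p : ℝ) ^ ((lam - κ + (k * (k + 1) : ℝ) / 2 - 1) * σ.n) * σ.E := by
  obtain ⟨M, hM, HM⟩ := exists_gain hk2 hk hdec hε (Y := (k * (k + 1) : ℝ) / 2) (by positivity)
  have hk0 : (0 : ℝ) < k := by exact_mod_cast (by omega : 0 < k)
  refine ⟨min (1 / (4 * k ^ M)) ε, by positivity, min_le_right _ _, fun lam hlam h => ?_⟩
  obtain ⟨C₁, hC₁, H₁⟩ := exists_U_lower (k := k) (l := 1) (r := k - 1) (by omega) hk
    (dec_one (p := p))
  obtain ⟨C₂, hC₂, H₂⟩ := HM lam hlam h (1 / (4 * k ^ M)) (by positivity)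
  have hD : 0 < k ^ M * k.factorial ^ M := by positivity
  refine ⟨C₁ * C₂, by nlinarith, 2 * (k ^ M * k.factorial ^ M), fun σ hn => ?_⟩
  have hq := one_lt_p (p := p)
  have hE := σ.E_nonneg
  set D := k ^ M * k.factorial ^ M with hDdef
  obtain ⟨c, hc⟩ : ∃ c, c = σ.n / D := ⟨_, rfl⟩
  have hc1 : D * c ≤ σ.n := by rw [hc]; exact Nat.mul_div_le _ _
  have hc2 : σ.n ≤ 2 * (D * c) := by
    have h1 := Nat.lt_mul_div_succ σ.n hD
    rw [← hc] at h1
    have h2 : 1 ≤ c := by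
      rw [hc, Nat.one_le_div_iff hD]; omega
    nlinarith
  have hc0 : 1 ≤ c := by
    rw [hc, Nat.one_le_div_iff hD]; omega
  obtain ⟨b, hb⟩ : ∃ b, b = k.factorial ^ M * c := ⟨_, rfl⟩
  have hb1 : 1 ≤ b := by rw [hb]; exact Nat.mul_pos (by positivity) hc0
  have hbn : k ^ M * b ≤ σ.n := by rw [hb, ← mul_assoc]; exact hc1
  have hbn2 : σ.n ≤ 2 * (k ^ M * b) := by rw [hb]; exact hc2.trans_eq (by rw [hDdef]; ring)
  have hkb : k * b ≤ k * σ.n :=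
    Nat.mul_le_mul_left k ((Nat.le_mul_of_pos_left b (by positivity)).trans hbn)
  have hP : 6 ≤ k * (k + 1) := by nlinarith
  obtain ⟨t, ht⟩ : ∃ t, k * (k + 1) = t + 3 := ⟨k * (k + 1) - 3, by omega⟩
  have htr : (k * (k + 1) : ℝ) = t + 3 := by exact_mod_cast ht
  have e1 := σ.U_refine hb1 2 t 1
  have e2 := H₁ σ 1 (k * b) b (t + 1) le_rfl hb1 (Nat.mul_pos (by omega) hb1)
    (by rw [one_mul, Nat.sub_add_cancel (by omega)]) (by rwa [Nat.sub_add_cancel (by omega)])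
  have e3 := H₂ σ (k * b) b hb1 (by rw [one_mul, Nat.sub_add_cancel (by omega)])
    (by rw [hb]; exact dvd_mul_right _ _) hbn
  have hz : (0 : ℝ) + ((1 : ℕ) * ((1 : ℕ) + 1) : ℝ) / 2 - 1 = 0 := by norm_num
  rw [hz, zero_mul, Real.rpow_zero, mul_one] at e2
  rw [ht] at e3 ⊢
  norm_num at e2 e3
  rw [show t + 3 - 2 = t + 1 by omega] at e3 ⊢
  refine e1.trans ((mul_le_mul_of_nonneg_left (e2.trans
    (mul_le_mul_of_nonneg_left e3 (by positivity))) (by positivity)).trans ?_)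
  rw [show ∀ x y z w v : ℝ, x * (y * (z * w * v)) = y * z * (x * w) * v by intros; ring,
    ← Real.rpow_natCast, ← Real.rpow_add (by linarith)]
  refine bound_mono hq.le (by nlinarith) hE ?_
  have hbr : (σ.n : ℝ) ≤ 2 * (k ^ M * b) := by exact_mod_cast hbn2
  have h4 : 1 / (4 * (k : ℝ) ^ M) * σ.n ≤ b / 2 := by
    rw [div_mul_eq_mul_div, div_le_div_iff₀ (by positivity) (by positivity)]
    nlinarith
  have h5 : min (1 / (4 * (k : ℝ) ^ M)) ε * σ.n ≤ 1 / (4 * (k : ℝ) ^ M) * σ.n :=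
    mul_le_mul_of_nonneg_right (min_le_left _ _) (by positivity)
  have h6 : (((k : ℝ) ^ M)⁻¹ * (1 / 4)) = 1 / (4 * (k : ℝ) ^ M) := by field_simp
  unfold nu
  push_cast
  rw [htr]
  rw [h6]
  nlinarith

lemma norm_sum_pow_le {q P : ℕ} (hq : 1 ≤ q) (hP : 2 ≤ P) :
    ∃ C : ℝ, 1 ≤ C ∧ ∀ (ι : Type) [DecidableEq ι] (s : Finset ι) (z : ι → ℂ), #s ≤ q →
    ‖∑ i ∈ s, z i‖ ^ P ≤
      2 * ∑ i ∈ s, ‖z i‖ ^ P +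
        C * ∑ i ∈ s, ∑ j ∈ s, if i = j then 0 else ‖z i‖ ^ 2 * ‖z j‖ ^ (P - 2) := by
  have hq0 : (1 : ℝ) ≤ q := by exact_mod_cast hq
  have hP0 : (2 : ℝ) ≤ P := by exact_mod_cast hP
  set R : ℝ := 2 * q * P with hR
  have hR1 : 1 ≤ R := by nlinarith
  refine ⟨q ^ P * R ^ (P - 2), one_le_mul_of_one_le_of_one_le (one_le_pow₀ hq0)
    (one_le_pow₀ hR1), fun ι _ s z hs => ?_⟩
  have hsq : (#s : ℝ) ≤ q := by exact_mod_cast hs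
  have hn1 : 0 ≤ ∑ i ∈ s, ‖z i‖ ^ P := sum_nonneg fun _ _ => by positivity
  have hn3 : ∀ i j, 0 ≤ if i = j then 0 else ‖z i‖ ^ 2 * ‖z j‖ ^ (P - 2) := by
    intro i j; split_ifs <;> positivity
  rcases s.eq_empty_or_nonempty with rfl | hne
  · simp [show P ≠ 0 by omega]
  obtain ⟨i, hi, hmax⟩ := s.exists_max_image (fun i => ‖z i‖) hne
  by_cases hbr : ∃ j ∈ s, j ≠ i ∧ ‖z i‖ ≤ R * ‖z j‖
  · obtain ⟨j, hj, hji, hz⟩ := hbr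
    have h1 : ‖∑ i ∈ s, z i‖ ≤ q * ‖z i‖ := by
      calc ‖∑ i ∈ s, z i‖ ≤ ∑ i ∈ s, ‖z i‖ := norm_sum_le _ _
        _ ≤ #s * ‖z i‖ := by
          rw [← nsmul_eq_mul]; exact sum_le_card_nsmul _ _ _ hmax
        _ ≤ _ := by gcongr
    have h2 : ‖z i‖ ^ P ≤ ‖z i‖ ^ 2 * (R * ‖z j‖) ^ (P - 2) := by
      calc ‖z i‖ ^ P = ‖z i‖ ^ 2 * ‖z i‖ ^ (P - 2) := by rw [← pow_add]; congr 1; omega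
        _ ≤ _ := by gcongr
    have h3 : ‖z i‖ ^ 2 * ‖z j‖ ^ (P - 2) ≤
        ∑ i ∈ s, ∑ j ∈ s, if i = j then 0 else ‖z i‖ ^ 2 * ‖z j‖ ^ (P - 2) := by
      have := single_le_sum (f := fun j => if i = j then 0 else ‖z i‖ ^ 2 * ‖z j‖ ^ (P - 2))
        (fun j _ => hn3 i j) hj
      simp only [if_neg hji.symm] at this
      exact this.trans (single_le_sum (f := fun i => ∑ j ∈ s, if i = j then 0 else
        ‖z i‖ ^ 2 * ‖z j‖ ^ (P - 2)) (fun i _ => sum_nonneg fun j _ => hn3 i j) hi)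
    calc ‖∑ i ∈ s, z i‖ ^ P ≤ (q * ‖z i‖) ^ P := by gcongr
      _ = q ^ P * ‖z i‖ ^ P := mul_pow _ _ _
      _ ≤ q ^ P * (‖z i‖ ^ 2 * (R * ‖z j‖) ^ (P - 2)) := by gcongr
      _ = q ^ P * R ^ (P - 2) * (‖z i‖ ^ 2 * ‖z j‖ ^ (P - 2)) := by rw [mul_pow]; ring
      _ ≤ q ^ P * R ^ (P - 2) * ∑ i ∈ s, ∑ j ∈ s, if i = j then 0 else
            ‖z i‖ ^ 2 * ‖z j‖ ^ (P - 2) := by gcongr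
      _ ≤ _ := by linarith
  · push Not at hbr
    have h1 : ‖∑ i ∈ s, z i‖ ≤ (1 + 1 / (2 * P)) * ‖z i‖ := by
      rw [← add_sum_erase s _ hi]
      calc ‖z i + ∑ j ∈ s.erase i, z j‖ ≤ ‖z i‖ + ∑ j ∈ s.erase i, ‖z j‖ :=
            (norm_add_le _ _).trans (by gcongr; exact norm_sum_le _ _)
        _ ≤ ‖z i‖ + #(s.erase i) * (‖z i‖ / R) := by
            gcongr
            rw [← nsmul_eq_mul]
            refine sum_le_card_nsmul _ _ _ fun j hj => ?_
            rw [mem_erase] at hj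
            rw [le_div_iff₀ (by linarith), mul_comm]
            exact (hbr j hj.2 hj.1).le
        _ ≤ ‖z i‖ + q * (‖z i‖ / R) := by
            gcongr
            exact_mod_cast (card_le_card (erase_subset _ _)).trans hs
        _ = _ := by rw [hR]; field_simp
    have h2 : (1 + 1 / (2 * P) : ℝ) ^ P ≤ 2 := by
      calc (1 + 1 / (2 * P) : ℝ) ^ P ≤ Real.exp (1 / (2 * P)) ^ P := by
            gcongr; rw [add_comm]; exact Real.add_one_le_exp _
        _ = Real.exp (1 / 2) := by rw [← Real.exp_nat_mul]; congr 1; field_simp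
        _ ≤ 2 := by
          have h3 : Real.exp (1 / 2) ^ 2 = Real.exp 1 := by rw [← Real.exp_nat_mul]; norm_num
          have := Real.exp_one_lt_d9
          nlinarith [Real.exp_pos (1 / 2)]
    have h3 : ‖z i‖ ^ P ≤ ∑ i ∈ s, ‖z i‖ ^ P :=
      single_le_sum (f := fun i => ‖z i‖ ^ P) (fun _ _ => by positivity) hi
    have h4 : 0 ≤ ∑ i ∈ s, ∑ j ∈ s, if i = j then 0 else ‖z i‖ ^ 2 * ‖z j‖ ^ (P - 2) :=
      sum_nonneg fun i _ => sum_nonneg fun j _ => hn3 i j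
    calc ‖∑ i ∈ s, z i‖ ^ P ≤ ((1 + 1 / (2 * P)) * ‖z i‖) ^ P := by gcongr
      _ = (1 + 1 / (2 * P)) ^ P * ‖z i‖ ^ P := mul_pow _ _ _
      _ ≤ 2 * ∑ i ∈ s, ‖z i‖ ^ P := by gcongr
      _ ≤ _ := by have : 0 ≤ (q : ℝ) ^ P * R ^ (P - 2) := by positivity
                  nlinarith

end Sys

end

section

namespace Sys

variable {p : ℕ}

lemma Sep_of_ne {k : ℕ} (σ : Sys p k) {A B : Finset σ.ι} (hA : A ∈ σ.cl 1) (hB : B ∈ σ.cl 1)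
    (h : A ≠ B) : σ.Sep A B := by
  intro i hi j hj hd
  refine h (classes_eq_of_mem hA hB (i := i) hi ?_)
  rw [class_eq_filter hB hj]
  simp only [mem_filter]
  exact ⟨classes_subset hA hi, by simpa using hd⟩

variable [hp : Fact p.Prime]

lemma narrow_le {k n : ℕ} (hk : k < p) {B : ℝ}
    (hB : ∀ σ : Sys p k, σ.n = n → σ.m (k * (k + 1)) σ.S ≤ B * σ.E) (σ : Sys p k)
    (hn : σ.n = n + 1) : ∑ I ∈ σ.cl 1, σ.m (k * (k + 1)) I ≤ B * σ.E := by
  unfold E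
  have h1n : 1 ≤ σ.n := by omega
  rw [cl, cl, sum_classes_refine (pow_dvd_pow p h1n), mul_sum]
  refine sum_le_sum fun A hA => ?_
  obtain ⟨i₀, hi₀⟩ := classes_nonempty hA
  obtain ⟨D, hD, hh⟩ := σ.good
  have hdiv : ∀ i ∈ A, σ.pt i = σ.pt i₀ + (p : ℤ) ^ 1 * ((σ.pt i - σ.pt i₀) / p ^ 1) := by
    intro i hi
    have := dvd_of_mem_classes hA hi₀ hi
    rw [Nat.cast_pow] at this
    rw [Int.mul_ediv_cancel' this]; ring
  obtain ⟨γ', hγ', -, hs'⟩ := (σ.sys.mono (classes_subset hA)).rescale (m := 0) (by omega)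
    (Or.inl rfl) hD (by simpa using hh) (a := 1) (Or.inl rfl) (Nat.mul_le_mul_left k h1n) hdiv
  rw [← Nat.mul_sub, hn, Nat.add_sub_cancel] at hs'
  have key := hB ⟨n, γ', hγ', σ.Ω, σ.ι, σ.fin, σ.w, A, _, σ.f, σ.nonneg, hs'⟩ rfl
  unfold E cl at key
  simp only at key
  have hn' : n = σ.n - 1 := by omega
  subst hn'
  rwa [classes_congr (q' := p ^ σ.n) (pt' := σ.pt)
    fun i hi j hj => dvd_rescale h1n (hdiv i hi) (hdiv j hj)] at key

lemma broad_narrow {k : ℕ} (hk : 2 ≤ k) :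
    ∃ C : ℝ, 1 ≤ C ∧ ∀ σ : Sys p k, σ.m (k * (k + 1)) σ.S ≤
      2 * ∑ I ∈ σ.cl 1, σ.m (k * (k + 1)) I + C * σ.U 2 (k * (k + 1) - 2) 1 1 := by
  classical
  obtain ⟨C, hC, H⟩ := norm_sum_pow_le (q := p) (P := k * (k + 1)) hp.out.one_le
    (by nlinarith)
  refine ⟨C, hC, fun σ => ?_⟩
  have hU : ∑ A ∈ σ.cl 1, ∑ B ∈ σ.cl 1,
      (if A = B then 0 else σ.mix 2 (k * (k + 1) - 2) A B) ≤ σ.U 2 (k * (k + 1) - 2) 1 1 := by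
    unfold U
    refine sum_le_sum fun A hA => sum_le_sum fun B hB => ?_
    split_ifs with h1 h2 h2
    · exact σ.mix_nonneg _ _ _ _
    · exact le_rfl
    · exact le_rfl
    · exact absurd (σ.Sep_of_ne hA hB h1) h2
  refine le_trans ?_ (add_le_add_right (mul_le_mul_of_nonneg_left hU (by linarith)) _)
  have hswap : ∑ A ∈ σ.cl 1, ∑ B ∈ σ.cl 1,
      (if A = B then 0 else σ.mix 2 (k * (k + 1) - 2) A B) =
      ∑ ω, σ.w ω * ∑ A ∈ σ.cl 1, ∑ B ∈ σ.cl 1, if A = B then 0 else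
        ‖psum σ.f A ω‖ ^ 2 * ‖psum σ.f B ω‖ ^ (k * (k + 1) - 2) := by
    simp_rw [mul_sum]
    conv_rhs => rw [sum_comm]
    refine sum_congr rfl fun A _ => ?_
    conv_rhs => rw [sum_comm]
    refine sum_congr rfl fun B _ => ?_
    split_ifs
    · simp
    · rfl
  rw [hswap]
  simp only [m, mom]
  rw [sum_comm, mul_sum, mul_sum, ← sum_add_distrib]
  refine sum_le_sum fun ω _ => ?_
  rw [← mul_sum]
  have h1 := H (Finset σ.ι) (σ.cl 1) (fun A => psum σ.f A ω)
    ((card_classes_le _ _ (pow_pos hp.out.pos 1)).trans_eq (pow_one p))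
  have h2 : psum σ.f σ.S ω = ∑ A ∈ σ.cl 1, psum σ.f A ω := psum_classes _ _ _ _ _
  rw [h2]
  have := mul_le_mul_of_nonneg_left h1 (σ.nonneg ω)
  linarith

lemma dec_improve {k : ℕ} (hk2 : 2 ≤ k) (hk : k < p)
    (hdec : ∀ l, 1 ≤ l → l < k → ∀ ε > (0 : ℝ), Dec p l ε) {ε : ℝ} (hε : 0 < ε) :
    ∃ κ > (0 : ℝ), ∀ lam : ℝ, ε ≤ lam → Dec p k lam → Dec p k (lam - κ) := by
  obtain ⟨κ, hκ, hκε, H⟩ := exists_U_one_le hk2 hk hdec hε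
  refine ⟨κ, hκ, fun lam hlam h => ?_⟩
  obtain ⟨C₁, hC₁, n₀, H₁⟩ := H lam hlam h
  obtain ⟨C₂, hC₂, H₂⟩ := broad_narrow (p := p) hk2
  obtain ⟨C₃, hC₃, H₃⟩ := h
  have hq := one_lt_p (p := p)
  set x : ℝ := lam - κ + (k * (k + 1) : ℝ) / 2 - 1 with hx
  have hx2 : 2 ≤ x := by
    have : (2 : ℝ) ≤ k := by exact_mod_cast hk2
    nlinarith
  have h4 : 4 * (p : ℝ) ^ (-x) ≤ 1 := by
    rw [Real.rpow_neg (by linarith), ← div_eq_mul_inv, div_le_one (by positivity)]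
    have h3 : (3 : ℝ) ≤ p := by exact_mod_cast (by omega : 3 ≤ p)
    calc (4 : ℝ) ≤ (p : ℝ) ^ (2 : ℝ) := by rw [Real.rpow_two]; nlinarith
      _ ≤ _ := Real.rpow_le_rpow_of_exponent_le hq.le hx2
  set K : ℝ := C₃ * (p : ℝ) ^ (κ * (n₀ + 1)) + 2 * C₂ * C₁ with hK
  have hK1 : 1 ≤ K := by
    have : 0 ≤ C₃ * (p : ℝ) ^ (κ * (n₀ + 1)) := by positivity
    nlinarith
  have main : ∀ n : ℕ, ∀ σ : Sys p k, σ.n = n →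
      σ.m (k * (k + 1)) σ.S ≤ K * (p : ℝ) ^ (x * n) * σ.E := by
    intro n
    induction n with
    | zero =>
      intro σ hn
      have hE := σ.E_nonneg
      have := H₃ σ.n σ.γ σ.good σ.Ω σ.ι σ.w σ.S σ.pt σ.f σ.nonneg σ.sys
      rw [hn] at this
      simp only [Nat.cast_zero, mul_zero, Real.rpow_zero, mul_one] at this ⊢
      refine this.trans ?_
      unfold E cl m
      rw [hn]
      refine mul_le_mul_of_nonneg_right ?_ (by
        simpa [E, cl, m, hn] using hE)
      have : 1 ≤ (p : ℝ) ^ (κ * (n₀ + 1)) := Real.one_le_rpow hq.le (by positivity)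
      nlinarith
    | succ n ih =>
      intro σ hn
      have hE := σ.E_nonneg
      by_cases hn₀ : σ.n < n₀
      · have := H₃ σ.n σ.γ σ.good σ.Ω σ.ι σ.w σ.S σ.pt σ.f σ.nonneg σ.sys
        rw [← hn]
        have hnr : (σ.n : ℝ) ≤ n₀ := by exact_mod_cast hn₀.le
        have hsplit : (p : ℝ) ^ ((lam + (k * (k + 1) : ℝ) / 2 - 1) * σ.n) ≤
            (p : ℝ) ^ (κ * (n₀ + 1)) * (p : ℝ) ^ (x * σ.n) := by
          rw [← Real.rpow_add (by linarith)]
          refine Real.rpow_le_rpow_of_exponent_le hq.le ?_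
          rw [hx]
          nlinarith
        refine this.trans (mul_le_mul_of_nonneg_right ?_ hE)
        calc C₃ * (p : ℝ) ^ ((lam + (k * (k + 1) : ℝ) / 2 - 1) * σ.n)
            ≤ C₃ * ((p : ℝ) ^ (κ * (n₀ + 1)) * (p : ℝ) ^ (x * σ.n)) := by gcongr
          _ ≤ K * (p : ℝ) ^ (x * σ.n) := by
            rw [hK, ← mul_assoc]
            refine mul_le_mul_of_nonneg_right ?_ (by positivity)
            nlinarith
      · push Not at hn₀
        have h1 := narrow_le hk ih σ hn
        have h2 := H₁ σ hn₀
        have h3 := H₂ σ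
        have h5 : (p : ℝ) ^ (x * n) = (p : ℝ) ^ (x * σ.n) * (p : ℝ) ^ (-x) := by
          rw [← Real.rpow_add (by linarith), hn]
          congr 1
          push_cast
          ring
        rw [← hn]
        rw [h5] at h1
        have h6 : 0 ≤ K * (p : ℝ) ^ (x * σ.n) * σ.E := by positivity
        have h7 : C₂ * σ.U 2 (k * (k + 1) - 2) 1 1 ≤
            C₂ * (C₁ * (p : ℝ) ^ (x * σ.n) * σ.E) := by gcongr
        have h8 : 2 * C₂ * C₁ ≤ K := by
          have : 0 ≤ C₃ * (p : ℝ) ^ (κ * (n₀ + 1)) := by positivity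
          linarith
        have h9 : 0 ≤ (p : ℝ) ^ (x * σ.n) * σ.E := by positivity
        nlinarith [mul_le_mul_of_nonneg_right h8 h9, mul_le_mul_of_nonneg_left h4 h6]
  refine ⟨K, hK1, fun n γ hγ Ω ι _ w S pt f hw hs => ?_⟩
  exact main n ⟨n, γ, hγ, Ω, ι, _, w, S, pt, f, hw, hs⟩ rfl

end Sys

variable {p : ℕ} [hp : Fact p.Prime]

lemma dec_trivial {k : ℕ} (hk : 1 ≤ k) : Dec p k ((k * (k + 1) : ℝ) / 2) := by
  refine ⟨1, le_rfl, fun n γ hγ Ω ι _ w S pt f hw hs => ?_⟩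
  have hq := Sys.one_lt_p (p := p)
  obtain ⟨P, hP⟩ : ∃ P, k * (k + 1) = P + 1 := ⟨k * (k + 1) - 1, by
    have : 1 ≤ k * (k + 1) := Nat.mul_pos hk (by omega)
    omega⟩
  have hPr : (k * (k + 1) : ℝ) = P + 1 := by exact_mod_cast hP
  rw [hP, hPr]
  refine (mom_psum_le hw f S pt (q := p ^ n) (pow_pos hp.out.pos n) P).trans (le_of_eq ?_)
  rw [one_mul]
  congr 1
  rw [show ((P + 1 : ℝ) / 2 + (P + 1) / 2 - 1) * n = (n * P : ℕ) by push_cast; ring,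
    Real.rpow_natCast, pow_mul, Nat.cast_pow]

/-- Decoupling for the moment curve over the `p`-adic integers. -/
theorem dec (k : ℕ) (hk1 : 1 ≤ k) (hk : k < p) : ∀ ε > (0 : ℝ), Dec p k ε := by
  induction k using Nat.strong_induction_on with
  | _ k ih =>
    intro ε hε
    rcases hk1.eq_or_lt with rfl | hk2
    · exact (dec_one (p := p)).mono hp.out.one_le hε.le
    obtain ⟨κ, hκ, H⟩ := Sys.dec_improve (p := p) hk2 hk
      (fun l hl hlk => ih l hlk hl (hlk.trans hk)) hε
    by_contra hcon
    have : ∀ N : ℕ, Dec p k ((k * (k + 1) : ℝ) / 2 - N * κ) := by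
      intro N
      induction N with
      | zero => simpa using dec_trivial hk1
      | succ N ihN =>
        by_cases hle : ε ≤ (k * (k + 1) : ℝ) / 2 - N * κ
        · have := H _ hle ihN
          refine this.mono hp.out.one_le (le_of_eq ?_)
          push_cast; ring
        · exact absurd (ihN.mono hp.out.one_le (not_le.1 hle).le) hcon
    obtain ⟨N, hN⟩ := exists_nat_ge ((k * (k + 1) : ℝ) / 2 / κ)
    rw [div_le_iff₀ hκ] at hN
    exact hcon ((this N).mono hp.out.one_le (by linarith))

end

section

open Polynomial

lemma e_sum {ι : Type*} (s : Finset ι) (f : ι → ℝ) : e (∑ i ∈ s, f i) = ∏ i ∈ s, e (f i) := by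
  classical
  induction s using Finset.induction_on with
  | empty => simp
  | insert i s hi ih => rw [sum_insert hi, prod_insert hi, e_add, ih]

/-- The vector of the first `k` power sums. -/
def pw (k : ℕ) {s : ℕ} (x : Fin s → ℕ) (j : Fin k) : ℤ := ∑ i, (x i : ℤ) ^ (j.val + 1)

/-- The box `[1, Y]^s`. -/
def box (s Y : ℕ) : Finset (Fin s → ℕ) := Fintype.piFinset fun _ => Icc 1 Y

/-- The number of solutions of Vinogradov's system. -/
def vinogradov (s k Y : ℕ) : ℕ := #{z ∈ box s Y ×ˢ box s Y | pw k z.1 = pw k z.2}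

lemma pow_weyl_sum (s k Y : ℕ) (α : Fin k → ℝ) :
    (∑ y ∈ Icc 1 Y, e (∑ j, α j * (y : ℝ) ^ (j.val + 1))) ^ s =
      ∑ x ∈ box s Y, e (∑ j, α j * pw k x j) := by
  have := prod_univ_sum (fun _ : Fin s => Icc 1 Y)
    fun _ y => e (∑ j, α j * (y : ℝ) ^ (j.val + 1))
  rw [prod_const, card_univ, Fintype.card_fin] at this
  rw [this]
  refine sum_congr rfl fun x _ => ?_
  rw [← e_sum]
  congr 1
  rw [sum_comm]
  refine sum_congr rfl fun j _ => ?_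
  simp only [pw]
  push_cast
  rw [mul_sum]

lemma e_div_congr {q : ℕ} (hq : 0 < q) {a b : ℤ} (h : (q : ℤ) ∣ a - b) :
    e ((a : ℝ) / q) = e ((b : ℝ) / q) := by
  obtain ⟨c, hc⟩ := h
  have hq' : (q : ℝ) ≠ 0 := by positivity
  rw [show ((a : ℝ) / q) = (b : ℝ) / q + c by
    rw [show a = b + q * c by linarith]; push_cast; field_simp, e_add_int]

section Characters

variable {q k : ℕ}

/-- The character of `(ℤ/q)^k` with frequency `u`. -/
def chr (u : Fin k → ℤ) (ω : Fin k → ZMod q) : ℂ :=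
  e (((∑ j, ((ω j).val : ℤ) * u j : ℤ) : ℝ) / q)

@[simp] lemma norm_chr (u : Fin k → ℤ) (ω : Fin k → ZMod q) : ‖chr u ω‖ = 1 := norm_e _

variable [NeZero q]

lemma chr_shift (u t : Fin k → ℤ) (ω : Fin k → ZMod q) :
    chr u (ω + fun j => (t j : ZMod q)) = e (((∑ j, t j * u j : ℤ) : ℝ) / q) * chr u ω := by
  unfold chr
  rw [← e_add, ← add_div, ← Int.cast_add]
  refine e_div_congr (Nat.pos_of_neZero q) ?_
  rw [← sum_add_distrib, ← sum_sub_distrib]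
  refine dvd_sum fun j _ => ?_
  rw [← add_mul, ← sub_mul]
  refine Dvd.dvd.mul_right ?_ _
  rw [← ZMod.intCast_zmod_eq_zero_iff_dvd]
  push_cast
  simp [add_comm]

lemma sum_chr_nonneg (u : Fin k → ℤ) : 0 ≤ (∑ ω : Fin k → ZMod q, chr u ω).re := by
  by_cases h : ∀ j, (q : ℤ) ∣ u j
  · have : ∀ ω : Fin k → ZMod q, chr u ω = 1 := by
      intro ω
      unfold chr
      rw [e_div_congr (Nat.pos_of_neZero q) (b := 0)
        (by rw [sub_zero]; exact dvd_sum fun j _ => (h j).mul_left _)]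
      simp
    simp only [this, sum_const, nsmul_eq_mul, mul_one, Complex.natCast_re]
    positivity
  · push Not at h
    obtain ⟨j, hj⟩ := h
    have := sum_e_eq_zero_aux (c := ∑ ω : Fin k → ZMod q, chr u ω)
      (α := ((∑ i, (Pi.single j 1 : Fin k → ℤ) i * u i : ℤ) : ℝ) / q) ?_ ?_
    · rw [this]; simp
    · rw [mul_sum]
      conv_rhs => rw [← Equiv.sum_comp (Equiv.addRight
        fun i => ((Pi.single j 1 : Fin k → ℤ) i : ZMod q))]
      refine sum_congr rfl fun ω _ => ?_
      rw [Equiv.coe_addRight, chr_shift]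
    · refine e_div_ne_one (Nat.pos_of_neZero q) ?_
      simpa [Pi.single_apply] using hj

lemma vinogradov_le_mean (s k Y : ℕ) :
    (vinogradov s k Y : ℝ) * (q : ℝ) ^ k ≤
      ∑ ω : Fin k → ZMod q, ‖∑ y ∈ Icc 1 Y, chr (fun j => (y : ℤ) ^ (j.val + 1)) ω‖ ^ (2 * s) := by
  have h1 : ∀ ω : Fin k → ZMod q, ‖∑ y ∈ Icc 1 Y, chr (fun j => (y : ℤ) ^ (j.val + 1)) ω‖ ^ (2 * s)
      = (∑ z ∈ box s Y ×ˢ box s Y, chr (pw k z.1 - pw k z.2) ω).re := by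
    intro ω
    have h2 : ∑ y ∈ Icc 1 Y, chr (fun j => (y : ℤ) ^ (j.val + 1)) ω =
        ∑ y ∈ Icc 1 Y, e (∑ j, ((ω j).val / q : ℝ) * (y : ℝ) ^ (j.val + 1)) := by
      refine sum_congr rfl fun y _ => ?_
      unfold chr
      congr 1
      push_cast
      rw [sum_div]
      exact sum_congr rfl fun j _ => by ring
    rw [h2, mul_comm, pow_mul, ← norm_pow, pow_weyl_sum, ← Complex.normSq_eq_norm_sq,
      ← Complex.ofReal_re (Complex.normSq _), ← Complex.mul_conj, map_sum, sum_mul_sum,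
      sum_product]
    congr 1
    refine sum_congr rfl fun x _ => sum_congr rfl fun y _ => ?_
    rw [conj_e, ← e_add]
    unfold chr
    congr 1
    push_cast
    rw [sum_div, ← sum_neg_distrib, ← sum_add_distrib]
    refine sum_congr rfl fun j _ => ?_
    simp only [Pi.sub_apply]
    push_cast
    ring
  simp_rw [h1]
  rw [← Complex.re_sum, sum_comm, Complex.re_sum]
  unfold vinogradov
  calc ((#{z ∈ box s Y ×ˢ box s Y | pw k z.1 = pw k z.2} : ℕ) : ℝ) * (q : ℝ) ^ k
      = ∑ z ∈ box s Y ×ˢ box s Y with pw k z.1 = pw k z.2,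
          (∑ ω : Fin k → ZMod q, chr (pw k z.1 - pw k z.2) ω).re := by
        rw [← nsmul_eq_mul, ← sum_const]
        refine sum_congr rfl fun z hz => ?_
        rw [mem_filter] at hz
        rw [hz.2, sub_self]
        simp only [chr, Pi.zero_apply, mul_zero, sum_const_zero, Int.cast_zero, zero_div, e_zero,
          sum_const, card_univ, Fintype.card_fun, ZMod.card, Fintype.card_fin, nsmul_eq_mul, mul_one,
          Nat.cast_pow]
        rw [← Nat.cast_pow, ← Nat.cast_pow, Complex.natCast_re]
    _ ≤ _ := sum_le_sum_of_subset_of_nonneg (filter_subset _ _) fun z _ _ => sum_chr_nonneg _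

end Characters

/-- Vinogradov's mean value theorem at the critical exponent. -/
theorem vinogradov_mean_value {s k : ℕ} (hk : 1 ≤ k) (hs : 2 * s = k * (k + 1)) {ε : ℝ}
    (hε : 0 < ε) :
    ∃ C : ℝ, 1 ≤ C ∧ ∀ Y : ℕ, 1 ≤ Y → (vinogradov s k Y : ℝ) ≤ C * (Y : ℝ) ^ (s + ε) := by
  obtain ⟨p, hkp, hp'⟩ := Nat.exists_infinite_primes (k + 1)
  have hp : Fact p.Prime := ⟨hp'⟩
  obtain ⟨C, hC, H⟩ := dec (p := p) k hk hkp ε hε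
  have hp1 := Sys.one_lt_p (p := p)
  have hsr : (2 * s : ℝ) = k * (k + 1) := by exact_mod_cast hs
  have hs1 : (1 : ℝ) ≤ s := by
    have : (1 : ℝ) ≤ k := by exact_mod_cast hk
    nlinarith
  refine ⟨C * (p : ℝ) ^ (ε + s - 1), one_le_mul_of_one_le_of_one_le hC
    (Real.one_le_rpow hp1.le (by linarith)), fun Y hY => ?_⟩
  obtain ⟨n, hn⟩ : ∃ n, n = Nat.clog p Y := ⟨_, rfl⟩
  have hYn : Y ≤ p ^ n := by rw [hn]; exact Nat.le_pow_clog hp'.one_lt Y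
  have hnY : (p : ℝ) ^ n ≤ p * Y := by
    rcases Nat.eq_zero_or_pos n with h0 | h0
    · rw [h0, pow_zero]
      have : (1 : ℝ) ≤ Y := by exact_mod_cast hY
      nlinarith
    · obtain ⟨n', rfl⟩ : ∃ n', n = n' + 1 := ⟨n - 1, by omega⟩
      have : p ^ n' < Y := by
        rw [← Nat.lt_clog_iff_pow_lt hp'.one_lt]; omega
      have : (p : ℝ) ^ n' ≤ Y := by exact_mod_cast this.le
      rw [pow_succ, mul_comm]
      gcongr
  set q := p ^ (k * n) with hqdef
  have hq0 : 0 < q := pow_pos hp'.pos _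
  have : NeZero q := ⟨hq0.ne'⟩
  have hqr : (0 : ℝ) < (q : ℝ) ^ k := by positivity
  have hgood : Good p (fun j : Fin k => (X : ℤ[X]) ^ (j.val + 1)) := by
    refine ⟨1, fun h => ?_, fun j => ⟨0, by simp⟩⟩
    exact hp'.one_lt.ne' (by simpa using Int.eq_one_of_dvd_one (by positivity) h)
  have hsys : IsSys p (k * n) (fun j : Fin k => (X : ℤ[X]) ^ (j.val + 1))
      (fun _ : Fin k → ZMod q => (1 : ℝ)) (Icc 1 Y) (fun y : ℕ => (y : ℤ))
      (fun y => chr fun j => (y : ℤ) ^ (j.val + 1)) := by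
    intro t
    refine ⟨Equiv.addRight fun j => (t j : ZMod q), fun _ => rfl, 1, by simp, fun y _ ω => ?_⟩
    simp only [Equiv.coe_addRight]
    rw [chr_shift, one_mul]
    congr 2
    rw [hqdef]
    simp
  have key := H n _ hgood _ _ _ _ _ _ (fun _ => zero_le_one) hsys
  rw [← hs] at key
  have hlow := vinogradov_le_mean (q := q) s k Y
  have hJ : ∑ J ∈ classes (Icc 1 Y) (fun y : ℕ => (y : ℤ)) (p ^ n),
      mom (fun _ : Fin k → ZMod q => (1 : ℝ)) (2 * s)
        (psum (fun y : ℕ => chr fun j => (y : ℤ) ^ (j.val + 1)) J) ≤ Y * (q : ℝ) ^ k := by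
    have hsing : ∀ J ∈ classes (Icc 1 Y) (fun y : ℕ => (y : ℤ)) (p ^ n), ∃ y, J = {y} := by
      intro J hJ
      obtain ⟨i, hi⟩ := classes_nonempty hJ
      refine ⟨i, eq_singleton_iff_unique_mem.2 ⟨hi, fun j hj => ?_⟩⟩
      have h1 := dvd_of_mem_classes hJ hi hj
      have h2 := mem_Icc.1 (classes_subset hJ hi)
      have h3 := mem_Icc.1 (classes_subset hJ hj)
      have h4 := Int.eq_zero_of_abs_lt_dvd h1 (by rw [abs_lt]; constructor <;> lia)
      lia
    calc _ ≤ ∑ J ∈ classes (Icc 1 Y) (fun y : ℕ => (y : ℤ)) (p ^ n), (q : ℝ) ^ k := by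
          refine sum_le_sum fun J hJ => ?_
          obtain ⟨y, rfl⟩ := hsing J hJ
          simp [mom, psum]
      _ ≤ _ := by
          rw [sum_const, nsmul_eq_mul]
          gcongr
          have : classes (Icc 1 Y) (fun y : ℕ => (y : ℤ)) (p ^ n) ⊆
              (Icc 1 Y).image fun y => {y} := by
            intro J hJ
            obtain ⟨y, rfl⟩ := hsing J hJ
            exact mem_image_of_mem _ (classes_subset hJ (mem_singleton_self y))
          exact (card_le_card this).trans (card_image_le.trans (by simp))
  have hfin : (vinogradov s k Y : ℝ) * (q : ℝ) ^ k ≤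
      (C * ((p : ℝ) ^ n) ^ (ε + s - 1) * Y) * (q : ℝ) ^ k := by
    refine hlow.trans ?_
    have h5 : (p : ℝ) ^ ((ε + (k * (k + 1) : ℝ) / 2 - 1) * n) = ((p : ℝ) ^ n) ^ (ε + s - 1) := by
      rw [← hsr, ← Real.rpow_natCast, ← Real.rpow_mul (by linarith)]
      congr 1; ring
    rw [h5] at key
    simp only [mom, psum, one_mul] at key hJ
    refine key.trans ?_
    rw [mul_assoc _ (Y : ℝ)]
    exact mul_le_mul_of_nonneg_left hJ (by positivity)
  refine (le_of_mul_le_mul_right hfin hqr).trans ?_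
  have hY0 : (0 : ℝ) < Y := by exact_mod_cast hY
  calc C * ((p : ℝ) ^ n) ^ (ε + s - 1) * Y ≤ C * (p * Y) ^ (ε + s - 1) * Y := by
        gcongr; linarith
    _ = C * (p : ℝ) ^ (ε + s - 1) * (Y : ℝ) ^ (s + ε) := by
        rw [Real.mul_rpow (by positivity) hY0.le, mul_assoc, mul_assoc, mul_assoc]
        congr 2
        conv_lhs => rw [← Real.rpow_one (Y : ℝ), ← Real.rpow_mul hY0.le]
        rw [← Real.rpow_add hY0]
        congr 1; ring

end

section

lemma norm_e_sub_one_ge {β : ℝ} (h : |β| ≤ 1 / 2) : 4 * |β| ≤ ‖e β - 1‖ := by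
  have h1 : ‖e β - 1‖ = 2 * |Real.sin (Real.pi * β)| := by
    unfold e
    rw [show (2 * Real.pi * Complex.I * β : ℂ) = Complex.I * ((2 * Real.pi * β : ℝ) : ℂ) by
      push_cast; ring, Complex.norm_exp_I_mul_ofReal_sub_one, norm_mul, Real.norm_eq_abs,
      Real.norm_eq_abs, abs_two, show 2 * Real.pi * β / 2 = Real.pi * β by ring]
  have h2 : |Real.sin (Real.pi * β)| = Real.sin (Real.pi * |β|) := by
    have hpi := Real.pi_pos
    have h3 : 0 ≤ Real.sin (Real.pi * |β|) :=
      Real.sin_nonneg_of_nonneg_of_le_pi (by positivity) (by nlinarith)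
    rcases abs_cases β with ⟨hb, _⟩ | ⟨hb, _⟩
    · rw [hb] at h3 ⊢; exact abs_of_nonneg h3
    · rw [hb, mul_neg, Real.sin_neg] at h3 ⊢
      exact abs_of_nonpos (by linarith)
  have h3 := Real.mul_le_sin (x := Real.pi * |β|) (by positivity)
    (by have := Real.pi_pos; nlinarith)
  rw [h1, h2]
  have h4 : 2 / Real.pi * (Real.pi * |β|) = 2 * |β| := by
    have := Real.pi_pos
    field_simp
  linarith

lemma norm_e_sub_one_le (β : ℝ) : ‖e β - 1‖ ≤ 2 * Real.pi * |β| := by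
  unfold e
  rw [show (2 * Real.pi * Complex.I * β : ℂ) = Complex.I * ((2 * Real.pi * β : ℝ) : ℂ) by
      push_cast; ring]
  refine (Real.norm_exp_I_mul_ofReal_sub_one_le (x := 2 * Real.pi * β)).trans ?_
  rw [norm_mul, norm_mul, Real.norm_eq_abs, Real.norm_eq_abs, Real.norm_eq_abs, abs_two,
    abs_of_pos Real.pi_pos]

lemma norm_e_sub_e_le (α β : ℝ) : ‖e α - e β‖ ≤ 2 * Real.pi * |α - β| := by
  have : e α - e β = e β * (e (α - β) - 1) := by
    rw [mul_sub, ← e_add]; ring_nf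
  rw [this, norm_mul, norm_e, one_mul]
  exact norm_e_sub_one_le _

lemma e_mul_nat (β : ℝ) (n : ℕ) : e (β * n) = e β ^ n := by
  induction n with
  | zero => simp
  | succ n ih => rw [pow_succ, ← ih, ← e_add]; push_cast; ring_nf

/-- The geometric sum. -/
def geo (N : ℕ) (β : ℝ) : ℂ := ∑ i ∈ range N, e (β * i)

lemma norm_geo_le_card (N : ℕ) (β : ℝ) : ‖geo N β‖ ≤ N := by
  refine (norm_sum_le _ _).trans ?_
  simp

lemma norm_geo_mul_le (N : ℕ) (β : ℝ) : ‖geo N β‖ * ‖e β - 1‖ ≤ 2 := by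
  unfold geo
  simp only [e_mul_nat]
  rw [← norm_mul, geom_sum_mul]
  calc ‖e β ^ N - 1‖ ≤ ‖e β ^ N‖ + ‖(1 : ℂ)‖ := norm_sub_le _ _
    _ = 2 := by rw [norm_pow, norm_e, one_pow, norm_one]; norm_num

lemma norm_geo_le {β : ℝ} (N : ℕ) (h : |β| ≤ 1 / 2) (h0 : 0 < |β|) :
    ‖geo N β‖ ≤ 1 / (2 * |β|) := by
  have h1 := norm_geo_mul_le N β
  have h2 := norm_e_sub_one_ge h
  rw [le_div_iff₀ (by positivity)]
  have h3 : ‖geo N β‖ * (4 * |β|) ≤ ‖geo N β‖ * ‖e β - 1‖ := by gcongr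
  linarith

lemma sum_inv_sq_le_of_injOn {R : Finset ℕ} {g : ℕ → ℕ} (hg : Set.InjOn g R) :
    ∑ n ∈ R, 1 / (g n : ℝ) ^ 2 ≤ 2 := by
  rw [← sum_image (f := fun i : ℕ => 1 / (i : ℝ) ^ 2) hg]
  refine (hasSum_zeta_two.summable.sum_le_tsum _ fun _ _ => by positivity).trans ?_
  rw [hasSum_zeta_two.tsum_eq]
  have := Real.pi_lt_d2
  have := Real.pi_pos
  nlinarith

lemma sum_inv_sq_le (R : Finset ℕ) (m : ℕ) :
    ∑ n ∈ R.erase m, 1 / ((m : ℝ) - n) ^ 2 ≤ 4 := by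
  rw [← sum_filter_add_sum_filter_not _ (fun n => n < m)]
  have hlo : ∑ n ∈ R.erase m with n < m, 1 / ((m : ℝ) - n) ^ 2 ≤ 2 := by
    refine le_trans (le_of_eq (sum_congr rfl fun n hn => ?_))
      (sum_inv_sq_le_of_injOn (g := fun n => m - n) ?_)
    · rw [Nat.cast_sub (mem_filter.1 hn).2.le]
    · intro a ha b hb hab
      simp only [coe_filter, Set.mem_ofPred_eq] at ha hb hab
      omega
  have hhi : ∑ n ∈ R.erase m with ¬ n < m, 1 / ((m : ℝ) - n) ^ 2 ≤ 2 := by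
    refine le_trans (le_of_eq (sum_congr rfl fun n hn => ?_))
      (sum_inv_sq_le_of_injOn (g := fun n => n - m) ?_)
    · rw [Nat.cast_sub (not_lt.1 (mem_filter.1 hn).2)]
      congr 1; ring
    · intro a ha b hb hab
      simp only [coe_filter, Set.mem_ofPred_eq] at ha hb hab
      omega
  linarith

/-- Duality between a sum over points and a sum over frequencies. -/
lemma duality {ι κ : Type*} (R : Finset ι) (V : Finset κ) (c : ι → κ → ℂ) {D : ℝ} (hD : 0 ≤ D)
    (h : ∀ b : ι → ℂ, ∑ v ∈ V, ‖∑ m ∈ R, b m * c m v‖ ^ 2 ≤ D * ∑ m ∈ R, ‖b m‖ ^ 2)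
    (a : κ → ℂ) :
    ∑ m ∈ R, ‖∑ v ∈ V, a v * c m v‖ ^ 2 ≤ D * ∑ v ∈ V, ‖a v‖ ^ 2 := by
  set T : ι → ℂ := fun m => ∑ v ∈ V, a v * c m v with hT
  set S : ℝ := ∑ m ∈ R, ‖T m‖ ^ 2 with hS
  set A : ℝ := ∑ v ∈ V, ‖a v‖ ^ 2 with hA
  have hS0 : 0 ≤ S := by positivity
  have hA0 : 0 ≤ A := by positivity
  have h1 : (S : ℂ) = ∑ v ∈ V, a v * ∑ m ∈ R, starRingEnd ℂ (T m) * c m v := by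
    rw [hS]
    push_cast
    have : ∀ m ∈ R, ((‖T m‖ : ℂ)) ^ 2 = ∑ v ∈ V, a v * (starRingEnd ℂ (T m) * c m v) := by
      intro m _
      rw [← Complex.mul_conj']
      conv_lhs => rw [hT]
      simp only
      rw [sum_mul]
      exact sum_congr rfl fun v _ => by ring
    rw [sum_congr rfl this, sum_comm]
    simp only [mul_sum]
  have h2 : S ≤ ∑ v ∈ V, ‖a v‖ * ‖∑ m ∈ R, starRingEnd ℂ (T m) * c m v‖ := by
    calc S = ‖(S : ℂ)‖ := by rw [Complex.norm_real, Real.norm_of_nonneg hS0]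
      _ ≤ _ := by
        rw [h1]
        refine (norm_sum_le _ _).trans (le_of_eq (sum_congr rfl fun v _ => norm_mul _ _))
  have h3 : S ^ 2 ≤ A * (D * S) := by
    calc S ^ 2 ≤ (∑ v ∈ V, ‖a v‖ * ‖∑ m ∈ R, starRingEnd ℂ (T m) * c m v‖) ^ 2 := by gcongr
      _ ≤ A * ∑ v ∈ V, ‖∑ m ∈ R, starRingEnd ℂ (T m) * c m v‖ ^ 2 :=
        sum_mul_sq_le_sq_mul_sq _ _ _
      _ ≤ A * (D * ∑ m ∈ R, ‖starRingEnd ℂ (T m)‖ ^ 2) := by gcongr; exact h _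
      _ = _ := by simp only [RCLike.norm_conj]; rfl
  rcases hS0.eq_or_lt with h0 | h0
  · rw [← h0]; positivity
  · nlinarith

/-- The large sieve for well-spaced points in an interval of length `1 / 2`. -/
theorem large_sieve (R : Finset ℕ) (α : ℕ → ℝ) {δ : ℝ} (hδ : 0 < δ)
    (hsep : ∀ m ∈ R, ∀ n ∈ R, δ * |(m : ℝ) - n| ≤ |α m - α n|)
    (hlen : ∀ m ∈ R, ∀ n ∈ R, |α m - α n| ≤ 1 / 2) (V : ℕ) (a : ℕ → ℂ) :
    ∑ m ∈ R, ‖∑ v ∈ range (V + 1), a v * e (α m * v)‖ ^ 2 ≤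
      (8 * V + 4 / δ + 4) * ∑ v ∈ range (V + 1), ‖a v‖ ^ 2 := by
  refine duality R _ (fun m (v : ℕ) => e (α m * (v : ℝ))) (by positivity) (fun b => ?_) a
  obtain ⟨N, hN⟩ : ∃ N, N = ⌈2 * V + 1 / δ⌉₊ := ⟨_, rfl⟩
  have hN1 : 2 * V + 1 / δ ≤ N := by rw [hN]; exact Nat.le_ceil _
  have hN2 : (N : ℝ) ≤ 2 * V + 1 / δ + 1 := by
    rw [hN]; exact (Nat.ceil_lt_add_one (by positivity)).le
  have hδ1 : 0 < 1 / δ := by positivity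
  have hN0 : (0 : ℝ) < N := by
    have : (0 : ℝ) ≤ V := by positivity
    linarith
  have hVN : 2 * V ≤ N := by
    have : (2 * V : ℝ) ≤ N := by linarith
    exact_mod_cast this
  set g : ℝ → ℂ := fun x => ∑ m ∈ R, b m * e (α m * x) with hg
  have hfej : (N : ℝ) / 2 * ∑ v ∈ range (V + 1), ‖g v‖ ^ 2 ≤
      ∑ i ∈ range N, ∑ j ∈ range N, ‖g ((i : ℝ) - j)‖ ^ 2 := by
    rw [sum_comm]
    have h1 : ∀ j ∈ range (N - V), ∑ v ∈ range (V + 1), ‖g v‖ ^ 2 ≤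
        ∑ i ∈ range N, ‖g ((i : ℝ) - j)‖ ^ 2 := by
      intro j hj
      have hinj : Set.InjOn (fun v => v + j) (range (V + 1)) := fun x _ y _ h => by
        simpa using h
      calc ∑ v ∈ range (V + 1), ‖g v‖ ^ 2
          = ∑ i ∈ (range (V + 1)).image (fun v => v + j), ‖g ((i : ℝ) - j)‖ ^ 2 := by
            rw [sum_image hinj]
            exact sum_congr rfl fun v _ => by push_cast; rw [add_sub_cancel_right]
        _ ≤ _ := by
            refine sum_le_sum_of_subset_of_nonneg ?_ fun _ _ _ => by positivity
            intro i hi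
            obtain ⟨v, hv, rfl⟩ := mem_image.1 hi
            simp only [mem_range] at hv hj ⊢
            omega
    have h2 : (N : ℝ) / 2 ≤ ((N - V : ℕ) : ℝ) := by
      rw [Nat.cast_sub (by omega)]
      have : (2 * V : ℝ) ≤ N := by exact_mod_cast hVN
      linarith
    calc (N : ℝ) / 2 * ∑ v ∈ range (V + 1), ‖g v‖ ^ 2
        ≤ ((N - V : ℕ) : ℝ) * ∑ v ∈ range (V + 1), ‖g v‖ ^ 2 := by gcongr
      _ = ∑ j ∈ range (N - V), ∑ v ∈ range (V + 1), ‖g v‖ ^ 2 := by simp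
      _ ≤ ∑ j ∈ range (N - V), ∑ i ∈ range N, ‖g ((i : ℝ) - j)‖ ^ 2 := sum_le_sum h1
      _ ≤ _ := sum_le_sum_of_subset_of_nonneg (range_subset_range.2 (by omega))
          fun _ _ _ => by positivity
  have hker : ∑ i ∈ range N, ∑ j ∈ range N, ‖g ((i : ℝ) - j)‖ ^ 2 ≤
      ∑ m ∈ R, ∑ n ∈ R, ‖b m‖ * ‖b n‖ * ‖geo N (α m - α n)‖ ^ 2 := by
    have h1 : ∀ x : ℝ, ((‖g x‖ ^ 2 : ℝ) : ℂ) =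
        ∑ m ∈ R, ∑ n ∈ R, b m * starRingEnd ℂ (b n) * e ((α m - α n) * x) := by
      intro x
      push_cast
      rw [← Complex.mul_conj', hg]
      simp only [map_sum, map_mul, conj_e, sum_mul_sum]
      refine sum_congr rfl fun m _ => sum_congr rfl fun n _ => ?_
      rw [show (α m - α n) * x = α m * x + -(α n * x) by ring, e_add]
      ring
    have h2 : ∀ β : ℝ, ∑ i ∈ range N, ∑ j ∈ range N, e (β * ((i : ℝ) - j)) =
        geo N β * starRingEnd ℂ (geo N β) := by
      intro β
      unfold geo
      simp only [map_sum, conj_e, sum_mul_sum]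
      refine sum_congr rfl fun i _ => sum_congr rfl fun j _ => ?_
      rw [← e_add]; ring_nf
    have h3 : ((∑ i ∈ range N, ∑ j ∈ range N, ‖g ((i : ℝ) - j)‖ ^ 2 : ℝ) : ℂ) =
        ∑ m ∈ R, ∑ n ∈ R, b m * starRingEnd ℂ (b n) *
          (geo N (α m - α n) * starRingEnd ℂ (geo N (α m - α n))) := by
      rw [Complex.ofReal_sum]
      simp only [Complex.ofReal_sum, h1, ← h2, mul_sum]
      calc _ = ∑ i ∈ range N, ∑ m ∈ R, ∑ j ∈ range N, ∑ n ∈ R,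
            b m * starRingEnd ℂ (b n) * e ((α m - α n) * ((i : ℝ) - j)) :=
            sum_congr rfl fun i _ => sum_comm
        _ = ∑ m ∈ R, ∑ i ∈ range N, ∑ j ∈ range N, ∑ n ∈ R,
            b m * starRingEnd ℂ (b n) * e ((α m - α n) * ((i : ℝ) - j)) := sum_comm
        _ = ∑ m ∈ R, ∑ i ∈ range N, ∑ n ∈ R, ∑ j ∈ range N,
            b m * starRingEnd ℂ (b n) * e ((α m - α n) * ((i : ℝ) - j)) :=
            sum_congr rfl fun m _ => sum_congr rfl fun i _ => sum_comm
        _ = _ := sum_congr rfl fun m _ => sum_comm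
    calc ∑ i ∈ range N, ∑ j ∈ range N, ‖g ((i : ℝ) - j)‖ ^ 2
        = ‖((∑ i ∈ range N, ∑ j ∈ range N, ‖g ((i : ℝ) - j)‖ ^ 2 : ℝ) : ℂ)‖ := by
          rw [Complex.norm_real, Real.norm_of_nonneg (by positivity)]
      _ ≤ _ := by
          rw [h3]
          refine (norm_sum_le _ _).trans (sum_le_sum fun m _ => (norm_sum_le _ _).trans
            (le_of_eq (sum_congr rfl fun n _ => ?_)))
          simp only [norm_mul, RCLike.norm_conj]
          ring
  have hsum : ∀ m ∈ R, ∑ n ∈ R, ‖geo N (α m - α n)‖ ^ 2 ≤ 2 * (N : ℝ) ^ 2 := by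
    intro m hm
    rw [← add_sum_erase _ _ hm]
    have h1 : ‖geo N (α m - α m)‖ ^ 2 ≤ (N : ℝ) ^ 2 := by
      gcongr; exact norm_geo_le_card _ _
    have h2 : ∑ n ∈ R.erase m, ‖geo N (α m - α n)‖ ^ 2 ≤ (1 / δ) ^ 2 := by
      calc ∑ n ∈ R.erase m, ‖geo N (α m - α n)‖ ^ 2
          ≤ ∑ n ∈ R.erase m, (1 / δ) ^ 2 / 4 * (1 / ((m : ℝ) - n) ^ 2) := by
            refine sum_le_sum fun n hn => ?_
            obtain ⟨hne, hn⟩ := mem_erase.1 hn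
            have hmn : 0 < |(m : ℝ) - n| := by
              rw [abs_pos, sub_ne_zero]; exact_mod_cast hne.symm
            have hs := hsep m hm n hn
            have hpos : 0 < δ * |(m : ℝ) - n| := by positivity
            have h3 : ‖geo N (α m - α n)‖ ≤ 1 / (2 * (δ * |(m : ℝ) - n|)) :=
              (norm_geo_le N (hlen m hm n hn) (by linarith)).trans (by gcongr)
            calc ‖geo N (α m - α n)‖ ^ 2 ≤ (1 / (2 * (δ * |(m : ℝ) - n|))) ^ 2 := by gcongr
              _ = _ := by
                rw [← sq_abs ((m : ℝ) - n)]
                field_simp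
                norm_num
        _ ≤ (1 / δ) ^ 2 / 4 * 4 := by
            rw [← mul_sum]
            gcongr
            exact sum_inv_sq_le R m
        _ = _ := by ring
    have h3 : (1 / δ) ^ 2 ≤ (N : ℝ) ^ 2 := by
      have : (0 : ℝ) ≤ V := by positivity
      gcongr
      linarith
    linarith
  have hsch : ∑ m ∈ R, ∑ n ∈ R, ‖b m‖ * ‖b n‖ * ‖geo N (α m - α n)‖ ^ 2 ≤
      ∑ m ∈ R, ∑ n ∈ R, ‖b m‖ ^ 2 * ‖geo N (α m - α n)‖ ^ 2 := by
    have hsym : ∀ m n, ‖geo N (α m - α n)‖ = ‖geo N (α n - α m)‖ := by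
      intro m n
      rw [← RCLike.norm_conj]
      unfold geo
      simp only [map_sum, conj_e]
      congr 1
      exact sum_congr rfl fun i _ => by ring_nf
    calc ∑ m ∈ R, ∑ n ∈ R, ‖b m‖ * ‖b n‖ * ‖geo N (α m - α n)‖ ^ 2
        ≤ ∑ m ∈ R, ∑ n ∈ R, (1 / 2 * (‖b m‖ ^ 2 * ‖geo N (α m - α n)‖ ^ 2) +
            1 / 2 * (‖b n‖ ^ 2 * ‖geo N (α n - α m)‖ ^ 2)) := by
          refine sum_le_sum fun m _ => sum_le_sum fun n _ => ?_
          rw [hsym n m]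
          have := two_mul_le_add_sq ‖b m‖ ‖b n‖
          have h0 : 0 ≤ ‖geo N (α m - α n)‖ ^ 2 := by positivity
          nlinarith
      _ = _ := by
          simp only [sum_add_distrib, ← mul_sum]
          rw [sum_comm (f := fun m n => ‖b n‖ ^ 2 * ‖geo N (α n - α m)‖ ^ 2)]
          simp only [← mul_sum]
          ring
  have hfin : (N : ℝ) / 2 * ∑ v ∈ range (V + 1), ‖g v‖ ^ 2 ≤
      (N : ℝ) / 2 * ((4 * N) * ∑ m ∈ R, ‖b m‖ ^ 2) := by
    refine (hfej.trans (hker.trans hsch)).trans ?_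
    simp only [← mul_sum]
    calc ∑ m ∈ R, ‖b m‖ ^ 2 * ∑ n ∈ R, ‖geo N (α m - α n)‖ ^ 2
        ≤ ∑ m ∈ R, ‖b m‖ ^ 2 * (2 * (N : ℝ) ^ 2) := by
          gcongr with m hm; exact hsum m hm
      _ = _ := by rw [← sum_mul]; ring
  refine (le_of_mul_le_mul_left hfin (by positivity)).trans ?_
  refine mul_le_mul_of_nonneg_right ?_ (by positivity)
  have : 4 / δ = 4 * (1 / δ) := by ring
  linarith

end

section

section WeylMean

variable {s k Y : ℕ}

/-- The first `k` power sums together with the last one. -/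
def powerSums (k : ℕ) (x : Fin s → ℕ) : (Fin k → ℕ) × ℕ :=
  (fun j => ∑ i, x i ^ (j.val + 1), ∑ i, x i ^ (k + 1))

lemma pw_eq_iff {x y : Fin s → ℕ} :
    pw (k + 1) x = pw (k + 1) y ↔ powerSums k x = powerSums k y := by
  simp only [funext_iff, powerSums, Prod.mk.injEq, pw, Fin.forall_fin_succ', Fin.val_castSucc,
    Fin.val_last]
  norm_cast

/-- The box containing all power sums but the last one. -/
def powerBox (s k Y : ℕ) : Finset (Fin k → ℕ) :=
  Fintype.piFinset fun j => Icc 1 (s * Y ^ (j.val + 1))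

lemma power_sum_mem {x : Fin s → ℕ} (hs : 1 ≤ s) (hx : x ∈ box s Y) (j : ℕ) :
    ∑ i, x i ^ j ∈ Icc 1 (s * Y ^ j) := by
  simp only [box, Fintype.mem_piFinset, mem_Icc] at hx
  rw [mem_Icc]
  constructor
  · have h0 : 1 ≤ x ⟨0, hs⟩ ^ j := Nat.one_le_pow _ _ (hx _).1
    exact h0.trans (single_le_sum (f := fun i => x i ^ j) (fun _ _ => Nat.zero_le _)
      (mem_univ _))
  · calc ∑ i, x i ^ j ≤ ∑ _i : Fin s, Y ^ j := sum_le_sum fun i _ => Nat.pow_le_pow_left (hx i).2 _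
      _ = _ := by simp

lemma powerSums_mem {x : Fin s → ℕ} (hs : 1 ≤ s) (hx : x ∈ box s Y) :
    powerSums k x ∈ powerBox s k Y ×ˢ range (s * Y ^ (k + 1) + 1) := by
  rw [mem_product]
  refine ⟨?_, ?_⟩
  · simp only [powerBox, Fintype.mem_piFinset]
    exact fun j => power_sum_mem hs hx _
  · rw [mem_range]
    exact Nat.lt_succ_of_le (mem_Icc.1 (power_sum_mem hs hx _)).2

/-- The number of points of the box with given power sums. -/
def repCount (s k Y : ℕ) (w : (Fin k → ℕ) × ℕ) : ℕ := #{x ∈ box s Y | powerSums k x = w}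

lemma sum_repCount_sq (hs : 1 ≤ s) :
    ∑ w ∈ powerBox s k Y ×ˢ range (s * Y ^ (k + 1) + 1), repCount s k Y w ^ 2 =
      vinogradov s (k + 1) Y := by
  unfold vinogradov
  rw [card_eq_sum_card_fiberwise (f := fun z : (Fin s → ℕ) × (Fin s → ℕ) => powerSums k z.1)
    (t := powerBox s k Y ×ˢ range (s * Y ^ (k + 1) + 1))]
  · refine sum_congr rfl fun w _ => ?_
    rw [sq, repCount, ← card_product]
    congr 1
    ext z
    simp only [mem_product, mem_filter, pw_eq_iff]
    constructor
    · rintro ⟨⟨h1, h2⟩, h3, h4⟩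
      exact ⟨⟨⟨h1, h3⟩, h2.trans h4.symm⟩, h2⟩
    · rintro ⟨⟨⟨h1, h2⟩, h3⟩, h4⟩
      exact ⟨⟨h1, h4⟩, h2, h3 ▸ h4⟩
  · intro z hz
    simp only [coe_filter, Set.mem_ofPred_eq, mem_product] at hz
    exact powerSums_mem hs hz.1.1

lemma pow_weyl_sum_eq (hs : 1 ≤ s) (α : Fin (k + 1) → ℝ) :
    (∑ y ∈ Icc 1 Y, e (∑ j, α j * (y : ℝ) ^ (j.val + 1))) ^ s =
      ∑ u ∈ powerBox s k Y, e (∑ j, α (Fin.castSucc j) * u j) *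
        ∑ v ∈ range (s * Y ^ (k + 1) + 1), (repCount s k Y (u, v) : ℂ) * e (α (Fin.last k) * v) := by
  rw [pow_weyl_sum, ← sum_fiberwise_of_maps_to (fun x hx => powerSums_mem (k := k) hs hx),
    sum_product]
  refine sum_congr rfl fun u _ => ?_
  rw [mul_sum]
  refine sum_congr rfl fun v _ => ?_
  rw [repCount, sum_congr rfl (g := fun _ => e (∑ j, α (Fin.castSucc j) * u j) *
    e (α (Fin.last k) * v))]
  · rw [sum_const, nsmul_eq_mul]; ring
  · intro x hx
    obtain ⟨-, hx⟩ := mem_filter.1 hx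
    simp only [powerSums, Prod.mk.injEq] at hx
    rw [← e_add, Fin.sum_univ_castSucc, ← hx.1, ← hx.2]
    simp [pw]

lemma card_powerBox : (#(powerBox s k Y) : ℝ) = ∏ j ∈ range k, ((s : ℝ) * (Y : ℝ) ^ (j + 1)) := by
  rw [powerBox, Fintype.card_piFinset, ← Fin.prod_univ_eq_prod_range
    (fun j => (s : ℝ) * (Y : ℝ) ^ (j + 1))]
  simp

/-- A discrete mean value of Weyl sums with well-spaced leading coefficients. -/
theorem weyl_mean (hs : 1 ≤ s) (R : Finset ℕ) (α : ℕ → Fin (k + 1) → ℝ) {δ : ℝ} (hδ : 0 < δ)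
    (hsep : ∀ m ∈ R, ∀ n ∈ R, δ * |(m : ℝ) - n| ≤ |α m (Fin.last k) - α n (Fin.last k)|)
    (hlen : ∀ m ∈ R, ∀ n ∈ R, |α m (Fin.last k) - α n (Fin.last k)| ≤ 1 / 2) :
    ∑ m ∈ R, ‖∑ y ∈ Icc 1 Y, e (∑ j, α m j * (y : ℝ) ^ (j.val + 1))‖ ^ (2 * s) ≤
      (∏ j ∈ range k, ((s : ℝ) * (Y : ℝ) ^ (j + 1))) *
        ((8 * (s * (Y : ℝ) ^ (k + 1)) + 4 / δ + 4) * vinogradov s (k + 1) Y) := by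
  set V := s * Y ^ (k + 1) with hV
  set A : ℕ → (Fin k → ℕ) → ℂ := fun m u =>
    ∑ v ∈ range (V + 1), (repCount s k Y (u, v) : ℂ) * e (α m (Fin.last k) * v) with hA
  have h1 : ∀ m, ‖∑ y ∈ Icc 1 Y, e (∑ j, α m j * (y : ℝ) ^ (j.val + 1))‖ ^ (2 * s) ≤
      #(powerBox s k Y) * ∑ u ∈ powerBox s k Y, ‖A m u‖ ^ 2 := by
    intro m
    rw [mul_comm 2 s, pow_mul, ← norm_pow, pow_weyl_sum_eq hs]
    calc _ ≤ (∑ u ∈ powerBox s k Y, ‖A m u‖) ^ 2 := by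
          gcongr
          refine (norm_sum_le _ _).trans (le_of_eq (sum_congr rfl fun u _ => ?_))
          rw [norm_mul, norm_e, one_mul]
      _ ≤ _ := sq_sum_le_card_mul_sum_sq
  calc _ ≤ ∑ m ∈ R, #(powerBox s k Y) * ∑ u ∈ powerBox s k Y, ‖A m u‖ ^ 2 :=
        sum_le_sum fun m _ => h1 m
    _ = #(powerBox s k Y) * ∑ u ∈ powerBox s k Y, ∑ m ∈ R, ‖A m u‖ ^ 2 := by
        rw [← mul_sum, sum_comm]
    _ ≤ #(powerBox s k Y) * ∑ u ∈ powerBox s k Y, (8 * V + 4 / δ + 4) *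
          ∑ v ∈ range (V + 1), ‖(repCount s k Y (u, v) : ℂ)‖ ^ 2 := by
        gcongr with u _
        exact large_sieve R (fun m => α m (Fin.last k)) hδ hsep hlen V
          fun v => (repCount s k Y (u, v) : ℂ)
    _ = _ := by
        rw [card_powerBox, ← mul_sum, ← sum_repCount_sq hs, sum_product]
        push_cast
        simp only [Complex.norm_natCast, hV]
        push_cast
        rfl

lemma two_mul_sum_range_succ (k : ℕ) : 2 * ∑ j ∈ range k, (j + 1) = k * (k + 1) := by
  induction k with
  | zero => rfl
  | succ k ih => rw [sum_range_succ, mul_add, ih]; ring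

theorem weyl_mean_le (hs : 2 * s = (k + 1) * (k + 2)) {ε : ℝ} (hε : 0 < ε) :
    ∃ C : ℝ, 1 ≤ C ∧ ∀ Y : ℕ, 1 ≤ Y → ∀ (R : Finset ℕ) (α : ℕ → Fin (k + 1) → ℝ) (δ : ℝ), 0 < δ →
    (∀ m ∈ R, ∀ n ∈ R, δ * |(m : ℝ) - n| ≤ |α m (Fin.last k) - α n (Fin.last k)|) →
    (∀ m ∈ R, ∀ n ∈ R, |α m (Fin.last k) - α n (Fin.last k)| ≤ 1 / 2) →
    ∑ m ∈ R, ‖∑ y ∈ Icc 1 Y, e (∑ j, α m j * (y : ℝ) ^ (j.val + 1))‖ ^ (2 * s) ≤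
      C * (Y : ℝ) ^ (2 * s + ε) * (1 + 1 / (δ * (Y : ℝ) ^ (k + 1))) := by
  have hs1 : 1 ≤ s := by nlinarith
  obtain ⟨C, hC1, hC⟩ := vinogradov_mean_value (s := s) (k := k + 1) (by omega) hs hε
  have hs1' : (1 : ℝ) ≤ s := by exact_mod_cast hs1
  refine ⟨s ^ k * (8 * s + 4) * C, ?_, fun Y hY R α δ hδ hsep hlen => ?_⟩
  · have h1 : (1 : ℝ) ≤ (s : ℝ) ^ k := one_le_pow₀ hs1'
    exact one_le_mul_of_one_le_of_one_le
      (one_le_mul_of_one_le_of_one_le h1 (by linarith)) hC1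
  have hY0 : (0 : ℝ) < Y := by exact_mod_cast hY
  have hY1 : (1 : ℝ) ≤ (Y : ℝ) ^ (k + 1) := one_le_pow₀ (by exact_mod_cast hY)
  have hS : ∑ j ∈ range k, (j + 1) + (k + 1) + s = 2 * s := by
    have := two_mul_sum_range_succ k
    nlinarith
  have hprod : ∏ j ∈ range k, ((s : ℝ) * (Y : ℝ) ^ (j + 1)) =
      (s : ℝ) ^ k * (Y : ℝ) ^ (∑ j ∈ range k, (j + 1)) := by
    rw [prod_mul_distrib, prod_pow_eq_pow_sum, prod_const, card_range]
  have hexp : (Y : ℝ) ^ (2 * s + ε) =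
      (Y : ℝ) ^ (∑ j ∈ range k, (j + 1)) * (Y : ℝ) ^ (k + 1) * (Y : ℝ) ^ (s + ε) := by
    rw [show (2 * s + ε : ℝ) = ((∑ j ∈ range k, (j + 1) + (k + 1) : ℕ) : ℝ) + (s + ε) by
      have : ((∑ j ∈ range k, (j + 1) + (k + 1) + s : ℕ) : ℝ) = ((2 * s : ℕ) : ℝ) := by rw [hS]
      push_cast at this ⊢
      linarith, Real.rpow_add hY0, Real.rpow_natCast, pow_add]
  have hmid : 8 * (s * (Y : ℝ) ^ (k + 1)) + 4 / δ + 4 ≤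
      (8 * s + 4) * ((Y : ℝ) ^ (k + 1) * (1 + 1 / (δ * (Y : ℝ) ^ (k + 1)))) := by
    have : (Y : ℝ) ^ (k + 1) * (1 + 1 / (δ * (Y : ℝ) ^ (k + 1))) =
        (Y : ℝ) ^ (k + 1) + 1 / δ := by
      field_simp
    rw [this]
    have : (0 : ℝ) ≤ s * (1 / δ) := by positivity
    have : 4 / δ = 4 * (1 / δ) := by ring
    nlinarith
  calc _ ≤ _ := weyl_mean hs1 R α hδ hsep hlen
    _ ≤ ((s : ℝ) ^ k * (Y : ℝ) ^ (∑ j ∈ range k, (j + 1))) *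
        (((8 * s + 4) * ((Y : ℝ) ^ (k + 1) * (1 + 1 / (δ * (Y : ℝ) ^ (k + 1))))) *
          (C * (Y : ℝ) ^ (s + ε))) := by
        rw [hprod]
        gcongr
        exact hC Y hY
    _ = _ := by rw [hexp]; ring

end WeylMean

end

section

section Taylor

variable {G : ℕ → ℝ → ℝ}

/-- A Taylor expansion with a bound for the remainder, for a chain of derivatives. -/
lemma taylor_chain (hG : ∀ i, ∀ x, 0 < x → HasDerivAt (G i) (G (i + 1) x) x) {m b L : ℝ}
    (hm : 0 < m) (n i : ℕ) (hL : ∀ x ∈ Set.Icc m b, |G (i + n) x| ≤ L) {y : ℝ} (hy : 0 ≤ y)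
    (hyb : m + y ≤ b) :
    |G i (m + y) - ∑ j ∈ range n, G (i + j) m * y ^ j / j.factorial| ≤ L * y ^ n := by
  induction n generalizing i y with
  | zero => simpa using hL (m + y) ⟨by linarith, hyb⟩
  | succ n ih =>
    set h : ℝ → ℝ := fun t => G i (m + t) - ∑ j ∈ range (n + 1), G (i + j) m * t ^ j / j.factorial
    set h' : ℝ → ℝ := fun t =>
      G (i + 1) (m + t) - ∑ j ∈ range n, G (i + 1 + j) m * t ^ j / j.factorial
    have hd : ∀ t ∈ Set.Icc 0 y, HasDerivWithinAt h (h' t) (Set.Icc 0 y) t := by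
      intro t ht
      have h1 : HasDerivAt (fun t => G i (m + t)) (G (i + 1) (m + t)) t :=
        (hG i (m + t) (by linarith [ht.1])).comp_const_add m t
      have h2 : HasDerivAt (fun t : ℝ => ∑ j ∈ range (n + 1), G (i + j) m * t ^ j / j.factorial)
          (∑ j ∈ range (n + 1), G (i + j) m * (j * t ^ (j - 1)) / j.factorial) t :=
        HasDerivAt.fun_sum fun j _ => ((hasDerivAt_pow j t).const_mul _).div_const _
      have h3 : ∑ j ∈ range (n + 1), G (i + j) m * (j * t ^ (j - 1)) / j.factorial =
          ∑ j ∈ range n, G (i + 1 + j) m * t ^ j / j.factorial := by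
        rw [sum_range_succ']
        simp only [CharP.cast_eq_zero, zero_mul, mul_zero, zero_div, add_zero]
        refine sum_congr rfl fun j _ => ?_
        rw [Nat.factorial_succ, show i + (j + 1) = i + 1 + j by ring, Nat.add_sub_cancel]
        push_cast
        have : (j.factorial : ℝ) ≠ 0 := by positivity
        have : (j + 1 : ℝ) ≠ 0 := by positivity
        field_simp
      rw [h3] at h2
      exact (h1.sub h2).hasDerivWithinAt
    have hb : ∀ t ∈ Set.Icc 0 y, ‖h' t‖ ≤ L * y ^ n := by
      intro t ht
      have hL0 : 0 ≤ L := (abs_nonneg _).trans (hL m ⟨le_rfl, by linarith⟩)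
      have := ih (i + 1) (fun x hx => by
        rw [show i + 1 + n = i + (n + 1) by ring]; exact hL x hx) ht.1 (by linarith [ht.2])
      rw [Real.norm_eq_abs]
      refine this.trans ?_
      have := ht.1
      have := ht.2
      gcongr
    have := (convex_Icc 0 y).norm_image_sub_le_of_norm_hasDerivWithin_le hd hb
      (Set.left_mem_Icc.2 hy) (Set.right_mem_Icc.2 hy)
    have h0 : h 0 = 0 := by
      simp only [h, add_zero]
      rw [sum_range_succ']
      simp
    rw [h0, sub_zero, sub_zero, Real.norm_eq_abs, Real.norm_eq_abs, abs_of_nonneg hy] at this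
    calc _ = |h y| := rfl
      _ ≤ _ := this
      _ = _ := by ring

/-- The mean value theorem for a chain of derivatives, in both directions. -/
lemma abs_sub_chain (hG : ∀ i, ∀ x, 0 < x → HasDerivAt (G i) (G (i + 1) x) x) {a b lo hi : ℝ}
    (ha : 0 < a) {i : ℕ} (h : ∀ x ∈ Set.Icc a b, lo ≤ |G (i + 1) x| ∧ |G (i + 1) x| ≤ hi)
    {x y : ℝ} (hx : x ∈ Set.Icc a b) (hy : y ∈ Set.Icc a b) :
    lo * |x - y| ≤ |G i x - G i y| ∧ |G i x - G i y| ≤ hi * |x - y| := by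
  wlog hxy : x < y generalizing x y
  · rcases (not_lt.1 hxy).eq_or_lt with rfl | hlt
    · simp
    · rw [abs_sub_comm, abs_sub_comm (G i x)]
      exact this hy hx hlt
  obtain ⟨c, hc, hcd⟩ := exists_hasDerivAt_eq_slope (G i) (G (i + 1)) hxy
    (fun t ht => (hG i t (by linarith [ht.1, hx.1])).continuousAt.continuousWithinAt)
    (fun t ht => hG i t (by linarith [ht.1, hx.1]))
  have hc' := h c ⟨by linarith [hc.1, hx.1], by linarith [hc.2, hy.2]⟩
  have hpos : 0 < y - x := by linarith
  rw [eq_div_iff hpos.ne'] at hcd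
  rw [abs_sub_comm, abs_sub_comm (G i x), ← hcd, abs_mul]
  exact ⟨mul_le_mul_of_nonneg_right hc'.1 (abs_nonneg _),
    mul_le_mul_of_nonneg_right hc'.2 (abs_nonneg _)⟩

end Taylor

/-- Comparing a sum with its translates. -/
lemma norm_sum_le_shift (f : ℕ → ℂ) (hf : ∀ n, ‖f n‖ ≤ 1) {A B Y y : ℕ} (hy : y ≤ Y)
    (hAB : A + Y ≤ B) :
    ‖∑ n ∈ Ioc A B, f n - ∑ m ∈ Ioc A (B - Y), f (m + y)‖ ≤ Y := by
  have h1 : ∑ m ∈ Ioc A (B - Y), f (m + y) = ∑ n ∈ Ioc (A + y) (B - Y + y), f n := by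
    rw [← map_add_right_Ioc, sum_map]
    rfl
  have hle (a b : ℕ) : ‖∑ n ∈ Ioc a b, f n‖ ≤ ((b - a : ℕ) : ℝ) := by
    refine (norm_sum_le_of_le _ fun n _ => hf n).trans ?_
    simp
  have h2 : ∑ n ∈ Ioc A B, f n = ∑ n ∈ Ioc A (A + y), f n +
      ∑ n ∈ Ioc (A + y) (B - Y + y), f n + ∑ n ∈ Ioc (B - Y + y) B, f n := by
    rw [sum_Ioc_consecutive _ (by omega) (by omega), sum_Ioc_consecutive _ (by omega) (by omega)]
  rw [h1, h2]
  calc _ = ‖∑ n ∈ Ioc A (A + y), f n + ∑ n ∈ Ioc (B - Y + y) B, f n‖ := by congr 1; ring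
    _ ≤ ((A + y - A : ℕ) : ℝ) + ((B - (B - Y + y) : ℕ) : ℝ) :=
      (norm_add_le _ _).trans (add_le_add (hle _ _) (hle _ _))
    _ = Y := by
      rw [← Nat.cast_add]
      congr 1
      omega

/-- The Weyl sum attached to the Taylor polynomial at `m`. -/
def weylTaylor (G : ℕ → ℝ → ℝ) (k Y m : ℕ) : ℂ :=
  ∑ y ∈ Icc 1 Y, e (∑ j : Fin k, G (j.val + 1) m / (j.val + 1).factorial * (y : ℝ) ^ (j.val + 1))

lemma norm_sum_le_weylTaylor {G : ℕ → ℝ → ℝ}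
    (hG : ∀ i, ∀ x, 0 < x → HasDerivAt (G i) (G (i + 1) x) x) {A B Y k : ℕ} {L : ℝ} (hA : 1 ≤ A)
    (hY : 1 ≤ Y) (hAB : A + Y ≤ B) (hL : ∀ x ∈ Set.Icc (A : ℝ) B, |G (k + 1) x| ≤ L) :
    ‖∑ n ∈ Ioc A B, e (G 0 n)‖ ≤ Y + 2 * Real.pi * (L * (Y : ℝ) ^ (k + 1)) * ((B : ℝ) - A) +
      1 / Y * ∑ m ∈ Ioc A (B - Y), ‖weylTaylor G k Y m‖ := by
  have hpi := Real.pi_pos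
  have hY0 : (0 : ℝ) < Y := by exact_mod_cast hY
  have hABr : (A : ℝ) + Y ≤ B := by exact_mod_cast hAB
  have hL0 : 0 ≤ L := (abs_nonneg _).trans (hL A ⟨le_rfl, by linarith⟩)
  set S := ∑ n ∈ Ioc A B, e (G 0 n) with hS
  have h1 : ∀ m ∈ Ioc A (B - Y), ‖∑ y ∈ Icc 1 Y, e (G 0 ((m : ℝ) + y))‖ ≤
      ‖weylTaylor G k Y m‖ + Y * (2 * Real.pi * (L * (Y : ℝ) ^ (k + 1))) := by
    intro m hm
    have hm := mem_Ioc.1 hm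
    have hm0 : (0 : ℝ) < m := by exact_mod_cast (by omega : 0 < m)
    have hmA : (A : ℝ) ≤ m := by exact_mod_cast hm.1.le
    have hmB : (m : ℝ) + Y ≤ B := by exact_mod_cast (by omega : m + Y ≤ B)
    have h2 : ∀ y ∈ Icc 1 Y, ‖e (G 0 ((m : ℝ) + y)) - e (G 0 m) *
        e (∑ j : Fin k, G (j.val + 1) m / (j.val + 1).factorial * (y : ℝ) ^ (j.val + 1))‖ ≤
        2 * Real.pi * (L * (Y : ℝ) ^ (k + 1)) := by
      intro y hy
      have hy := mem_Icc.1 hy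
      have hyY : (y : ℝ) ≤ Y := by exact_mod_cast hy.2
      rw [← e_add]
      refine (norm_e_sub_e_le _ _).trans ?_
      have := taylor_chain hG hm0 (k + 1) 0 (b := B) (L := L) (fun x hx => by
        rw [zero_add]; exact hL x ⟨by linarith [hx.1], hx.2⟩) (y := y) (by positivity)
        (by linarith)
      rw [sum_range_succ', ← Fin.sum_univ_eq_sum_range
        (fun j => G (0 + (j + 1)) m * (y : ℝ) ^ (j + 1) / (j + 1).factorial)] at this
      have heq : G 0 m + ∑ j : Fin k, G (j.val + 1) m / (j.val + 1).factorial *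
          (y : ℝ) ^ (j.val + 1) = ∑ j : Fin k, G (0 + (j.val + 1)) m * (y : ℝ) ^ (j.val + 1) /
          (j.val + 1).factorial + G (0 + 0) m * (y : ℝ) ^ 0 / Nat.factorial 0 := by
        rw [add_comm]
        simp only [zero_add, pow_zero, mul_one, Nat.factorial_zero, Nat.cast_one, div_one]
        congr 1
        exact sum_congr rfl fun j _ => by ring
      rw [heq]
      gcongr
      exact this.trans (by gcongr)
    have h3 : ‖∑ y ∈ Icc 1 Y, e (G 0 ((m : ℝ) + y)) - e (G 0 m) * weylTaylor G k Y m‖ ≤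
        Y * (2 * Real.pi * (L * (Y : ℝ) ^ (k + 1))) := by
      rw [weylTaylor, mul_sum, ← sum_sub_distrib]
      refine (norm_sum_le_of_le _ h2).trans ?_
      rw [sum_const, Nat.card_Icc, nsmul_eq_mul]
      simp
    calc _ = ‖e (G 0 m) * weylTaylor G k Y m + (∑ y ∈ Icc 1 Y, e (G 0 ((m : ℝ) + y)) -
          e (G 0 m) * weylTaylor G k Y m)‖ := by congr 1; ring
      _ ≤ _ := (norm_add_le _ _).trans (add_le_add (by rw [norm_mul, norm_e, one_mul]) h3)
  have h4 : ‖(Y : ℂ) * S - ∑ m ∈ Ioc A (B - Y), ∑ y ∈ Icc 1 Y, e (G 0 ((m : ℝ) + y))‖ ≤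
      Y * Y := by
    rw [sum_comm]
    have : (Y : ℂ) * S = ∑ _y ∈ Icc 1 Y, S := by simp
    rw [this, ← sum_sub_distrib]
    refine (norm_sum_le_of_le (n := fun _ => (Y : ℝ)) _ fun y hy => ?_).trans ?_
    · have := norm_sum_le_shift (fun n => e (G 0 n)) (fun n => (norm_e _).le) (mem_Icc.1 hy).2 hAB
      push_cast at this
      exact this
    · simp
  have h5 : ‖(Y : ℂ) * S‖ ≤ Y * Y + ∑ m ∈ Ioc A (B - Y), (‖weylTaylor G k Y m‖ +
      Y * (2 * Real.pi * (L * (Y : ℝ) ^ (k + 1)))) := by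
    calc _ = ‖((Y : ℂ) * S - ∑ m ∈ Ioc A (B - Y), ∑ y ∈ Icc 1 Y, e (G 0 ((m : ℝ) + y))) +
          ∑ m ∈ Ioc A (B - Y), ∑ y ∈ Icc 1 Y, e (G 0 ((m : ℝ) + y))‖ := by congr 1; ring
      _ ≤ _ := (norm_add_le _ _).trans (add_le_add h4 (norm_sum_le_of_le _ h1))
  rw [norm_mul, Complex.norm_natCast, sum_add_distrib, sum_const, Nat.card_Ioc, nsmul_eq_mul] at h5
  have h6 : ((B - Y - A : ℕ) : ℝ) ≤ (B : ℝ) - A := by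
    rw [Nat.sub_sub, Nat.cast_sub (by omega)]
    push_cast
    linarith
  have h7 : ((B - Y - A : ℕ) : ℝ) * (Y * (2 * Real.pi * (L * (Y : ℝ) ^ (k + 1)))) ≤
      ((B : ℝ) - A) * (Y * (2 * Real.pi * (L * (Y : ℝ) ^ (k + 1)))) := by gcongr
  refine le_of_mul_le_mul_left (h5.trans ?_) hY0
  have h8 : (Y : ℝ) * (1 / Y * ∑ m ∈ Ioc A (B - Y), ‖weylTaylor G k Y m‖) =
      ∑ m ∈ Ioc A (B - Y), ‖weylTaylor G k Y m‖ := by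
    field_simp
  rw [mul_add, mul_add, h8]
  linarith

/-- A bound for an exponential sum whose phase has a controlled derivative of order `k + 2`. -/
theorem exp_sum_block {k s : ℕ} (hs : 2 * s = (k + 1) * (k + 2)) {ε : ℝ} (hε : 0 < ε) :
    ∃ C : ℝ, 1 ≤ C ∧ ∀ G : ℕ → ℝ → ℝ,
    (∀ i, ∀ x, 0 < x → HasDerivAt (G i) (G (i + 1) x) x) → ∀ (A B Y : ℕ) (l C₀ : ℝ), 1 ≤ A →
    1 ≤ Y → A + Y ≤ B → 0 < l →
    (∀ x ∈ Set.Icc (A : ℝ) B, l ≤ |G (k + 2) x| ∧ |G (k + 2) x| ≤ C₀ * l) →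
    C₀ * l * ((B : ℝ) - A) ≤ 1 / 2 →
    ∃ W : ℝ, 0 ≤ W ∧ W ^ (2 * s) ≤ C * ((B : ℝ) - A) ^ (2 * s - 1) * (Y : ℝ) ^ ε *
      (1 + 1 / (l * (Y : ℝ) ^ (k + 1))) ∧
    ‖∑ n ∈ Ioc A B, e (G 0 n)‖ ≤
      Y + 2 * Real.pi * (C₀ * l * (Y : ℝ) ^ (k + 2)) * ((B : ℝ) - A) + W := by
  obtain ⟨C, hC1, hC⟩ := weyl_mean_le hs hε
  have hs1 : 1 ≤ s := by nlinarith
  have hf1 : (1 : ℝ) ≤ (k + 1).factorial := by 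
    exact_mod_cast Nat.succ_le_of_lt (Nat.factorial_pos (k + 1))
  refine ⟨C * (k + 1).factorial, one_le_mul_of_one_le_of_one_le hC1 hf1,
    fun G hG A B Y l C₀ hA hY hAB hl hGl hlen => ?_⟩
  have hABr : (A : ℝ) + Y ≤ B := by exact_mod_cast hAB
  have hY0 : (0 : ℝ) < Y := by exact_mod_cast hY
  have hA0 : (0 : ℝ) < A := by exact_mod_cast hA
  have hAB' : (0 : ℝ) ≤ (B : ℝ) - A := by linarith
  set R := Ioc A (B - Y) with hR
  have hcard : (#R : ℝ) ≤ (B : ℝ) - A := by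
    rw [hR, Nat.card_Ioc, Nat.sub_sub, Nat.cast_sub (by omega)]
    push_cast
    linarith
  have hmem : ∀ m ∈ R, (m : ℝ) ∈ Set.Icc (A : ℝ) B := by
    intro m hm
    have := mem_Ioc.1 hm
    exact ⟨by exact_mod_cast this.1.le, by exact_mod_cast this.2.trans (Nat.sub_le _ _)⟩
  have hC₀ : 0 ≤ C₀ * l := (abs_nonneg _).trans (hGl A ⟨le_rfl, by linarith⟩).2
  refine ⟨1 / Y * ∑ m ∈ R, ‖weylTaylor G (k + 1) Y m‖, by positivity, ?_,
    norm_sum_le_weylTaylor hG hA hY hAB fun x hx => (hGl x hx).2⟩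
  have hsub : ∀ m ∈ R, ∀ n ∈ R, _ := fun m hm n hn =>
    abs_sub_chain hG hA0 (i := k + 1) hGl (hmem m hm) (hmem n hn)
  have habs : ∀ m n : ℕ, |G ((Fin.last k).val + 1) m / ((Fin.last k).val + 1).factorial -
      G ((Fin.last k).val + 1) n / ((Fin.last k).val + 1).factorial| =
      |G (k + 1) m - G (k + 1) n| / (k + 1).factorial := by
    intro m n
    rw [Fin.val_last, ← sub_div, abs_div, Nat.abs_cast]
  have hmean := hC Y hY R (fun m j => G (j.val + 1) m / (j.val + 1).factorial)
    (l / (k + 1).factorial) (by positivity) (fun m hm n hn => by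
      rw [habs, div_mul_eq_mul_div]
      gcongr
      exact (hsub m hm n hn).1) (fun m hm n hn => by
      rw [habs]
      refine (div_le_self (abs_nonneg _) hf1).trans ((hsub m hm n hn).2.trans (le_trans ?_ hlen))
      gcongr
      have h1 := hmem m hm
      have h2 := hmem n hn
      rw [abs_le]
      constructor <;> linarith [h1.1, h1.2, h2.1, h2.2])
  have hpow := pow_sum_le_card_mul (s := R) (f := fun m => ‖weylTaylor G (k + 1) Y m‖)
    (fun _ _ => norm_nonneg _) (2 * s - 1)
  rw [show 2 * s - 1 + 1 = 2 * s by omega] at hpow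
  have hfac : 1 + 1 / (l / (k + 1).factorial * (Y : ℝ) ^ (k + 1)) ≤
      (k + 1).factorial * (1 + 1 / (l * (Y : ℝ) ^ (k + 1))) := by
    rw [mul_add, mul_one]
    gcongr
    refine le_of_eq ?_
    field_simp
  calc (1 / Y * ∑ m ∈ R, ‖weylTaylor G (k + 1) Y m‖) ^ (2 * s)
      = 1 / (Y : ℝ) ^ (2 * s) * (∑ m ∈ R, ‖weylTaylor G (k + 1) Y m‖) ^ (2 * s) := by
        rw [mul_pow, div_pow, one_pow]
    _ ≤ 1 / (Y : ℝ) ^ (2 * s) * (((B : ℝ) - A) ^ (2 * s - 1) * (C * (Y : ℝ) ^ (2 * s + ε) *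
          ((k + 1).factorial * (1 + 1 / (l * (Y : ℝ) ^ (k + 1)))))) := by
        gcongr
        refine hpow.trans ?_
        gcongr
        exact hmean.trans (by gcongr)
    _ = _ := by
        rw [show (2 * s + ε : ℝ) = ((2 * s : ℕ) : ℝ) + ε by push_cast; ring,
          Real.rpow_add hY0, Real.rpow_natCast]
        field_simp

end

section

lemma norm_sum_e_le (A B : ℕ) (F : ℕ → ℝ) : ‖∑ n ∈ Ioc A B, e (F n)‖ ≤ ((B - A : ℕ) : ℝ) := by
  refine (norm_sum_le_of_le (n := fun _ => (1 : ℝ)) _ fun n _ => (norm_e _).le).trans ?_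
  simp

/-- An exponential sum over `[M, 16 * M]` whose phase has derivative of order `k + 2` of size
`T / M ^ (k + 2)`. -/
theorem exp_sum_order (k : ℕ) {σ μ ν c C₀ : ℝ} (hσ : 0 < σ) (hσ1 : σ ≤ 1) (hμ : 0 < μ)
    (hν : 0 < ν) (hc : 0 < c) (hC₀ : 0 < C₀) :
    ∃ C : ℝ, 1 ≤ C ∧ ∀ᶠ M : ℝ in atTop, ∀ T : ℝ,
    M ^ (σ * ((k + 2) * ((k + 1) * (k + 2) + 1) - 1) + μ) ≤ T → T ≤ M ^ (k + 1 - ν) →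
    ∀ G : ℕ → ℝ → ℝ, (∀ i, ∀ x, 0 < x → HasDerivAt (G i) (G (i + 1) x) x) →
    ∀ A B : ℕ, M ≤ A → A ≤ B → (B : ℝ) ≤ 16 * M →
    (∀ x ∈ Set.Icc (A : ℝ) B, c * T / M ^ (k + 2) ≤ |G (k + 2) x| ∧
      |G (k + 2) x| ≤ C₀ * (c * T / M ^ (k + 2))) →
    ‖∑ n ∈ Ioc A B, e (G 0 n)‖ ≤ C * M ^ (1 - σ) := by
  obtain ⟨s, hs⟩ : ∃ s, 2 * s = (k + 1) * (k + 2) := by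
    obtain ⟨s, hs⟩ := (Nat.even_mul_succ_self (k + 1)).two_dvd
    exact ⟨s, hs.symm⟩
  have hs1 : 1 ≤ s := by nlinarith
  have hsr : (2 * s : ℝ) = (k + 1) * (k + 2) := by exact_mod_cast hs
  set n : ℝ := k + 2 with hn
  have hn0 : 0 < n := by positivity
  set μ' := μ / (2 * n) with hμ'
  have hμ'0 : 0 < μ' := by positivity
  obtain ⟨C, hC1, hC⟩ := exp_sum_block hs hμ'0
  set C₁ := C * 15 ^ (2 * s - 1) * (2 ^ (k + 1) + 1) with hC₁
  have hC₁1 : 1 ≤ C₁ := by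
    refine one_le_mul_of_one_le_of_one_le (one_le_mul_of_one_le_of_one_le hC1 ?_) ?_
    · exact one_le_pow₀ (by norm_num)
    · have : (0 : ℝ) < 2 ^ (k + 1) := by positivity
      linarith
  have hpi := Real.pi_pos
  refine ⟨1 + 30 * Real.pi * C₀ + C₁, by nlinarith, ?_⟩
  filter_upwards [eventually_ge_atTop 1, (tendsto_rpow_atTop hν).eventually_ge_atTop c,
    (tendsto_rpow_atTop hν).eventually_ge_atTop (30 * (C₀ * c)),
    (tendsto_rpow_atTop (half_pos hμ)).eventually_ge_atTop (1 / c)] with M hM1 hMc hMC hMμ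
  intro T hTlo hThi G hG A B hMA hAB hBM hGl
  have hM0 : 0 < M := by linarith
  have hT0 : 0 < T := lt_of_lt_of_le (by positivity) hTlo
  set l := c * T / M ^ (k + 2) with hl
  have hl0 : 0 < l := by positivity
  have hMn : M ^ (k + 2) = M ^ n := by
    rw [hn, ← Real.rpow_natCast]; push_cast; rfl
  set y₀ := (M ^ (-σ) / l) ^ (1 / n) with hy₀
  have hy₀0 : 0 < y₀ := by positivity
  have hy₀n : l * y₀ ^ (k + 2) = M ^ (-σ) := by
    rw [hy₀, ← Real.rpow_natCast, ← Real.rpow_mul (by positivity)]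
    rw [show 1 / n * ((k + 2 : ℕ) : ℝ) = 1 by rw [hn]; push_cast; field_simp, Real.rpow_one]
    field_simp
  have hy₀1 : 1 ≤ y₀ := by
    refine Real.one_le_rpow ?_ (by positivity)
    rw [le_div_iff₀ hl0, one_mul, hl, div_le_iff₀ (by positivity), hMn, ← Real.rpow_add hM0]
    calc c * T ≤ M ^ ν * M ^ (k + 1 - ν) := by gcongr
      _ = M ^ ((k : ℝ) + 1) := by rw [← Real.rpow_add hM0]; ring_nf
      _ ≤ _ := Real.rpow_le_rpow_of_exponent_le hM1 (by rw [hn]; linarith)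
  have hy₀M : y₀ ≤ M ^ (1 - (2 * s + 1) * σ - μ') := by
    refine le_of_pow_le_pow_left₀ (n := k + 2) (by omega) (by positivity) ?_
    have h1 : y₀ ^ (k + 2) = M ^ (-σ) * M ^ n * (1 / c) * (1 / T) := by
      have : y₀ ^ (k + 2) = M ^ (-σ) / l := by rw [← hy₀n]; field_simp
      rw [this, hl, hMn]
      field_simp
    have h2 : 1 / T ≤ M ^ (-(σ * ((k + 2) * ((k + 1) * (k + 2) + 1) - 1) + μ)) := by
      rw [Real.rpow_neg hM0.le, ← one_div]
      exact one_div_le_one_div_of_le (by positivity) hTlo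
    rw [h1]
    calc _ ≤ M ^ (-σ) * M ^ n * M ^ (μ / 2) *
          M ^ (-(σ * ((k + 2) * ((k + 1) * (k + 2) + 1) - 1) + μ)) := by gcongr
      _ = _ := by
        rw [← Real.rpow_add hM0, ← Real.rpow_add hM0, ← Real.rpow_add hM0, ← Real.rpow_natCast,
          ← Real.rpow_mul hM0.le]
        congr 1
        rw [hsr, hμ']
        push_cast
        rw [← hn]
        field_simp
        rw [hn]
        ring
  obtain ⟨Y, hY⟩ : ∃ Y, Y = ⌊y₀⌋₊ := ⟨_, rfl⟩
  have hYle : (Y : ℝ) ≤ y₀ := by rw [hY]; exact Nat.floor_le hy₀0.le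
  have hY1 : 1 ≤ Y := by rw [hY]; exact Nat.le_floor (by simpa using hy₀1)
  have hY1r : (1 : ℝ) ≤ Y := by exact_mod_cast hY1
  have hYge : y₀ / 2 ≤ Y := by
    have := Nat.lt_floor_add_one y₀
    rw [← hY] at this
    linarith
  have hYM : (Y : ℝ) ≤ M ^ (1 - σ) := by
    refine hYle.trans (hy₀M.trans (Real.rpow_le_rpow_of_exponent_le hM1 ?_))
    have : (0 : ℝ) ≤ s * σ := by positivity
    linarith
  have hMσ0 : 0 < M ^ (1 - σ) := by positivity
  rcases lt_or_ge B (A + Y) with hBY | hBY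
  · refine (norm_sum_e_le A B _).trans ?_
    have : ((B - A : ℕ) : ℝ) ≤ Y := by exact_mod_cast (by omega : B - A ≤ Y)
    have h2 : (0 : ℝ) ≤ 30 * Real.pi * C₀ + C₁ := by positivity
    nlinarith
  have hBA3 : (B : ℝ) - A ≤ 15 * M := by linarith
  have hBA0 : (0 : ℝ) ≤ (B : ℝ) - A := by
    have : (A : ℝ) ≤ B := by exact_mod_cast hAB
    linarith
  have hA1 : 1 ≤ A := by
    have : (1 : ℝ) ≤ A := hM1.trans hMA
    exact_mod_cast this
  obtain ⟨W, hW0, hWP, hS⟩ := hC G hG A B Y l C₀ hA1 hY1 hBY hl0 hGl (by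
    have h1 : l * M ≤ c * M ^ (-ν) := by
      rw [hl, div_mul_eq_mul_div, div_le_iff₀ (by positivity), mul_assoc, mul_assoc]
      refine mul_le_mul_of_nonneg_left ?_ hc.le
      calc T * M ≤ M ^ (k + 1 - ν) * M ^ (1 : ℝ) := by rw [Real.rpow_one]; gcongr
        _ = M ^ (-ν) * M ^ (k + 2) := by
          rw [hMn, ← Real.rpow_add hM0, ← Real.rpow_add hM0, hn]
          ring_nf
    calc C₀ * l * ((B : ℝ) - A) ≤ C₀ * l * (15 * M) := by gcongr
      _ = 15 * C₀ * (l * M) := by ring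
      _ ≤ 15 * C₀ * (c * M ^ (-ν)) := by gcongr
      _ = 1 / 2 * (30 * (C₀ * c) * M ^ (-ν)) := by ring
      _ ≤ 1 / 2 * (M ^ ν * M ^ (-ν)) := by gcongr
      _ = 1 / 2 := by rw [← Real.rpow_add hM0]; simp)
  refine hS.trans ?_
  have hmid : 2 * Real.pi * (C₀ * l * (Y : ℝ) ^ (k + 2)) * ((B : ℝ) - A) ≤
      30 * Real.pi * C₀ * M ^ (1 - σ) := by
    calc _ ≤ 2 * Real.pi * (C₀ * l * y₀ ^ (k + 2)) * (15 * M) := by gcongr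
      _ = 30 * Real.pi * C₀ * (M ^ (-σ) * M) := by rw [mul_assoc C₀, hy₀n]; ring
      _ = _ := by
        congr 1
        nth_rewrite 2 [← Real.rpow_one M]
        rw [← Real.rpow_add hM0]
        ring_nf
  have hW : W ≤ C₁ * M ^ (1 - σ) := by
    refine le_of_pow_le_pow_left₀ (n := 2 * s) (by omega) (by positivity) ?_
    have h1 : 1 / (l * (Y : ℝ) ^ (k + 1)) ≤ 2 ^ (k + 1) * (y₀ * M ^ σ) := by
      have h2 : 1 / (l * (Y : ℝ) ^ (k + 1)) ≤ 1 / (l * (y₀ / 2) ^ (k + 1)) := by gcongr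
      refine h2.trans (le_of_eq ?_)
      have h3 : M ^ σ = 1 / (l * y₀ ^ (k + 2)) := by
        rw [hy₀n, Real.rpow_neg hM0.le, one_div, inv_inv]
      rw [h3, div_pow, pow_succ y₀ (k + 1)]
      field_simp
    have h4 : 1 + 1 / (l * (Y : ℝ) ^ (k + 1)) ≤
        (2 ^ (k + 1) + 1) * M ^ (1 - 2 * s * σ - μ') := by
      have h5 : y₀ * M ^ σ ≤ M ^ (1 - 2 * s * σ - μ') := by
        calc y₀ * M ^ σ ≤ M ^ (1 - (2 * s + 1) * σ - μ') * M ^ σ := by gcongr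
          _ = _ := by rw [← Real.rpow_add hM0]; ring_nf
      have h6 : 1 ≤ y₀ * M ^ σ :=
        one_le_mul_of_one_le_of_one_le hy₀1 (Real.one_le_rpow hM1 hσ.le)
      have h7 : (2 : ℝ) ^ (k + 1) * (y₀ * M ^ σ) ≤ 2 ^ (k + 1) * M ^ (1 - 2 * s * σ - μ') := by
        gcongr
      linarith
    have h8 : (Y : ℝ) ^ μ' ≤ M ^ μ' := by
      refine Real.rpow_le_rpow (by positivity) (hYM.trans ?_) hμ'0.le
      calc M ^ (1 - σ) ≤ M ^ (1 : ℝ) := Real.rpow_le_rpow_of_exponent_le hM1 (by linarith)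
        _ = M := Real.rpow_one M
    calc W ^ (2 * s) ≤ C * (15 * M) ^ (2 * s - 1) * M ^ μ' *
          ((2 ^ (k + 1) + 1) * M ^ (1 - 2 * s * σ - μ')) := by
          refine hWP.trans ?_
          gcongr
      _ = C₁ * (M ^ (2 * s - 1) * (M ^ μ' * M ^ (1 - 2 * s * σ - μ'))) := by
          rw [hC₁, mul_pow]; ring
      _ = C₁ * (M ^ (1 - σ)) ^ (2 * s) := by
          congr 1
          have h9 : M ^ (2 * s - 1) = M ^ (2 * s - 1 : ℝ) := by
            rw [← Real.rpow_natCast, Nat.cast_sub (by omega)]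
            push_cast
            rfl
          rw [h9, ← Real.rpow_natCast (M ^ (1 - σ)), ← Real.rpow_mul hM0.le,
            ← Real.rpow_add hM0, ← Real.rpow_add hM0]
          congr 1
          push_cast
          ring
      _ ≤ C₁ ^ (2 * s) * (M ^ (1 - σ)) ^ (2 * s) := by
          gcongr
          exact le_self_pow₀ hC₁1 (by omega)
      _ = _ := (mul_pow _ _ _).symm
  linarith

end

section

/-- The falling factorial `θ (θ - 1) ⋯ (θ - i + 1)`. -/
def fallFac (θ : ℝ) (i : ℕ) : ℝ := ∏ l ∈ range i, (θ - l)

lemma fallFac_ne_zero {θ : ℝ} (hθ : ∀ z : ℤ, (z : ℝ) ≠ θ) (i : ℕ) : fallFac θ i ≠ 0 := by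
  refine prod_ne_zero_iff.2 fun l _ h => hθ l ?_
  push_cast
  linarith

section Chain

variable {d : ℕ}

/-- The derivatives of a generalized polynomial with coefficients `c` and exponents `θ`. -/
def genPoly (c θ : Fin (d + 1) → ℝ) (i : ℕ) (x : ℝ) : ℝ :=
  ∑ j, c j * (fallFac (θ j) i * x ^ (θ j - i))

lemma genPoly_zero (c θ : Fin (d + 1) → ℝ) (x : ℝ) : genPoly c θ 0 x = ∑ j, c j * x ^ θ j := by
  simp [genPoly, fallFac]

lemma hasDerivAt_genPoly (c θ : Fin (d + 1) → ℝ) (i : ℕ) (x : ℝ) (hx : 0 < x) :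
    HasDerivAt (genPoly c θ i) (genPoly c θ (i + 1) x) x := by
  unfold genPoly
  refine HasDerivAt.fun_sum fun j _ => ?_
  have h := ((Real.hasDerivAt_rpow_const (x := x) (p := θ j - i) (Or.inl hx.ne')).const_mul
    (fallFac (θ j) i)).const_mul (c j)
  refine h.congr_deriv ?_
  rw [show fallFac (θ j) (i + 1) = fallFac (θ j) i * (θ j - i) from prod_range_succ _ _]
  push_cast
  rw [sub_sub]
  ring

lemma rpow_mem_of_mem_Icc {M x : ℝ} (hM : 0 < M) (hx : x ∈ Set.Icc M (16 * M)) (a : ℝ) :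
    M ^ a * (16 ^ |a|)⁻¹ ≤ x ^ a ∧ x ^ a ≤ M ^ a * 16 ^ |a| := by
  obtain ⟨u, rfl⟩ : ∃ u, x = M * u := ⟨x / M, by field_simp⟩
  have hu1 : 1 ≤ u := by have := hx.1; nlinarith
  have hu16 : u ≤ 16 := by have := hx.2; nlinarith
  have hu0 : 0 < u := by linarith
  rw [Real.mul_rpow hM.le hu0.le]
  have h16 : u ^ |a| ≤ 16 ^ |a| := Real.rpow_le_rpow hu0.le hu16 (abs_nonneg _)
  constructor
  · refine mul_le_mul_of_nonneg_left ?_ (by positivity)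
    calc (16 ^ |a|)⁻¹ ≤ (u ^ |a|)⁻¹ := by gcongr
      _ = u ^ (-|a|) := by rw [Real.rpow_neg hu0.le]
      _ ≤ u ^ a := Real.rpow_le_rpow_of_exponent_le hu1 (neg_abs_le a)
  · refine mul_le_mul_of_nonneg_left ?_ (by positivity)
    exact (Real.rpow_le_rpow_of_exponent_le hu1 (le_abs_self a)).trans h16

/-- The derivatives of a generalized polynomial are controlled by the dominant term. -/
lemma genPoly_bounds {θ : Fin (d + 1) → ℝ} (hθ : ∀ z : ℤ, (z : ℝ) ≠ θ (Fin.last d)) (i : ℕ) :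
    ∃ η > 0, ∃ b > 0, ∃ C₀ > 0, ∀ M : ℝ, 0 < M → ∀ (c : Fin (d + 1) → ℝ) (T : ℝ),
    T = |c (Fin.last d)| * M ^ θ (Fin.last d) →
    (∀ j : Fin d, |c j.castSucc| * M ^ θ j.castSucc ≤ η * T) →
    ∀ x ∈ Set.Icc M (16 * M), b * T / M ^ i ≤ |genPoly c θ i x| ∧
      |genPoly c θ i x| ≤ C₀ * (b * T / M ^ i) := by
  set E : Fin (d + 1) → ℝ := fun j => |fallFac (θ j) i| * 16 ^ |θ j - i| with hE
  have hE0 : ∀ j, 0 ≤ E j := fun j => by positivity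
  have hD : 0 < |fallFac (θ (Fin.last d)) i| := abs_pos.2 (fallFac_ne_zero hθ i)
  set b : ℝ := |fallFac (θ (Fin.last d)) i| * (16 ^ |θ (Fin.last d) - i|)⁻¹ / 2 with hb
  have hb0 : 0 < b := by positivity
  set S : ℝ := ∑ j : Fin d, E j.castSucc + 1 with hS
  have hS0 : 0 < S := by positivity
  refine ⟨b / S, by positivity, b, hb0, (E (Fin.last d) + b) / b, ?_, ?_⟩
  · have := hE0 (Fin.last d)
    positivity
  intro M hM c T hT hc x hx
  have hT0 : 0 ≤ T := by rw [hT]; positivity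
  have hMi : 0 < M ^ i := by positivity
  have hsplit : ∀ a : ℝ, M ^ (a - i) = M ^ a / M ^ i := fun a => by
    rw [Real.rpow_sub hM, Real.rpow_natCast]
  have hrest : |∑ j : Fin d, c j.castSucc * (fallFac (θ j.castSucc) i *
      x ^ (θ j.castSucc - i))| ≤ b * T / M ^ i := by
    calc _ ≤ ∑ j : Fin d, |c j.castSucc * (fallFac (θ j.castSucc) i *
          x ^ (θ j.castSucc - i))| := abs_sum_le_sum_abs _ _
      _ ≤ ∑ j : Fin d, E j.castSucc * (b / S * T / M ^ i) := by
        refine sum_le_sum fun j _ => ?_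
        rw [abs_mul, abs_mul, abs_of_nonneg (Real.rpow_nonneg (hM.le.trans hx.1) _)]
        calc _ ≤ |c j.castSucc| * (|fallFac (θ j.castSucc) i| *
              (M ^ (θ j.castSucc - i) * 16 ^ |θ j.castSucc - i|)) := by
              gcongr; exact (rpow_mem_of_mem_Icc hM hx _).2
          _ = E j.castSucc * (|c j.castSucc| * M ^ θ j.castSucc / M ^ i) := by
              rw [hE, hsplit]; ring
          _ ≤ _ := mul_le_mul_of_nonneg_left
              (div_le_div_of_nonneg_right (hc j) hMi.le) (hE0 _)
      _ = (S - 1) / S * (b * T / M ^ i) := by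
        rw [← sum_mul, hS]; field_simp; ring
      _ ≤ 1 * (b * T / M ^ i) := by
        gcongr
        rw [div_le_one hS0]; linarith
      _ = _ := one_mul _
  have hmain : |c (Fin.last d) * (fallFac (θ (Fin.last d)) i * x ^ (θ (Fin.last d) - i))| =
      |c (Fin.last d)| * |fallFac (θ (Fin.last d)) i| * x ^ (θ (Fin.last d) - i) := by
    rw [abs_mul, abs_mul, abs_of_nonneg (Real.rpow_nonneg (hM.le.trans hx.1) _), mul_assoc]
  have hx' := rpow_mem_of_mem_Icc hM hx (θ (Fin.last d) - i)
  have hlo : 2 * (b * T / M ^ i) ≤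
      |c (Fin.last d) * (fallFac (θ (Fin.last d)) i * x ^ (θ (Fin.last d) - i))| := by
    rw [hmain]
    calc _ = |c (Fin.last d)| * |fallFac (θ (Fin.last d)) i| *
          (M ^ (θ (Fin.last d) - i) * (16 ^ |θ (Fin.last d) - i|)⁻¹) := by
          rw [hT, hb, hsplit]; ring
      _ ≤ _ := by gcongr; exact hx'.1
  have hhi : |c (Fin.last d) * (fallFac (θ (Fin.last d)) i * x ^ (θ (Fin.last d) - i))| ≤
      E (Fin.last d) * (T / M ^ i) := by
    rw [hmain]
    calc _ ≤ |c (Fin.last d)| * |fallFac (θ (Fin.last d)) i| *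
          (M ^ (θ (Fin.last d) - i) * 16 ^ |θ (Fin.last d) - i|) := by gcongr; exact hx'.2
      _ = _ := by rw [hT, hE, hsplit]; ring
  have hC : (E (Fin.last d) + b) / b * (b * T / M ^ i) =
      E (Fin.last d) * (T / M ^ i) + b * T / M ^ i := by
    field_simp
  rw [hC, genPoly, Fin.sum_univ_castSucc]
  set u := ∑ j : Fin d, c j.castSucc * (fallFac (θ j.castSucc) i * x ^ (θ j.castSucc - i))
  set v := c (Fin.last d) * (fallFac (θ (Fin.last d)) i * x ^ (θ (Fin.last d) - i))
  constructor
  · have := abs_sub_abs_le_abs_sub v (-u)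
    rw [abs_neg, sub_neg_eq_add, add_comm v] at this
    linarith
  · have := abs_add_le u v
    linarith

/-- Exponential sums with a generalized polynomial of non-integral degree as phase. -/
theorem exp_sum_genPoly {θ : Fin (d + 1) → ℝ} (hθ : ∀ z : ℤ, (z : ℝ) ≠ θ (Fin.last d))
    {σ μ ν τ : ℝ} (hσ : 0 < σ) (hσ1 : σ ≤ 1) (hμ : 0 < μ) (hν : 0 < ν) (K : ℕ)
    (hstep : ∀ k < K, σ * ((k + 3) * ((k + 2) * (k + 3) + 1) - 1) + μ ≤ k + 1 - ν)
    (hτ : τ ≤ K + 1 - ν) :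
    ∃ η > 0, ∃ C ≥ 1, ∀ᶠ M : ℝ in atTop, ∀ (c : Fin (d + 1) → ℝ) (T : ℝ),
    T = |c (Fin.last d)| * M ^ θ (Fin.last d) →
    (∀ j : Fin d, |c j.castSucc| * M ^ θ j.castSucc ≤ η * T) →
    M ^ (5 * σ + μ) ≤ T → T ≤ M ^ τ →
    ∀ A B : ℕ, M ≤ A → A ≤ B → (B : ℝ) ≤ 16 * M →
    ‖∑ n ∈ Ioc A B, e (∑ j, c j * (n : ℝ) ^ θ j)‖ ≤ C * M ^ (1 - σ) := by
  choose η hη b hb C₀ hC₀ hbd using genPoly_bounds hθ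
  choose C hC1 hC using fun k => exp_sum_order k hσ hσ1 hμ hν (hb (k + 2)) (hC₀ (k + 2))
  have hne : (range (K + 1)).Nonempty := ⟨0, by simp⟩
  obtain ⟨η', hη'0, hη'⟩ : ∃ η' > 0, ∀ k ∈ range (K + 1), η' ≤ η (k + 2) :=
    ⟨(range (K + 1)).inf' hne fun k => η (k + 2), (lt_inf'_iff hne).2 fun k _ => hη _,
      fun k hk => inf'_le (fun k => η (k + 2)) hk⟩
  have hCsum : ∀ k ∈ range (K + 1), C k ≤ ∑ k ∈ range (K + 1), C k := fun k hk =>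
    single_le_sum (f := C) (fun i _ => zero_le_one.trans (hC1 i)) hk
  refine ⟨η', hη'0, ∑ k ∈ range (K + 1), C k, (hC1 0).trans (hCsum 0 (by simp)), ?_⟩
  filter_upwards [eventually_ge_atTop 1,
    (eventually_all_finset (range (K + 1))).2 fun k _ => hC k] with M hM1 hM
  intro c T hT hc hlo hhi A B hA hAB hB
  have hM0 : 0 < M := by linarith
  have hT0 : 0 ≤ T := by rw [hT]; positivity
  obtain ⟨k, hkK, hk1, hk2⟩ : ∃ k ≤ K,
      M ^ (σ * ((k + 2) * ((k + 1) * (k + 2) + 1) - 1) + μ) ≤ T ∧ T ≤ M ^ (k + 1 - ν) := by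
    have hex : ∃ k : ℕ, T ≤ M ^ (k + 1 - ν) :=
      ⟨K, hhi.trans (Real.rpow_le_rpow_of_exponent_le hM1 hτ)⟩
    classical
    have hmin := fun j (hj : j < Nat.find hex) => Nat.find_min hex hj
    have hle : Nat.find hex ≤ K :=
      Nat.find_min' hex (hhi.trans (Real.rpow_le_rpow_of_exponent_le hM1 hτ))
    have hsp := Nat.find_spec hex
    refine ⟨Nat.find hex, hle, ?_, hsp⟩
    rcases hz : Nat.find hex with _ | k
    · refine le_trans (le_of_eq ?_) hlo
      congr 1
      push_cast
      ring
    · have h1 := not_le.1 (hmin k (by omega))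
      refine le_trans (Real.rpow_le_rpow_of_exponent_le hM1 ?_) h1.le
      refine le_trans (le_of_eq ?_) (hstep k (by omega))
      push_cast
      ring
  have hkr : k ∈ range (K + 1) := mem_range.2 (by omega)
  have := hM k hkr T hk1 hk2 (genPoly c θ) (hasDerivAt_genPoly c θ) A B hA hAB hB
    fun x hx => hbd (k + 2) M hM0 c T hT (fun j => (hc j).trans
      (mul_le_mul_of_nonneg_right (hη' k hkr) hT0)) x ⟨hA.trans hx.1, hx.2.trans hB⟩
  simp only [genPoly_zero] at this
  refine this.trans ?_
  gcongr
  exact hCsum k hkr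

end Chain

end

section

/-- The exponent `1 / (3 (8 Θ² + 12 Θ + 10))`. -/
def rho (Θ : ℝ) : ℝ := 1 / (3 * (8 * Θ ^ 2 + 12 * Θ + 10))

lemma rho_pos (Θ : ℝ) : 0 < rho Θ := by
  unfold rho
  have : 0 < 8 * Θ ^ 2 + 12 * Θ + 10 := by nlinarith [sq_nonneg (4 * Θ + 3)]
  positivity

lemma rho_le {Θ : ℝ} (h : 3 < Θ) : rho Θ ≤ 1 / 354 := by
  unfold rho
  apply one_div_le_one_div_of_le <;> nlinarith

lemma exists_order {Θ : ℝ} (h : 3 < Θ) : ∃ K : ℕ,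
    (∀ k < K, 22 / 5 * rho Θ * (((k : ℝ) + 3) * ((k + 2) * (k + 3) + 1) - 1) + 1 / 1000
      ≤ k + 1 - 1 / 1000) ∧ 2 * Θ + 1 / 10 ≤ K + 1 - 1 / 1000 := by
  have hc : 0 < ⌈2 * Θ + 101 / 1000⌉₊ := Nat.ceil_pos.2 (by linarith)
  refine ⟨⌈2 * Θ + 101 / 1000⌉₊ - 1, fun k hk => ?_, ?_⟩
  · have h1 : (k : ℝ) + 1 < 2 * Θ + 101 / 1000 := by
      have : k + 1 < ⌈2 * Θ + 101 / 1000⌉₊ := by omega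
      exact_mod_cast Nat.lt_ceil.1 this
    have hD : 0 < 3 * (8 * Θ ^ 2 + 12 * Θ + 10) := by nlinarith
    have key : 22 / 5 * (((k : ℝ) + 3) * ((k + 2) * (k + 3) + 1) - 1) ≤
        (k + 1 - 2 / 1000) * (3 * (8 * Θ ^ 2 + 12 * Θ + 10)) := by
      rcases le_or_gt k 5 with h5 | h5
      · have hD' : 354 ≤ 3 * (8 * Θ ^ 2 + 12 * Θ + 10) := by nlinarith
        have hk0 : (0 : ℝ) ≤ k + 1 - 2 / 1000 := by
          have : (0 : ℝ) ≤ k := Nat.cast_nonneg k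
          linarith
        refine le_trans ?_ (mul_le_mul_of_nonneg_left hD' hk0)
        interval_cases k <;> norm_num
      · have h6 : (6 : ℝ) ≤ k := by exact_mod_cast h5
        have hD' : 3 * (2 * ((k : ℝ) + 1 - 101 / 1000) ^ 2 + 6 * (k + 1 - 101 / 1000) + 10) ≤
            3 * (8 * Θ ^ 2 + 12 * Θ + 10) := by nlinarith
        have hk0 : (0 : ℝ) ≤ k + 1 - 2 / 1000 := by linarith
        refine le_trans ?_ (mul_le_mul_of_nonneg_left hD' hk0)
        obtain ⟨t, ht⟩ : ∃ t : ℝ, t = k - 6 := ⟨_, rfl⟩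
        have ht0 : 0 ≤ t := by linarith
        rw [show (k : ℝ) = t + 6 by linarith]
        nlinarith [pow_nonneg ht0 2, pow_nonneg ht0 3]
    unfold rho
    have : 22 / 5 * (1 / (3 * (8 * Θ ^ 2 + 12 * Θ + 10))) *
        (((k : ℝ) + 3) * ((k + 2) * (k + 3) + 1) - 1) ≤ k + 1 - 2 / 1000 := by
      rw [mul_one_div, div_mul_eq_mul_div, div_le_iff₀ hD]
      exact key
    linarith
  · have := Nat.le_ceil (2 * Θ + 101 / 1000)
    rw [Nat.cast_sub hc]
    push_cast
    linarith

/-- The standing assumptions on the coefficients and exponents of a pseudo polynomial. -/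
structure IsData {d : ℕ} (α θ : Fin (d + 1) → ℝ) : Prop where
  pos : ∀ j, 0 < α j
  mono : StrictMono θ
  one_le : 1 ≤ θ 0
  not_int : ∀ z : ℤ, (z : ℝ) ≠ θ (Fin.last d)
  three_lt : 3 < θ (Fin.last d)

variable {d : ℕ} {α θ : Fin (d + 1) → ℝ}

/-- The pseudo polynomial with coefficients `α` and exponents `θ`. -/
def ppol (α θ : Fin (d + 1) → ℝ) (x : ℝ) : ℝ := ∑ j, α j * x ^ θ j

lemma IsData.one_le' (h : IsData α θ) (j : Fin (d + 1)) : 1 ≤ θ j :=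
  h.one_le.trans (h.mono.monotone (Fin.zero_le j))

/-- The range of frequencies in which exponential sums over primes are estimated. -/
def FreqRange (Θ X β : ℝ) : Prop :=
  X ^ (-Θ + (121 / 5 * rho Θ + 1 / 500)) ≤ |β| ∧ |β| ≤ X ^ (2 * rho Θ)

/-- `C x ^ a ≤ x ^ b` eventually, when `a < b`. -/
lemma eventually_mul_rpow_le (C : ℝ) {a b : ℝ} (h : a < b) :
    ∀ᶠ X : ℝ in atTop, C * X ^ a ≤ X ^ b := by
  have h1 := tendsto_rpow_atTop (sub_pos.2 h)
  filter_upwards [h1.eventually_ge_atTop C, eventually_gt_atTop 0] with X hX hX0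
  rw [show b = (b - a) + a by ring, Real.rpow_add hX0 (b - a) a]
  exact mul_le_mul_of_nonneg_right hX (Real.rpow_nonneg hX0.le _)

lemma exp_sum_scaled (h : IsData α θ) : ∃ C ≥ (1 : ℝ), ∀ᶠ X : ℝ in atTop, ∀ β,
    FreqRange (θ (Fin.last d)) X β → ∀ (s : Fin (d + 1) → ℝ) (M : ℝ),
    √X / 16 ≤ M → M ≤ X → (∀ j, 0 ≤ s j) →
    (∀ j, s j * M ^ θ j * (X / 16) ^ (θ (Fin.last d) - θ j) ≤
      s (Fin.last d) * M ^ θ (Fin.last d)) →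
    X ^ (θ (Fin.last d) - 11 / 5 * rho (θ (Fin.last d))) / 16 ^ θ (Fin.last d) ≤
      s (Fin.last d) * M ^ θ (Fin.last d) →
    s (Fin.last d) * M ^ θ (Fin.last d) ≤ X ^ θ (Fin.last d) →
    ∀ A B : ℕ, M ≤ A → A ≤ B → (B : ℝ) ≤ 16 * M →
      ‖∑ n ∈ Ioc A B, e (∑ j, β * α j * s j * (n : ℝ) ^ θ j)‖ ≤
        C * M ^ (1 - 22 / 5 * rho (θ (Fin.last d))) := by
  set Θ := θ (Fin.last d) with hΘ
  have h3 : 3 < Θ := h.three_lt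
  have hr0 := rho_pos Θ
  have hr1 := rho_le h3
  set r := rho Θ with hr
  obtain ⟨K, hK1, hK2⟩ := exists_order h3
  obtain ⟨η, hη, C, hC, hM⟩ := exp_sum_genPoly h.not_int (σ := 22 / 5 * r) (μ := 1 / 1000)
    (ν := 1 / 1000) (τ := 2 * Θ + 1 / 10) (by positivity) (by linarith) (by norm_num) (by norm_num)
    K hK1 hK2
  obtain ⟨M0, hM0⟩ := eventually_atTop.1 hM
  refine ⟨C, hC, ?_⟩
  have hsq : Tendsto (fun X : ℝ => √X / 16) atTop atTop :=
    (Real.tendsto_sqrt_atTop).atTop_div_const (by norm_num)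
  have hη' : ∀ᶠ X : ℝ in atTop, ∀ j : Fin d, α j.castSucc ≤
      η * α (Fin.last d) * (X / 16) ^ (Θ - θ j.castSucc) := by
    refine eventually_all.2 fun j => ?_
    have hlt : θ j.castSucc < Θ := h.mono (Fin.castSucc_lt_last j)
    have h1 : Tendsto (fun X : ℝ => (X / 16) ^ (Θ - θ j.castSucc)) atTop atTop :=
      (tendsto_rpow_atTop (sub_pos.2 hlt)).comp (tendsto_id.atTop_div_const (by norm_num))
    have hp := mul_pos hη (h.pos (Fin.last d))
    filter_upwards [(h1.const_mul_atTop hp).eventually_ge_atTop (α j.castSucc)] with X hX using hX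
  filter_upwards [hsq.eventually_ge_atTop M0, eventually_ge_atTop 1, hη',
    eventually_mul_rpow_le (16 ^ Θ / α (Fin.last d)) (a := 22 * r + 1 / 1000)
      (b := 22 * r + 1 / 500) (by linarith),
    eventually_mul_rpow_le (α (Fin.last d) * 16 ^ (2 * Θ + 1 / 10)) (a := Θ + 2 * r)
      (b := Θ + 1 / 20) (by linarith)]
    with X hXM hX1 hXη hXlo hXhi β hβ s M hM1 hM2 hs0 hs1 hs2 hs3 A B hA hAB hB
  have hX0 : 0 < X := by linarith
  have hsX : 1 ≤ √X := Real.one_le_sqrt.2 hX1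
  have hMpos : 0 < M := lt_of_lt_of_le (by positivity) hM1
  have ha := h.pos (Fin.last d)
  have hL0 : 0 ≤ s (Fin.last d) * M ^ Θ := mul_nonneg (hs0 _) (Real.rpow_nonneg hMpos.le _)
  refine hM0 M (hXM.trans hM1) (fun j => β * α j * s j)
    (|β * α (Fin.last d) * s (Fin.last d)| * M ^ Θ) rfl (fun j => ?_) ?_ ?_ A B hA hAB hB
  · have e1 := hs1 j.castSucc
    simp only [abs_mul, abs_of_pos (h.pos _), abs_of_nonneg (hs0 _)]
    have hu : 0 ≤ s j.castSucc * M ^ θ j.castSucc :=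
      mul_nonneg (hs0 _) (Real.rpow_nonneg hMpos.le _)
    calc |β| * α j.castSucc * s j.castSucc * M ^ θ j.castSucc
        = |β| * (α j.castSucc * (s j.castSucc * M ^ θ j.castSucc)) := by ring
      _ ≤ |β| * (η * α (Fin.last d) * (s (Fin.last d) * M ^ Θ)) := by
        refine mul_le_mul_of_nonneg_left ?_ (abs_nonneg β)
        calc α j.castSucc * (s j.castSucc * M ^ θ j.castSucc)
            ≤ η * α (Fin.last d) * (X / 16) ^ (Θ - θ j.castSucc) *
              (s j.castSucc * M ^ θ j.castSucc) := mul_le_mul_of_nonneg_right (hXη j) hu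
          _ = η * α (Fin.last d) * (s j.castSucc * M ^ θ j.castSucc *
              (X / 16) ^ (Θ - θ j.castSucc)) := by ring
          _ ≤ _ := mul_le_mul_of_nonneg_left e1 (by positivity)
      _ = _ := by ring
  · simp only [abs_mul, abs_of_pos (h.pos _), abs_of_nonneg (hs0 _)]
    calc M ^ (5 * (22 / 5 * r) + 1 / 1000) ≤ X ^ (5 * (22 / 5 * r) + 1 / 1000) :=
          Real.rpow_le_rpow hMpos.le hM2 (by positivity)
      _ = X ^ (22 * r + 1 / 1000) := by ring_nf
      _ ≤ α (Fin.last d) / 16 ^ Θ * X ^ (22 * r + 1 / 500) := by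
        have h16 : (0 : ℝ) < 16 ^ Θ := by positivity
        have := mul_le_mul_of_nonneg_left hXlo (div_pos ha h16).le
        refine le_trans (le_of_eq ?_) this
        field_simp
      _ = X ^ (-Θ + (121 / 5 * r + 1 / 500)) * α (Fin.last d) *
          (X ^ (Θ - 11 / 5 * r) / 16 ^ Θ) := by
        rw [show 22 * r + 1 / 500 = (-Θ + (121 / 5 * r + 1 / 500)) + (Θ - 11 / 5 * r) by ring,
          Real.rpow_add hX0 (-Θ + _)]
        ring
      _ ≤ |β| * α (Fin.last d) * (s (Fin.last d) * M ^ Θ) := by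
        refine mul_le_mul (mul_le_mul_of_nonneg_right hβ.1 ha.le) hs2 (by positivity) (by positivity)
      _ = _ := by ring
  · simp only [abs_mul, abs_of_pos (h.pos _), abs_of_nonneg (hs0 _)]
    calc |β| * α (Fin.last d) * s (Fin.last d) * M ^ Θ
        = α (Fin.last d) * (|β| * (s (Fin.last d) * M ^ Θ)) := by ring
      _ ≤ α (Fin.last d) * (X ^ (2 * r) * X ^ Θ) := by
        refine mul_le_mul_of_nonneg_left ?_ ha.le
        exact mul_le_mul hβ.2 hs3 hL0 (by positivity)
      _ = 16 ^ (-(2 * Θ + 1 / 10)) *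
          (α (Fin.last d) * 16 ^ (2 * Θ + 1 / 10) * X ^ (Θ + 2 * r)) := by
        rw [Real.rpow_neg (by norm_num), add_comm Θ, Real.rpow_add hX0]
        have h16 : (0 : ℝ) < 16 ^ (2 * Θ + 1 / 10) := by positivity
        field_simp
      _ ≤ 16 ^ (-(2 * Θ + 1 / 10)) * X ^ (Θ + 1 / 20) :=
        mul_le_mul_of_nonneg_left hXhi (by positivity)
      _ = (√X / 16) ^ (2 * Θ + 1 / 10) := by
        rw [Real.div_rpow (by positivity) (by norm_num), Real.sqrt_eq_rpow, ← Real.rpow_mul hX0.le,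
          Real.rpow_neg (by norm_num), mul_comm, ← div_eq_mul_inv,
          show (1 / 2 : ℝ) * (2 * Θ + 1 / 10) = Θ + 1 / 20 by ring]
      _ ≤ M ^ (2 * Θ + 1 / 10) := Real.rpow_le_rpow (by positivity) hM1 (by positivity)

end

section

variable {d : ℕ} {α θ : Fin (d + 1) → ℝ}

lemma ppol_mul (α θ : Fin (d + 1) → ℝ) {v x : ℝ} (hv : 0 ≤ v) (hx : 0 ≤ x) :
    ppol α θ (v * x) = ∑ j, α j * v ^ θ j * x ^ θ j :=
  sum_congr rfl fun j _ => by rw [Real.mul_rpow hv hx]; ring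

lemma sub_one_lt_natCast_div (a : ℕ) (b : ℕ) : (a : ℝ) / b - 1 < (a / b : ℕ) := by
  rw [← Nat.floor_div_eq_div (K := ℝ)]
  linarith [Nat.lt_floor_add_one ((a : ℝ) / b)]

/-- The lower end of a range `Ioc (X / 4 / v) _`, compared with `X / (16 N)`. -/
lemma div_le_natCast_div_div {X v A : ℕ} {N : ℝ} (hv : 0 < v) (hvN : (v : ℝ) ≤ 2 * N)
    (hN : 0 < N) (hX : 16 * N ≤ X) (hA : X / 4 / v ≤ A) : (X : ℝ) / (16 * N) ≤ A := by
  have h1 : ((X / 4 / v : ℕ) : ℝ) ≤ A := by exact_mod_cast hA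
  rw [Nat.div_div_eq_div_mul] at h1
  have h2 := sub_one_lt_natCast_div X (4 * v)
  have h3 : (X : ℝ) / (4 * (2 * N)) ≤ X / ((4 * v : ℕ) : ℝ) := by
    push_cast
    have : (0 : ℝ) < v := by exact_mod_cast hv
    exact div_le_div_of_nonneg_left (by positivity) (by positivity) (by linarith)
  have h4 : (X : ℝ) / (4 * (2 * N)) = X / (16 * N) + X / (16 * N) := by ring
  have h5 : 1 ≤ (X : ℝ) / (16 * N) := (one_le_div (by positivity)).2 hX
  linarith

lemma rpow_le_rpow_neg_of_le {x y a : ℝ} (hx : 0 < x) (h : x ≤ y) (ha : 0 ≤ a) :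
    y ^ (-a) ≤ x ^ (-a) :=
  Real.rpow_le_rpow_of_nonpos hx h (by linarith)

/-- Exponential sums along `m ↦ β f (v m)` with `v` small. -/
lemma exp_sum_typeI (h : IsData α θ) : ∃ C ≥ (1 : ℝ), ∀ᶠ X : ℕ in atTop, ∀ β,
    FreqRange (θ (Fin.last d)) X β → ∀ v : ℕ, 1 ≤ v → (v : ℝ) ≤ (X : ℝ) ^ (1 / 5 : ℝ) →
    ∀ A B : ℕ, X / 4 / v ≤ A → B ≤ X / v →
      ‖∑ m ∈ Ioc A B, e (β * ppol α θ (v * m))‖ ≤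
        C * (X / v) * (X : ℝ) ^ (-(33 / 10 * rho (θ (Fin.last d)))) := by
  obtain ⟨C, hC, hev⟩ := exp_sum_scaled h
  set Θ := θ (Fin.last d) with hΘ
  have h3 : 3 < Θ := h.three_lt
  have hr0 := rho_pos Θ
  have hr1 := rho_le h3
  set r := rho Θ with hr
  refine ⟨C, hC, ?_⟩
  have hcast : Tendsto (fun X : ℕ => (X : ℝ)) atTop atTop := tendsto_natCast_atTop_atTop
  filter_upwards [hcast.eventually hev, eventually_ge_atTop 1,
    hcast.eventually (eventually_mul_rpow_le 16 (a := 1 / 5) (b := 1) (by norm_num)),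
    hcast.eventually (eventually_mul_rpow_le 16 (a := 3 / 4) (b := 4 / 5) (by norm_num))]
    with X hX hX1 hX5 hX34 β hβ v hv hvX A B hA hB
  have hX1' : (1 : ℝ) ≤ X := by exact_mod_cast hX1
  have hX0 : (0 : ℝ) < X := by linarith
  have hv1 : (1 : ℝ) ≤ v := by exact_mod_cast hv
  have hv0 : (0 : ℝ) < v := by linarith
  rcases lt_or_ge B A with hBA | hAB
  · rw [Ioc_eq_empty (by omega), sum_empty, norm_zero]
    positivity
  rw [Real.rpow_one] at hX5
  have hM45 : (X : ℝ) ^ (4 / 5 : ℝ) ≤ X / v := by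
    rw [le_div_iff₀ hv0]
    calc (X : ℝ) ^ (4 / 5 : ℝ) * v ≤ (X : ℝ) ^ (4 / 5 : ℝ) * (X : ℝ) ^ (1 / 5 : ℝ) :=
          mul_le_mul_of_nonneg_left hvX (by positivity)
      _ = X := by rw [← Real.rpow_add hX0]; norm_num
  have hM34 : (X : ℝ) ^ (3 / 4 : ℝ) ≤ X / (16 * v) := by
    rw [mul_comm, ← div_div]
    linarith
  have hM0 : (0 : ℝ) < X / (16 * v) := by positivity
  have hvM : (v : ℝ) * (X / (16 * v)) = X / 16 := by field_simp
  have hsM : ∀ t : ℝ, (v : ℝ) ^ t * (X / (16 * v) : ℝ) ^ t = ((X : ℝ) / 16) ^ t := fun t => by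
    rw [← Real.mul_rpow hv0.le hM0.le, hvM]
  have hX16 : (0 : ℝ) < (X : ℝ) / 16 := by positivity
  have := hX β hβ (fun j => (v : ℝ) ^ θ j) (X / (16 * v)) ?_ ?_ (fun j => by positivity)
    (fun j => ?_) ?_ ?_ A B ?_ hAB ?_
  · calc ‖∑ m ∈ Ioc A B, e (β * ppol α θ (v * m))‖
        = ‖∑ n ∈ Ioc A B, e (∑ j, β * α j * (v : ℝ) ^ θ j * (n : ℝ) ^ θ j)‖ := by
          congr 1
          refine sum_congr rfl fun m _ => ?_
          rw [ppol_mul α θ hv0.le (Nat.cast_nonneg m), mul_sum]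
          congr 1
          exact sum_congr rfl fun j _ => by ring
      _ ≤ C * (X / (16 * v) : ℝ) ^ (1 - 22 / 5 * r) := this
      _ = C * (X / (16 * v)) * (X / (16 * v) : ℝ) ^ (-(22 / 5 * r)) := by
        rw [sub_eq_add_neg, Real.rpow_add hM0, Real.rpow_one]
        ring
      _ ≤ C * (X / v) * (X : ℝ) ^ (-(33 / 10 * r)) := by
        refine mul_le_mul ?_ ?_ (by positivity) (by positivity)
        · refine mul_le_mul_of_nonneg_left ?_ (by positivity)
          exact div_le_div_of_nonneg_left hX0.le hv0 (by linarith)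
        · refine (rpow_le_rpow_neg_of_le (by positivity) hM34 (by positivity)).trans (le_of_eq ?_)
          rw [← Real.rpow_mul hX0.le]
          congr 1
          ring
  · refine le_trans ?_ hM34
    rw [Real.sqrt_eq_rpow]
    have : (X : ℝ) ^ (1 / 2 : ℝ) ≤ (X : ℝ) ^ (3 / 4 : ℝ) :=
      Real.rpow_le_rpow_of_exponent_le hX1' (by norm_num)
    have h0 : 0 ≤ (X : ℝ) ^ (1 / 2 : ℝ) := by positivity
    linarith
  · exact div_le_self hX0.le (by linarith)
  · rw [← hΘ, hsM, hsM, ← Real.rpow_add hX16]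
    simp
  · rw [← hΘ, hsM, Real.div_rpow hX0.le (by norm_num)]
    refine div_le_div_of_nonneg_right ?_ (by positivity)
    exact Real.rpow_le_rpow_of_exponent_le hX1' (by linarith)
  · rw [← hΘ, hsM]
    exact Real.rpow_le_rpow hX16.le (by linarith) (by linarith)
  · refine div_le_natCast_div_div (by omega) (by linarith) hv0 (le_trans ?_ hX5) hA
    exact mul_le_mul_of_nonneg_left hvX (by norm_num)
  · have h1 : (B : ℝ) ≤ (X / v : ℕ) := by exact_mod_cast hB
    refine h1.trans (Nat.cast_div_le.trans (le_of_eq ?_))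
    field_simp

lemma rpow_sub_rpow_mul_le {a b N t Θ : ℝ} (hN : 0 < N) (hNb : N ≤ b) (hba : b ≤ a)
    (ht0 : 0 ≤ t) (ht : t ≤ Θ) : (a ^ t - b ^ t) * N ^ (Θ - t) ≤ a ^ Θ - b ^ Θ := by
  have hb : 0 < b := by linarith
  have ha : 0 < a := by linarith
  have e1 : a ^ Θ = a ^ t * a ^ (Θ - t) := by rw [← Real.rpow_add ha]; ring_nf
  have e2 : b ^ Θ = b ^ t * b ^ (Θ - t) := by rw [← Real.rpow_add hb]; ring_nf
  have h1 : N ^ (Θ - t) ≤ a ^ (Θ - t) := Real.rpow_le_rpow hN.le (by linarith) (by linarith)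
  have h2 : b ^ (Θ - t) ≤ a ^ (Θ - t) := Real.rpow_le_rpow hb.le (by linarith) (by linarith)
  have h3 : b ^ t ≤ a ^ t := Real.rpow_le_rpow hb.le hba ht0
  have h4 : 0 ≤ b ^ t := by positivity
  rw [e1, e2]
  nlinarith [mul_le_mul_of_nonneg_left h1 (sub_nonneg.2 h3), mul_le_mul_of_nonneg_left h2 h4]

/-- Exponential sums along `m ↦ β (f (n₁ m) - f (n₂ m))`. -/
lemma exp_sum_typeII (h : IsData α θ) : ∃ C ≥ (1 : ℝ), ∀ᶠ X : ℕ in atTop, ∀ β,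
    FreqRange (θ (Fin.last d)) X β → ∀ N n₁ n₂ : ℕ, 1 ≤ N → (N : ℝ) ≤ √X →
    N < n₂ → n₁ ≤ 2 * N →
    N * (X : ℝ) ^ (-(11 / 5 * rho (θ (Fin.last d)))) ≤ (n₁ : ℝ) - n₂ →
    ∀ A B : ℕ, X / 4 / n₂ ≤ A → B ≤ X / n₁ →
      ‖∑ m ∈ Ioc A B, e (β * (ppol α θ (n₁ * m) - ppol α θ (n₂ * m)))‖ ≤
        C * (X / N) * (X : ℝ) ^ (-(11 / 5 * rho (θ (Fin.last d)))) := by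
  obtain ⟨C, hC, hev⟩ := exp_sum_scaled h
  set Θ := θ (Fin.last d) with hΘ
  have h3 : 3 < Θ := h.three_lt
  have hr0 := rho_pos Θ
  have hr1 := rho_le h3
  set r := rho Θ with hr
  refine ⟨C, hC, ?_⟩
  have hcast : Tendsto (fun X : ℕ => (X : ℝ)) atTop atTop := tendsto_natCast_atTop_atTop
  filter_upwards [hcast.eventually hev, eventually_ge_atTop 1,
    hcast.eventually (eventually_mul_rpow_le 16 (a := 1 / 2) (b := 1) (by norm_num))]
    with X hX hX1 hX5 β hβ N n₁ n₂ hN hNX hn2 hn1 hdiff A B hA hB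
  have hX1' : (1 : ℝ) ≤ X := by exact_mod_cast hX1
  have hX0 : (0 : ℝ) < X := by linarith
  have hN1 : (1 : ℝ) ≤ N := by exact_mod_cast hN
  have hN0 : (0 : ℝ) < N := by linarith
  rcases lt_or_ge B A with hBA | hAB
  · rw [Ioc_eq_empty (by omega), sum_empty, norm_zero]
    positivity
  rw [Real.rpow_one, ← Real.sqrt_eq_rpow] at hX5
  have hn2' : (N : ℝ) ≤ n₂ := by exact_mod_cast hn2.le
  have hn1' : (n₁ : ℝ) ≤ 2 * N := by exact_mod_cast hn1
  have hn21 : (n₂ : ℝ) ≤ n₁ := by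
    have : 0 ≤ N * (X : ℝ) ^ (-(11 / 5 * r)) := by positivity
    linarith
  have hn20 : (0 : ℝ) < n₂ := by linarith
  have hn10 : (0 : ℝ) < n₁ := by linarith
  have hMs : √X / 16 ≤ X / (16 * N) := by
    rw [div_le_div_iff₀ (by norm_num) (by positivity)]
    have : √X * N ≤ X :=
      (mul_le_mul_of_nonneg_left hNX (by positivity)).trans (Real.mul_self_sqrt hX0.le).le
    linarith
  have hM0 : (0 : ℝ) < X / (16 * N) := by positivity
  have hNM : (N : ℝ) * (X / (16 * N)) = X / 16 := by field_simp
  have hsM : ∀ t : ℝ, (N : ℝ) ^ t * (X / (16 * N) : ℝ) ^ t = ((X : ℝ) / 16) ^ t := fun t => by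
    rw [← Real.mul_rpow hN0.le hM0.le, hNM]
  have hX16 : (0 : ℝ) < (X : ℝ) / 16 := by positivity
  have hcomp := fun (t : ℝ) (ht0 : 0 ≤ t) (ht : t ≤ Θ) =>
    rpow_sub_rpow_mul_le (N := N) hN0 hn2' hn21 ht0 ht
  have hθΘ : ∀ j, θ j ≤ Θ := fun j => h.mono.monotone (Fin.le_last j)
  have := hX β hβ (fun j => (n₁ : ℝ) ^ θ j - (n₂ : ℝ) ^ θ j) (X / (16 * N)) hMs ?_ (fun j => ?_)
    (fun j => ?_) ?_ ?_ A B ?_ hAB ?_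
  · calc ‖∑ m ∈ Ioc A B, e (β * (ppol α θ (n₁ * m) - ppol α θ (n₂ * m)))‖
        = ‖∑ n ∈ Ioc A B, e (∑ j, β * α j * ((n₁ : ℝ) ^ θ j - (n₂ : ℝ) ^ θ j) *
            (n : ℝ) ^ θ j)‖ := by
          congr 1
          refine sum_congr rfl fun m _ => ?_
          rw [ppol_mul α θ hn10.le (Nat.cast_nonneg m), ppol_mul α θ hn20.le (Nat.cast_nonneg m),
            ← sum_sub_distrib, mul_sum]
          congr 1
          exact sum_congr rfl fun j _ => by ring
      _ ≤ C * (X / (16 * N) : ℝ) ^ (1 - 22 / 5 * r) := this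
      _ = C * ((X / (16 * N)) * (X / (16 * N) : ℝ) ^ (-(22 / 5 * r))) := by
        rw [sub_eq_add_neg, Real.rpow_add hM0, Real.rpow_one]
      _ ≤ C * ((X / (16 * N)) * (16 * (X : ℝ) ^ (-(11 / 5 * r)))) := by
        refine mul_le_mul_of_nonneg_left (mul_le_mul_of_nonneg_left ?_ hM0.le) (by positivity)
        refine (rpow_le_rpow_neg_of_le (by positivity) hMs (by positivity)).trans ?_
        rw [Real.sqrt_eq_rpow, Real.div_rpow (by positivity) (by norm_num),
          ← Real.rpow_mul hX0.le, Real.rpow_neg (by norm_num), div_inv_eq_mul, mul_comm,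
          show (1 / 2 : ℝ) * -(22 / 5 * r) = -(11 / 5 * r) by ring]
        refine mul_le_mul_of_nonneg_right ?_ (by positivity)
        calc (16 : ℝ) ^ (22 / 5 * r) ≤ 16 ^ (1 : ℝ) :=
              Real.rpow_le_rpow_of_exponent_le (by norm_num) (by linarith)
          _ = 16 := Real.rpow_one _
      _ = C * (X / N) * (X : ℝ) ^ (-(11 / 5 * r)) := by field_simp
  · exact div_le_self hX0.le (by linarith)
  · exact sub_nonneg.2 (Real.rpow_le_rpow hn20.le hn21 (by linarith [h.one_le' j]))
  · have e1 : (X / (16 * N) : ℝ) ^ Θ =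
        (X / (16 * N) : ℝ) ^ θ j * (X / (16 * N) : ℝ) ^ (Θ - θ j) := by
      rw [← Real.rpow_add hM0]; ring_nf
    rw [e1, ← hsM]
    calc ((n₁ : ℝ) ^ θ j - (n₂ : ℝ) ^ θ j) * (X / (16 * N) : ℝ) ^ θ j *
          ((N : ℝ) ^ (Θ - θ j) * (X / (16 * N) : ℝ) ^ (Θ - θ j))
        = ((n₁ : ℝ) ^ θ j - (n₂ : ℝ) ^ θ j) * (N : ℝ) ^ (Θ - θ j) *
          ((X / (16 * N) : ℝ) ^ θ j * (X / (16 * N) : ℝ) ^ (Θ - θ j)) := by ring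
      _ ≤ _ := mul_le_mul_of_nonneg_right (hcomp _ (by linarith [h.one_le' j]) (hθΘ j))
          (by positivity)
  · have e1 := hcomp 1 zero_le_one (by linarith)
    rw [Real.rpow_one, Real.rpow_one] at e1
    have e2 : (N : ℝ) ^ Θ = N * (N : ℝ) ^ (Θ - 1) := by
      rw [Real.rpow_sub_one hN0.ne']; field_simp
    have e3 : (X : ℝ) ^ (Θ - 11 / 5 * r) / 16 ^ Θ =
        N * (X : ℝ) ^ (-(11 / 5 * r)) * (N : ℝ) ^ (Θ - 1) * (X / (16 * N) : ℝ) ^ Θ := by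
      rw [sub_eq_add_neg, Real.rpow_add hX0, mul_div_right_comm, ← Real.div_rpow hX0.le
        (by norm_num), ← hsM, e2]
      ring
    rw [e3]
    refine mul_le_mul_of_nonneg_right (le_trans ?_ e1) (by positivity)
    exact mul_le_mul_of_nonneg_right hdiff (by positivity)
  · calc ((n₁ : ℝ) ^ Θ - (n₂ : ℝ) ^ Θ) * (X / (16 * N) : ℝ) ^ Θ
        ≤ (n₁ : ℝ) ^ Θ * (X / (16 * N) : ℝ) ^ Θ := by
          refine mul_le_mul_of_nonneg_right ?_ (by positivity)
          linarith [Real.rpow_nonneg hn20.le Θ]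
      _ = (n₁ * (X / (16 * N)) : ℝ) ^ Θ := (Real.mul_rpow hn10.le hM0.le).symm
      _ ≤ (X : ℝ) ^ Θ := by
        refine Real.rpow_le_rpow (by positivity) ?_ (by linarith)
        calc (n₁ : ℝ) * (X / (16 * N)) ≤ 2 * N * (X / (16 * N)) :=
              mul_le_mul_of_nonneg_right hn1' hM0.le
          _ = X / 8 := by field_simp; norm_num
          _ ≤ X := by linarith
  · exact div_le_natCast_div_div (by omega) (by linarith) hN0
      ((mul_le_mul_of_nonneg_left hNX (by norm_num)).trans hX5) hA
  · have h1 : (B : ℝ) ≤ (X / n₁ : ℕ) := by exact_mod_cast hB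
    refine h1.trans (Nat.cast_div_le.trans ?_)
    rw [show (16 : ℝ) * (X / (16 * N)) = X / N by field_simp]
    exact div_le_div_of_nonneg_left hX0.le hN0 (by linarith)

end

section

/-- Partial summation: a monotone nonnegative weight costs a factor of twice its last value. -/
lemma norm_sum_mul_le_of_monotone (x : ℕ → ℂ) (g : ℕ → ℝ) (hg : MonotoneOn g (Set.Ici 1))
    (hg0 : ∀ n, 0 ≤ g n) {A B : ℕ} (hAB : A ≤ B) {D : ℝ}
    (hD : ∀ B', A ≤ B' → B' ≤ B → ‖∑ n ∈ Ioc A B', x n‖ ≤ D) :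
    ‖∑ n ∈ Ioc A B, (g n : ℂ) * x n‖ ≤ 2 * g B * D := by
  have hD0 : 0 ≤ D := (norm_nonneg _).trans (hD A le_rfl hAB)
  rcases Nat.eq_or_lt_of_le hAB with rfl | hlt
  · simpa using mul_nonneg (mul_nonneg zero_le_two (hg0 _)) hD0
  have key : ∀ B', A + 1 ≤ B' → B' ≤ B →
      ‖∑ n ∈ Ioc A B', (g n : ℂ) * x n - g B' * ∑ n ∈ Ioc A B', x n‖ ≤
        (g B' - g (A + 1)) * D := by
    intro B' h1
    induction B', h1 using Nat.le_induction with
    | base => intro _; simp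
    | succ n hn ih =>
      intro h2
      have ih := ih (by omega)
      have hmono : g n ≤ g (n + 1) :=
        hg (Set.mem_Ici.2 (by omega)) (Set.mem_Ici.2 (by omega)) (Nat.le_succ n)
      rw [sum_Ioc_succ_top (by omega), sum_Ioc_succ_top (by omega)]
      have : (∑ k ∈ Ioc A n, (g k : ℂ) * x k + g (n + 1) * x (n + 1) -
          g (n + 1) * (∑ k ∈ Ioc A n, x k + x (n + 1))) =
          (∑ k ∈ Ioc A n, (g k : ℂ) * x k - g n * ∑ k ∈ Ioc A n, x k) -
          ((g (n + 1) - g n : ℝ) : ℂ) * ∑ k ∈ Ioc A n, x k := by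
        push_cast
        ring
      rw [this]
      refine (norm_sub_le _ _).trans ?_
      rw [norm_mul, Complex.norm_real, Real.norm_of_nonneg (sub_nonneg.2 hmono)]
      have := mul_le_mul_of_nonneg_left (hD n (by omega) (by omega)) (sub_nonneg.2 hmono)
      linarith
  have h1 := key B hlt le_rfl
  have h2 : ‖(g B : ℂ) * ∑ n ∈ Ioc A B, x n‖ ≤ g B * D := by
    rw [norm_mul, Complex.norm_real, Real.norm_of_nonneg (hg0 B)]
    exact mul_le_mul_of_nonneg_left (hD B hAB le_rfl) (hg0 B)
  have h3 := norm_add_le (∑ n ∈ Ioc A B, (g n : ℂ) * x n - g B * ∑ n ∈ Ioc A B, x n)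
    ((g B : ℂ) * ∑ n ∈ Ioc A B, x n)
  rw [sub_add_cancel] at h3
  have h4 := mul_nonneg (hg0 (A + 1)) hD0
  linarith

lemma mem_Ioc_div_iff {Y X k l : ℕ} (hk : 0 < k) : l ∈ Ioc (Y / k) (X / k) ↔ k * l ∈ Ioc Y X := by
  rw [mem_Ioc, mem_Ioc, Nat.div_lt_iff_lt_mul hk, Nat.le_div_iff_mul_le hk, mul_comm]

/-- Summing over the fibres of `(k, l) ↦ k l`. -/
lemma sum_mul_antidiagonal (f g E : ℕ → ℂ) (Y X : ℕ) :
    ∑ n ∈ Ioc Y X, (∑ p ∈ n.divisorsAntidiagonal, f p.1 * g p.2) * E n =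
      ∑ k ∈ Ioc 0 X, f k * ∑ l ∈ Ioc (Y / k) (X / k), g l * E (k * l) := by
  have h1 : ∀ n ∈ Ioc Y X, (∑ p ∈ n.divisorsAntidiagonal, f p.1 * g p.2) * E n =
      ∑ p ∈ (Ioc 0 X ×ˢ Ioc 0 X) with p.1 * p.2 = n, f p.1 * (g p.2 * E (p.1 * p.2)) := by
    intro n hn
    rw [mem_Ioc] at hn
    rw [Nat.divisorsAntidiagonal_eq_prod_filter_of_le (by omega) hn.2, sum_mul]
    refine sum_congr rfl fun p hp => ?_
    rw [(mem_filter.1 hp).2]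
    ring
  rw [sum_congr rfl h1]
  have h3 : ∀ n ∈ Ioc Y X, (∑ p ∈ (Ioc 0 X ×ˢ Ioc 0 X) with p.1 * p.2 = n,
      f p.1 * (g p.2 * E (p.1 * p.2))) =
      ∑ p ∈ ((Ioc 0 X ×ˢ Ioc 0 X).filter fun p => p.1 * p.2 ∈ Ioc Y X) with p.1 * p.2 = n,
        f p.1 * (g p.2 * E (p.1 * p.2)) := by
    intro n hn
    rw [filter_filter]
    refine sum_congr ?_ fun _ _ => rfl
    ext p
    simp only [mem_filter]
    constructor
    · rintro ⟨a, b⟩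
      exact ⟨a, b ▸ hn, b⟩
    · rintro ⟨a, b, c⟩
      exact ⟨a, c⟩
  rw [sum_congr rfl h3, sum_fiberwise_of_maps_to (fun p hp => (mem_filter.1 hp).2), sum_filter,
    sum_product]
  refine sum_congr rfl fun k hk => ?_
  rw [← sum_filter, mul_sum]
  refine sum_congr ?_ fun _ _ => rfl
  ext l
  rw [mem_filter, mem_Ioc_div_iff (mem_Ioc.1 hk).1]
  constructor
  · exact fun h => h.2
  · intro h
    refine ⟨?_, h⟩
    have hk := (mem_Ioc.1 hk).1
    rw [mem_Ioc] at h ⊢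
    refine ⟨Nat.pos_of_ne_zero fun h0 => by simp [h0] at h, ?_⟩
    exact (Nat.le_mul_of_pos_left l hk).trans h.2

lemma sum_inv_Ioc_le (V : ℕ) : ∑ v ∈ Ioc 0 V, (1 / v : ℝ) ≤ 1 + Real.log V := by
  have := harmonic_le_one_add_log V
  rw [harmonic_eq_sum_Icc] at this
  push_cast at this
  simp only [one_div]
  exact this

/-- A type I sum. -/
lemma norm_typeI_sum_le (c : ℕ → ℂ) (g : ℕ → ℝ) (E : ℕ → ℂ) (hg : MonotoneOn g (Set.Ici 1))
    (hg0 : ∀ n, 0 ≤ g n) {X V : ℕ} {L G D : ℝ} (hX : 1 ≤ X) (hL : 0 ≤ L) (hD : 0 ≤ D)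
    (hc : ∀ v, 1 ≤ v → v ≤ X → ‖c v‖ ≤ L) (hcV : ∀ v, V < v → c v = 0)
    (hG : ∀ n, n ≤ X → g n ≤ G)
    (hE : ∀ v, 1 ≤ v → v ≤ V → ∀ A B, X / 4 / v ≤ A → B ≤ X / v →
      ‖∑ m ∈ Ioc A B, E (v * m)‖ ≤ D * (X / v)) :
    ‖∑ v ∈ Ioc 0 X, c v * ∑ l ∈ Ioc (X / 4 / v) (X / v), (g l : ℂ) * E (v * l)‖ ≤
      2 * L * G * D * X * (1 + Real.log X) := by
  have hG0 : 0 ≤ G := (hg0 0).trans (hG 0 (Nat.zero_le _))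
  have : ∀ v ∈ Ioc 0 X, ‖c v * ∑ l ∈ Ioc (X / 4 / v) (X / v), (g l : ℂ) * E (v * l)‖ ≤
      2 * L * G * D * X * (1 / v) := by
    intro v hv
    rw [mem_Ioc] at hv
    rcases lt_or_ge V v with h | h
    · rw [hcV v h, zero_mul, norm_zero]
      positivity
    rw [norm_mul]
    have h1 : X / 4 / v ≤ X / v := Nat.div_le_div_right (Nat.div_le_self _ _)
    have h2 := norm_sum_mul_le_of_monotone (fun l => E (v * l)) g hg hg0 h1
      (fun B' _ hB' => hE v hv.1 h _ B' le_rfl hB')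
    have h3 := hG (X / v) (Nat.div_le_self _ _)
    calc ‖c v‖ * _ ≤ L * (2 * G * (D * (X / v))) := by
          refine mul_le_mul (hc v hv.1 hv.2) (h2.trans ?_) (norm_nonneg _) hL
          exact mul_le_mul_of_nonneg_right (by linarith) (by positivity)
      _ = _ := by ring
  refine (norm_sum_le_of_le _ this).trans ?_
  rw [← mul_sum]
  exact mul_le_mul_of_nonneg_left (sum_inv_Ioc_le X) (by positivity)

/-- Second moment of the divisor function. -/
lemma sum_card_divisors_sq_le {N : ℕ} (hN : 1 ≤ N) :
    ∑ n ∈ Ioc 0 N, (#n.divisors : ℝ) ^ 2 ≤ N * (1 + Real.log N) ^ 3 := by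
  set H := 1 + Real.log N with hH
  have hH0 : 0 ≤ H := by
    have := Real.log_natCast_nonneg N
    linarith
  have hfib : ∀ (M : ℕ) (F : ℕ → ℝ), ∑ n ∈ Ioc 0 M, (#n.divisors : ℝ) * F n =
      ∑ d ∈ Ioc 0 M, ∑ m ∈ Ioc 0 (M / d), F (d * m) := by
    intro M F
    have := sum_mul_antidiagonal (fun _ => 1) (fun _ => 1) (fun n => (F n : ℂ)) 0 M
    simp only [mul_one, one_mul, sum_const, Nat.zero_div, nsmul_eq_mul, ← Complex.ofReal_natCast,
      ← Complex.ofReal_mul, ← Complex.ofReal_sum, Complex.ofReal_inj] at this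
    rw [← this]
    refine sum_congr rfl fun n _ => ?_
    rw [← Nat.map_div_right_divisors, card_map]
  have hlog : ∀ d, 1 ≤ d → d ≤ N → 1 + Real.log d ≤ H := fun d h1 h2 => by
    have := Real.log_le_log (by exact_mod_cast h1) (show (d : ℝ) ≤ N by exact_mod_cast h2)
    linarith
  have hsum : ∀ M ≤ N, ∑ m ∈ Ioc 0 M, (#m.divisors : ℝ) ≤ M * H := by
    intro M hM
    rcases Nat.eq_zero_or_pos M with rfl | hM0
    · simp
    have := hfib M fun _ => 1
    simp only [mul_one, sum_const, Nat.card_Ioc, tsub_zero, nsmul_eq_mul] at this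
    rw [this]
    calc ∑ d ∈ Ioc 0 M, ((M / d : ℕ) : ℝ) ≤ ∑ d ∈ Ioc 0 M, (M : ℝ) * (1 / d) :=
          sum_le_sum fun d _ => Nat.cast_div_le.trans (by rw [mul_one_div])
      _ = M * ∑ d ∈ Ioc 0 M, (1 / d : ℝ) := by rw [mul_sum]
      _ ≤ M * H := mul_le_mul_of_nonneg_left ((sum_inv_Ioc_le M).trans (hlog M hM0 hM))
          (Nat.cast_nonneg _)
  have hinv : ∑ n ∈ Ioc 0 N, (#n.divisors : ℝ) * (1 / n) ≤ H * H := by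
    rw [hfib]
    calc ∑ d ∈ Ioc 0 N, ∑ m ∈ Ioc 0 (N / d), (1 / ((d * m : ℕ) : ℝ))
        ≤ ∑ d ∈ Ioc 0 N, (1 / d : ℝ) * H := by
          refine sum_le_sum fun d hd => ?_
          rw [mem_Ioc] at hd
          simp only [Nat.cast_mul, ← one_div_mul_one_div]
          rw [← mul_sum]
          refine mul_le_mul_of_nonneg_left ?_ (by positivity)
          refine (sum_inv_Ioc_le _).trans ?_
          have h1 : 1 ≤ N / d := Nat.div_pos hd.2 hd.1
          exact hlog _ h1 (Nat.div_le_self _ _)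
      _ ≤ H * H := by
          rw [← sum_mul]
          exact mul_le_mul_of_nonneg_right (sum_inv_Ioc_le N) hH0
  calc ∑ n ∈ Ioc 0 N, (#n.divisors : ℝ) ^ 2 = ∑ n ∈ Ioc 0 N, (#n.divisors : ℝ) * #n.divisors :=
        sum_congr rfl fun n _ => sq _
    _ = ∑ d ∈ Ioc 0 N, ∑ m ∈ Ioc 0 (N / d), (#(d * m).divisors : ℝ) := hfib N _
    _ ≤ ∑ d ∈ Ioc 0 N, ∑ m ∈ Ioc 0 (N / d), (#d.divisors : ℝ) * #m.divisors := by
      refine sum_le_sum fun d _ => sum_le_sum fun m _ => ?_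
      rw [Nat.divisors_mul]
      exact_mod_cast card_mul_le
    _ ≤ ∑ d ∈ Ioc 0 N, (#d.divisors : ℝ) * (N / d * H) := by
      refine sum_le_sum fun d _ => ?_
      rw [← mul_sum]
      refine mul_le_mul_of_nonneg_left ((hsum _ (Nat.div_le_self _ _)).trans ?_)
        (Nat.cast_nonneg _)
      exact mul_le_mul_of_nonneg_right Nat.cast_div_le hH0
    _ = N * H * ∑ n ∈ Ioc 0 N, (#n.divisors : ℝ) * (1 / n) := by
      rw [mul_sum]
      exact sum_congr rfl fun d _ => by ring
    _ ≤ N * H * (H * H) := mul_le_mul_of_nonneg_left hinv (by positivity)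
    _ = N * H ^ 3 := by ring

end

section

/-- Schur's test for a symmetric nonnegative kernel. -/
lemma sum_mul_kernel_le {ι : Type*} (R : Finset ι) (x : ι → ℝ) (k : ι → ι → ℝ)
    (hk : ∀ i j, 0 ≤ k i j) (hs : ∀ i j, k i j = k j i) {T : ℝ}
    (hT : ∀ i ∈ R, ∑ j ∈ R, k i j ≤ T) :
    ∑ i ∈ R, ∑ j ∈ R, x i * x j * k i j ≤ T * ∑ i ∈ R, x i ^ 2 := by
  have h1 : ∑ i ∈ R, ∑ j ∈ R, x i ^ 2 * k i j ≤ T * ∑ i ∈ R, x i ^ 2 := by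
    rw [mul_sum]
    refine sum_le_sum fun i hi => ?_
    rw [← mul_sum, mul_comm]
    exact mul_le_mul_of_nonneg_right (hT i hi) (sq_nonneg _)
  have h2 : ∑ i ∈ R, ∑ j ∈ R, x j ^ 2 * k i j = ∑ i ∈ R, ∑ j ∈ R, x i ^ 2 * k i j := by
    rw [sum_comm]
    exact sum_congr rfl fun i _ => sum_congr rfl fun j _ => by rw [hs]
  have h3 : ∑ i ∈ R, ∑ j ∈ R, x i * x j * k i j ≤
      ∑ i ∈ R, ∑ j ∈ R, (1 / 2 * (x i ^ 2 * k i j) + 1 / 2 * (x j ^ 2 * k i j)) := by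
    refine sum_le_sum fun i _ => sum_le_sum fun j _ => ?_
    nlinarith [mul_nonneg (sq_nonneg (x i - x j)) (hk i j)]
  have h4 : ∑ i ∈ R, ∑ j ∈ R, (1 / 2 * (x i ^ 2 * k i j) + 1 / 2 * (x j ^ 2 * k i j)) =
      1 / 2 * ∑ i ∈ R, ∑ j ∈ R, x i ^ 2 * k i j + 1 / 2 * ∑ i ∈ R, ∑ j ∈ R, x j ^ 2 * k i j := by
    simp only [sum_add_distrib, mul_sum]
  linarith

lemma sum_norm_sq_le {ι κ : Type*} (R : Finset ι) (V : Finset κ) (z : ι → κ → ℂ) :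
    ∑ m ∈ V, ‖∑ n ∈ R, z n m‖ ^ 2 ≤
      ∑ i ∈ R, ∑ j ∈ R, ‖∑ m ∈ V, z i m * starRingEnd ℂ (z j m)‖ := by
  have h1 : ∀ m, ((‖∑ n ∈ R, z n m‖ ^ 2 : ℝ) : ℂ) =
      ∑ i ∈ R, ∑ j ∈ R, z i m * starRingEnd ℂ (z j m) := fun m => by
    rw [Complex.ofReal_pow, ← Complex.mul_conj', map_sum, sum_mul_sum]
  have h2 : ((∑ m ∈ V, ‖∑ n ∈ R, z n m‖ ^ 2 : ℝ) : ℂ) =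
      ∑ i ∈ R, ∑ j ∈ R, ∑ m ∈ V, z i m * starRingEnd ℂ (z j m) := by
    rw [Complex.ofReal_sum, sum_congr rfl fun m _ => h1 m, sum_comm]
    exact sum_congr rfl fun i _ => sum_comm
  have h3 := congrArg norm h2
  rw [Complex.norm_real, Real.norm_of_nonneg (by positivity)] at h3
  rw [h3]
  exact norm_sum_le_of_le _ fun i _ => norm_sum_le _ _

lemma card_filter_near_le (R : Finset ℕ) (n : ℕ) {t : ℝ} (ht : 1 ≤ t) :
    (#(R.filter fun j : ℕ => |(n : ℝ) - j| < t) : ℝ) ≤ 3 * t := by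
  have hsub : (R.filter fun j : ℕ => |(n : ℝ) - j| < t) ⊆ Icc (n - ⌊t⌋₊) (n + ⌊t⌋₊) := by
    intro j hj
    have h := abs_lt.1 (mem_filter.1 hj).2
    rw [mem_Icc]
    constructor
    · rcases le_or_gt n j with hl | hl
      · omega
      · have : n - j ≤ ⌊t⌋₊ := Nat.le_floor (by rw [Nat.cast_sub hl.le]; linarith)
        omega
    · rcases le_or_gt j n with hl | hl
      · omega
      · have : j - n ≤ ⌊t⌋₊ := Nat.le_floor (by rw [Nat.cast_sub hl.le]; linarith)
        omega
  have h1 := card_le_card hsub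
  rw [Nat.card_Icc] at h1
  have h2 : #(R.filter fun j : ℕ => |(n : ℝ) - j| < t) ≤ 2 * ⌊t⌋₊ + 1 := by omega
  have h3 := Nat.floor_le (show (0 : ℝ) ≤ t by linarith)
  have h4 : (#(R.filter fun j : ℕ => |(n : ℝ) - j| < t) : ℝ) ≤ 2 * ⌊t⌋₊ + 1 := by exact_mod_cast h2
  linarith

/-- A dyadic block of a type II sum. -/
lemma bilinear_block (a b E : ℕ → ℂ) (hE : ∀ n, ‖E n‖ ≤ 1) {X N : ℕ} (hN : 1 ≤ N) {δ C : ℝ}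
    (hδ : 0 < δ) (hC : 0 ≤ C) (hNδ : 1 ≤ N * δ)
    (hII : ∀ n₁ n₂ : ℕ, N < n₂ → n₁ ≤ 2 * N → N * δ ≤ (n₁ : ℝ) - n₂ →
      ‖∑ m ∈ Ioc (X / 4 / n₂) (X / n₁), E (n₁ * m) * starRingEnd ℂ (E (n₂ * m))‖ ≤
        C * (X / N) * δ) :
    ‖∑ n ∈ Ioc N (2 * N), a n * ∑ m ∈ Ioc (X / 4 / n) (X / n), b m * E (n * m)‖ ^ 2 ≤
      (C + 3) * X * δ * (∑ n ∈ Ioc N (2 * N), ‖a n‖ ^ 2) * ∑ m ∈ Ioc 0 (X / N), ‖b m‖ ^ 2 := by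
  set R := Ioc N (2 * N) with hR
  set V := Ioc 0 (X / N) with hV
  have hN0 : (0 : ℝ) < N := by exact_mod_cast hN
  let I : ℕ → Finset ℕ := fun n => Ioc (X / 4 / n) (X / n)
  have hI : ∀ n ∈ R, I n ⊆ V := fun n hn =>
    Ioc_subset_Ioc (Nat.zero_le _) (Nat.div_le_div_left (mem_Ioc.1 hn).1.le hN)
  let u : ℕ → ℕ → ℂ := fun n m => if m ∈ I n then E (n * m) else 0
  have hu1 : ∀ n m, ‖u n m‖ ≤ 1 := fun n m => by
    simp only [u]
    split_ifs
    · exact hE _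
    · simp
  let z : ℕ → ℕ → ℂ := fun n m => a n * u n m
  have hexp : ∑ n ∈ R, a n * ∑ m ∈ I n, b m * E (n * m) = ∑ m ∈ V, b m * ∑ n ∈ R, z n m := by
    simp only [mul_sum]
    rw [sum_comm (s := V)]
    refine sum_congr rfl fun n hn => ?_
    rw [← sum_subset (hI n hn)]
    · refine sum_congr rfl fun m hm => ?_
      simp only [z, u, if_pos hm]
      ring
    · intro m _ hm
      simp only [z, u, if_neg hm, mul_zero]
  let k : ℕ → ℕ → ℝ := fun i j => ‖∑ m ∈ V, u i m * starRingEnd ℂ (u j m)‖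
  have hks : ∀ i j, k i j = k j i := fun i j => by
    simp only [k]
    rw [← Complex.norm_conj, map_sum]
    congr 1
    refine sum_congr rfl fun m _ => ?_
    rw [map_mul, Complex.conj_conj, mul_comm]
  have hktriv : ∀ i j, k i j ≤ X / N := fun i j => by
    have h1 : k i j ≤ #V • (1 : ℝ) := by
      refine (norm_sum_le _ _).trans (sum_le_card_nsmul _ _ _ fun m _ => ?_)
      rw [norm_mul, Complex.norm_conj]
      exact mul_le_one₀ (hu1 _ _) (norm_nonneg _) (hu1 _ _)
    refine h1.trans ?_
    rw [hV, Nat.card_Ioc, tsub_zero, nsmul_eq_mul, mul_one]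
    exact Nat.cast_div_le
  have hfar : ∀ i ∈ R, ∀ j ∈ R, N * δ ≤ (i : ℝ) - j → k i j ≤ C * (X / N) * δ := by
    intro i hi j hj hij
    have hji : j ≤ i := by
      have : (j : ℝ) ≤ i := by linarith
      exact_mod_cast this
    have hj0 : 0 < j := by have := (mem_Ioc.1 hj).1; omega
    have hIij : I i ∩ I j = Ioc (X / 4 / j) (X / i) := by
      simp only [I]
      rw [Ioc_inter_Ioc, max_eq_right (Nat.div_le_div_left hji hj0),
        min_eq_left (Nat.div_le_div_left hji hj0)]
    have : ∑ m ∈ V, u i m * starRingEnd ℂ (u j m) =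
        ∑ m ∈ Ioc (X / 4 / j) (X / i), E (i * m) * starRingEnd ℂ (E (j * m)) := by
      rw [← hIij]
      rw [← sum_subset (inter_subset_left.trans (hI i hi))]
      · refine sum_congr rfl fun m hm => ?_
        rw [mem_inter] at hm
        simp only [u, if_pos hm.1, if_pos hm.2]
      · intro m _ hm
        rw [mem_inter, not_and_or] at hm
        rcases hm with h | h <;> simp [u, h]
    simp only [k, this]
    exact hII i j (mem_Ioc.1 hj).1 (mem_Ioc.1 hi).2 hij
  have hrow : ∀ i ∈ R, ∑ j ∈ R, k i j ≤ (C + 3) * X * δ := by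
    intro i hi
    have h1 : ∀ j ∈ R, k i j ≤ C * (X / N) * δ + if |(i : ℝ) - j| < N * δ then (X / N : ℝ) else 0 := by
      intro j hj
      split_ifs with h
      · have := hktriv i j
        have : 0 ≤ C * (X / N) * δ := by positivity
        linarith
      · rw [add_zero]
        rcases le_abs.1 (not_lt.1 h) with h | h
        · exact hfar i hi j hj h
        · rw [hks]
          exact hfar j hj i hi (by linarith)
    refine (sum_le_sum h1).trans ?_
    rw [sum_add_distrib, sum_const, ← sum_filter, sum_const, nsmul_eq_mul, nsmul_eq_mul]
    have h2 : (#R : ℝ) = N := by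
      rw [hR, Nat.card_Ioc]
      congr 1
      omega
    have h3 := mul_le_mul_of_nonneg_right (card_filter_near_le R i hNδ)
      (show (0 : ℝ) ≤ X / N by positivity)
    have h4 : 3 * (N * δ) * (X / N) = 3 * X * δ := by field_simp
    have h5 : (N : ℝ) * (C * (X / N) * δ) = C * X * δ := by field_simp
    rw [h2, h5]
    linarith
  have hcs : ‖∑ m ∈ V, b m * ∑ n ∈ R, z n m‖ ^ 2 ≤
      (∑ m ∈ V, ‖b m‖ ^ 2) * ∑ m ∈ V, ‖∑ n ∈ R, z n m‖ ^ 2 := by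
    have h1 : ‖∑ m ∈ V, b m * ∑ n ∈ R, z n m‖ ≤ ∑ m ∈ V, ‖b m‖ * ‖∑ n ∈ R, z n m‖ :=
      norm_sum_le_of_le _ fun m _ => (norm_mul _ _).le
    exact (pow_le_pow_left₀ (norm_nonneg _) h1 2).trans (sum_mul_sq_le_sq_mul_sq _ _ _)
  change ‖∑ n ∈ R, a n * ∑ m ∈ I n, b m * E (n * m)‖ ^ 2 ≤ _
  rw [hexp]
  refine hcs.trans ?_
  rw [mul_comm]
  refine mul_le_mul_of_nonneg_right ?_ (by positivity)
  refine (sum_norm_sq_le R V z).trans ?_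
  refine le_trans (le_of_eq ?_) (sum_mul_kernel_le R (fun n => ‖a n‖) k (fun i j => norm_nonneg _)
    hks hrow)
  refine sum_congr rfl fun i _ => sum_congr rfl fun j _ => ?_
  simp only [k, z]
  rw [← Complex.norm_conj (a j), ← norm_mul, ← norm_mul, mul_sum]
  congr 1
  refine sum_congr rfl fun m _ => ?_
  rw [map_mul]
  ring

end

section

lemma norm_sum_Ioc_two_pow_le (F : ℕ → ℂ) (U : ℕ) {D : ℝ}
    (hF : ∀ N, U ≤ N → ‖∑ n ∈ Ioc N (2 * N), F n‖ ≤ D) (L : ℕ) :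
    ‖∑ n ∈ Ioc U (2 ^ L * U), F n‖ ≤ L * D := by
  induction L with
  | zero => simp
  | succ L ih =>
    have h1 : U ≤ 2 ^ L * U := Nat.le_mul_of_pos_left U (by positivity)
    rw [pow_succ', mul_assoc, ← sum_Ioc_consecutive F h1 (by omega)]
    have h2 := hF _ h1
    have h3 := norm_add_le (∑ n ∈ Ioc U (2 ^ L * U), F n)
      (∑ n ∈ Ioc (2 ^ L * U) (2 * (2 ^ L * U)), F n)
    push_cast
    linarith

lemma natLog_two_add_one_le {X : ℕ} (hX : 1 ≤ X) :
    ((Nat.log 2 X + 1 : ℕ) : ℝ) ≤ 2 * (1 + Real.log X) := by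
  have h1 : (2 : ℝ) ^ Nat.log 2 X ≤ X := by exact_mod_cast Nat.pow_log_le_self 2 (by omega)
  have h2 := Real.log_le_log (by positivity) h1
  rw [Real.log_pow] at h2
  have h3 := Real.log_two_gt_d9
  push_cast
  nlinarith [(Nat.cast_nonneg (Nat.log 2 X) : (0 : ℝ) ≤ _)]

/-- A type II sum whose first variable is at most `√X`. -/
lemma norm_bilinear_sum_le (a b E : ℕ → ℂ) (hE : ∀ n, ‖E n‖ ≤ 1) {X U : ℕ} (hX : 1 ≤ X)
    (hU : 1 ≤ U) {δ C Q Q' : ℝ} (hδ : 0 < δ) (hC : 0 ≤ C) (hUδ : 1 ≤ U * δ)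
    (hQ : 0 ≤ Q) (ha0 : ∀ n ≤ U, a n = 0) (has : ∀ n, X.sqrt < n → a n = 0)
    (ha : ∀ N, 1 ≤ N → N ≤ X.sqrt → ∑ n ∈ Ioc N (2 * N), ‖a n‖ ^ 2 ≤ N * Q)
    (hb : ∀ N, 1 ≤ N → N ≤ X.sqrt → ∑ m ∈ Ioc 0 (X / N), ‖b m‖ ^ 2 ≤ X / N * Q')
    (hII : ∀ N n₁ n₂ : ℕ, 1 ≤ N → N ≤ X.sqrt → N < n₂ → n₁ ≤ 2 * N →
      N * δ ≤ (n₁ : ℝ) - n₂ →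
      ‖∑ m ∈ Ioc (X / 4 / n₂) (X / n₁), E (n₁ * m) * starRingEnd ℂ (E (n₂ * m))‖ ≤
        C * (X / N) * δ) :
    ‖∑ n ∈ Ioc 0 X, a n * ∑ m ∈ Ioc (X / 4 / n) (X / n), b m * E (n * m)‖ ≤
      2 * (1 + Real.log X) * (X * √((C + 3) * δ * Q * Q')) := by
  set F : ℕ → ℂ := fun n => a n * ∑ m ∈ Ioc (X / 4 / n) (X / n), b m * E (n * m) with hF
  set L := Nat.log 2 X + 1 with hL
  have hXL : X ≤ 2 ^ L * U :=
    (Nat.lt_pow_succ_log_self (by norm_num) X).le.trans (Nat.le_mul_of_pos_right _ hU)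
  have h1 : ∑ n ∈ Ioc 0 X, F n = ∑ n ∈ Ioc U (2 ^ L * U), F n := by
    have e1 : ∑ n ∈ Ioc 0 X, F n = ∑ n ∈ Ioc 0 (2 ^ L * U), F n := by
      refine sum_subset (Ioc_subset_Ioc le_rfl hXL) fun n hn hn' => ?_
      rw [mem_Ioc] at hn hn'
      have : X.sqrt < n := lt_of_le_of_lt (Nat.sqrt_le_self X) (by omega)
      simp only [hF, has n this, zero_mul]
    have e2 : ∑ n ∈ Ioc U (2 ^ L * U), F n = ∑ n ∈ Ioc 0 (2 ^ L * U), F n := by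
      refine sum_subset (Ioc_subset_Ioc (Nat.zero_le _) le_rfl) fun n hn hn' => ?_
      rw [mem_Ioc] at hn hn'
      simp only [hF, ha0 n (by omega), zero_mul]
    rw [e1, e2]
  rw [h1]
  refine (norm_sum_Ioc_two_pow_le F U (D := X * √((C + 3) * δ * Q * Q')) (fun N hN => ?_) L).trans
    (mul_le_mul_of_nonneg_right (natLog_two_add_one_le hX) (by positivity))
  rcases lt_or_ge X.sqrt N with hs | hs
  · rw [sum_eq_zero, norm_zero]
    · positivity
    · intro n hn
      simp only [hF, has n (hs.trans (mem_Ioc.1 hn).1), zero_mul]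
  have hN1 : 1 ≤ N := hU.trans hN
  have hN0 : (0 : ℝ) < N := by exact_mod_cast hN1
  have hNδ : 1 ≤ N * δ :=
    hUδ.trans (mul_le_mul_of_nonneg_right (by exact_mod_cast hN) hδ.le)
  have h2 := bilinear_block a b E hE hN1 hδ hC hNδ fun n₁ n₂ => hII N n₁ n₂ hN1 hs
  have h3 : ‖∑ n ∈ Ioc N (2 * N), F n‖ ^ 2 ≤ (X : ℝ) ^ 2 * ((C + 3) * δ * Q * Q') := by
    refine h2.trans ?_
    have h4 := mul_le_mul (ha N hN1 hs) (hb N hN1 hs) (by positivity) (by positivity)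
    calc (C + 3) * X * δ * (∑ n ∈ Ioc N (2 * N), ‖a n‖ ^ 2) * ∑ m ∈ Ioc 0 (X / N), ‖b m‖ ^ 2
        = (C + 3) * X * δ *
          ((∑ n ∈ Ioc N (2 * N), ‖a n‖ ^ 2) * ∑ m ∈ Ioc 0 (X / N), ‖b m‖ ^ 2) := by ring
      _ ≤ (C + 3) * X * δ * (N * Q * (X / N * Q')) := mul_le_mul_of_nonneg_left h4 (by positivity)
      _ = _ := by field_simp
  have h5 := Real.le_sqrt_of_sq_le h3
  rwa [Real.sqrt_mul (by positivity), Real.sqrt_sq (by positivity)] at h5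

open ArithmeticFunction in
/-- The restriction of an arithmetic function to `n ≤ U`. -/
def trunc (f : ArithmeticFunction ℝ) (U : ℕ) : ArithmeticFunction ℝ :=
  ⟨fun n => if n ≤ U then f n else 0, by simp⟩

open ArithmeticFunction in
lemma trunc_apply (f : ArithmeticFunction ℝ) (U n : ℕ) :
    trunc f U n = if n ≤ U then f n else 0 := rfl

open ArithmeticFunction in
/-- The real-valued Möbius function. -/
def moebiusR : ArithmeticFunction ℝ := ((moebius : ArithmeticFunction ℤ) : ArithmeticFunction ℝ)

open ArithmeticFunction in
/-- The real-valued constant function `1`. -/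
def zetaR : ArithmeticFunction ℝ := ((zeta : ArithmeticFunction ℕ) : ArithmeticFunction ℝ)

open ArithmeticFunction in
lemma abs_moebiusR_le (n : ℕ) : |moebiusR n| ≤ 1 := by
  have := abs_moebius_le_one (n := n)
  simp only [moebiusR, intCoe_apply]
  exact_mod_cast this

open ArithmeticFunction in
lemma zetaR_apply {n : ℕ} (hn : n ≠ 0) : zetaR n = 1 := by
  simp [zetaR, natCoe_apply, zeta_apply, hn]

open ArithmeticFunction in
/-- Vaughan's identity. -/
lemma vaughan_identity (U : ℕ) : (vonMangoldt : ArithmeticFunction ℝ) =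
    trunc vonMangoldt U + trunc moebiusR U * log - trunc vonMangoldt U * trunc moebiusR U * zetaR +
      (vonMangoldt - trunc vonMangoldt U) * ((moebiusR - trunc moebiusR U) * zetaR) := by
  have h1 : (vonMangoldt : ArithmeticFunction ℝ) * zetaR = log := vonMangoldt_mul_zeta
  have h2 : moebiusR * zetaR = 1 := coe_moebius_mul_coe_zeta
  rw [← h1]
  linear_combination (trunc vonMangoldt U - vonMangoldt) * h2

end

section

lemma arithmetic_sub_apply (f g : ArithmeticFunction ℝ) (n : ℕ) : (f - g) n = f n - g n := by
  rw [sub_eq_add_neg, ArithmeticFunction.add_apply, sub_eq_add_neg]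
  rfl

open ArithmeticFunction in
lemma sum_arithmeticMul (f g : ArithmeticFunction ℝ) (E : ℕ → ℂ) (Y X : ℕ) :
    ∑ n ∈ Ioc Y X, (((f * g) n : ℝ) : ℂ) * E n =
      ∑ k ∈ Ioc 0 X, (f k : ℂ) * ∑ l ∈ Ioc (Y / k) (X / k), (g l : ℂ) * E (k * l) := by
  rw [← sum_mul_antidiagonal]
  refine sum_congr rfl fun n _ => ?_
  rw [mul_apply]
  push_cast
  rfl

open ArithmeticFunction in
lemma abs_mul_le_sum_left {f g : ArithmeticFunction ℝ} (hg : ∀ n, |g n| ≤ 1) (n : ℕ) :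
    |(f * g) n| ≤ ∑ d ∈ n.divisors, |f d| := by
  rw [mul_apply, ← Nat.sum_divisorsAntidiagonal (fun d _ => |f d|)]
  refine abs_sum_le_sum_abs _ _ |>.trans (sum_le_sum fun p _ => ?_)
  rw [abs_mul]
  exact mul_le_of_le_one_right (abs_nonneg _) (hg _)

open ArithmeticFunction in
lemma abs_trunc_le (f : ArithmeticFunction ℝ) (U n : ℕ) : |trunc f U n| ≤ |f n| := by
  rw [trunc_apply]
  split_ifs <;> simp

open ArithmeticFunction in
lemma abs_sub_trunc_le (f : ArithmeticFunction ℝ) (U n : ℕ) : |(f - trunc f U) n| ≤ |f n| := by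
  rw [arithmetic_sub_apply, trunc_apply]
  split_ifs <;> simp

open ArithmeticFunction in
lemma sub_trunc_eq_zero (f : ArithmeticFunction ℝ) {U n : ℕ} (h : n ≤ U) :
    (f - trunc f U) n = 0 := by
  rw [arithmetic_sub_apply, trunc_apply, if_pos h, sub_self]

open ArithmeticFunction in
lemma abs_trunc_mul_trunc_le (U : ℕ) {v X : ℕ} (hv : 1 ≤ v) (hvX : v ≤ X) :
    |(trunc vonMangoldt U * trunc moebiusR U) v| ≤ Real.log X := by
  refine (abs_mul_le_sum_left (fun n => (abs_trunc_le _ U n).trans (abs_moebiusR_le n)) v).trans ?_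
  have h1 : ∑ d ∈ v.divisors, |trunc vonMangoldt U d| ≤ ∑ d ∈ v.divisors, vonMangoldt d :=
    sum_le_sum fun d _ => (abs_trunc_le _ U d).trans (abs_of_nonneg vonMangoldt_nonneg).le
  rw [vonMangoldt_sum] at h1
  exact h1.trans (Real.log_le_log (by exact_mod_cast hv) (by exact_mod_cast hvX))

open ArithmeticFunction in
lemma trunc_mul_trunc_eq_zero (f g : ArithmeticFunction ℝ) {U v : ℕ} (hv : U * U < v) :
    (trunc f U * trunc g U) v = 0 := by
  rw [mul_apply]
  refine sum_eq_zero fun p hp => ?_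
  rw [Nat.mem_divisorsAntidiagonal] at hp
  rw [trunc_apply, trunc_apply]
  rcases le_or_gt p.1 U with h1 | h1
  · rcases le_or_gt p.2 U with h2 | h2
    · have := Nat.mul_le_mul h1 h2
      omega
    · rw [if_neg (not_le.2 h2), mul_zero]
  · rw [if_neg (not_le.2 h1), zero_mul]

open ArithmeticFunction in
lemma abs_moebius_sub_trunc_mul_zeta_le (U n : ℕ) :
    |((moebiusR - trunc moebiusR U) * zetaR) n| ≤ #n.divisors := by
  have h1 : ∀ n, |zetaR n| ≤ 1 := fun n => by
    rcases eq_or_ne n 0 with rfl | h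
    · simp
    · simp [zetaR_apply h]
  refine (abs_mul_le_sum_left h1 n).trans ?_
  have h2 : ∑ d ∈ n.divisors, |(moebiusR - trunc moebiusR U) d| ≤ ∑ d ∈ n.divisors, (1 : ℝ) :=
    sum_le_sum fun d _ => (abs_sub_trunc_le _ U d).trans (abs_moebiusR_le d)
  simpa using h2

open ArithmeticFunction in
lemma sub_trunc_mul_eq_zero (f g : ArithmeticFunction ℝ) {U n : ℕ} (hn : n ≤ U) :
    ((f - trunc f U) * g) n = 0 := by
  rw [mul_apply]
  refine sum_eq_zero fun p hp => ?_
  rw [Nat.mem_divisorsAntidiagonal] at hp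
  rw [sub_trunc_eq_zero _ ((Nat.le_of_dvd (Nat.pos_of_ne_zero hp.2) ⟨_, hp.1.symm⟩).trans hn),
    zero_mul]

open ArithmeticFunction in
/-- The type II part of Vaughan's decomposition. -/
lemma norm_typeII_part_le (E : ℕ → ℂ) (hE : ∀ n, ‖E n‖ ≤ 1) {X U : ℕ} (hX : 4 ≤ X)
    (hU : 1 ≤ U) {δ C : ℝ} (hδ : 0 < δ) (hC : 0 ≤ C) (hUδ : 1 ≤ U * δ)
    (hII : ∀ N n₁ n₂ : ℕ, 1 ≤ N → N ≤ X.sqrt → N < n₂ → n₁ ≤ 2 * N →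
      N * δ ≤ (n₁ : ℝ) - n₂ →
      ‖∑ m ∈ Ioc (X / 4 / n₂) (X / n₁), E (n₁ * m) * starRingEnd ℂ (E (n₂ * m))‖ ≤
        C * (X / N) * δ) :
    ‖∑ n ∈ Ioc (X / 4) X, ((((vonMangoldt - trunc vonMangoldt U) *
      ((moebiusR - trunc moebiusR U) * zetaR)) n : ℝ) : ℂ) * E n‖ ≤
      4 * (1 + Real.log X) * (X * √((C + 3) * δ * 2 * (1 + Real.log X) ^ 5)) := by
  set A := (vonMangoldt - trunc vonMangoldt U : ArithmeticFunction ℝ) with hA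
  set h := ((moebiusR - trunc moebiusR U) * zetaR : ArithmeticFunction ℝ) with hh
  set H := 1 + Real.log X with hH
  set s := X.sqrt with hs
  have hlogX : 0 ≤ Real.log X := Real.log_natCast_nonneg X
  have hH1 : 1 ≤ H := by linarith
  have hs2 : s * s ≤ X := Nat.sqrt_le X
  have h2s : 2 ≤ s := Nat.le_sqrt.2 hX
  have hA0 : ∀ n ≤ U, A n = 0 := fun n hn => sub_trunc_eq_zero _ hn
  have hh0 : ∀ n ≤ U, h n = 0 := fun n hn => sub_trunc_mul_eq_zero _ _ hn
  have hAle : ∀ n, n ≤ X → |A n| ≤ H := fun n hn => by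
    rcases Nat.eq_zero_or_pos n with rfl | h0
    · rw [ArithmeticFunction.map_zero, abs_zero]
      linarith
    refine (abs_sub_trunc_le _ U n).trans ?_
    rw [abs_of_nonneg vonMangoldt_nonneg]
    have := Real.log_le_log (by exact_mod_cast h0) (show (n : ℝ) ≤ X by exact_mod_cast hn)
    linarith [vonMangoldt_le_log (n := n)]
  have hA2 : ∀ R : Finset ℕ, R ⊆ Ioc 0 X → ∀ a : ℕ → ℂ, (∀ n, ‖a n‖ ≤ |A n|) →
      ∑ n ∈ R, ‖a n‖ ^ 2 ≤ #R * H ^ 2 := fun R hR a ha => by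
    rw [← nsmul_eq_mul]
    refine sum_le_card_nsmul _ _ _ fun n hn => ?_
    exact pow_le_pow_left₀ (norm_nonneg _)
      ((ha n).trans (hAle n (mem_Ioc.1 (hR hn)).2)) 2
  have hh2 : ∀ M, 1 ≤ M → M ≤ X → ∀ a : ℕ → ℂ, (∀ n, ‖a n‖ ≤ |h n|) →
      ∑ n ∈ Ioc 0 M, ‖a n‖ ^ 2 ≤ M * H ^ 3 := fun M hM1 hM a ha => by
    have h1 : ∑ n ∈ Ioc 0 M, ‖a n‖ ^ 2 ≤ ∑ n ∈ Ioc 0 M, (#n.divisors : ℝ) ^ 2 :=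
      sum_le_sum fun n _ => pow_le_pow_left₀ (norm_nonneg _)
        ((ha n).trans (abs_moebius_sub_trunc_mul_zeta_le U n)) 2
    refine (h1.trans (sum_card_divisors_sq_le hM1)).trans ?_
    have h2 := Real.log_le_log (by exact_mod_cast hM1) (show (M : ℝ) ≤ X by exact_mod_cast hM)
    have h3 := Real.log_natCast_nonneg M
    exact mul_le_mul_of_nonneg_left (pow_le_pow_left₀ (by linarith) (by linarith) 3)
      (Nat.cast_nonneg _)
  let A₁ : ℕ → ℂ := fun n => if n ≤ s then (A n : ℂ) else 0
  let A₂ : ℕ → ℂ := fun n => if n ≤ s then 0 else (A n : ℂ)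
  let h₁ : ℕ → ℂ := fun n => if n ≤ s then (h n : ℂ) else 0
  have hnA₁ : ∀ n, ‖A₁ n‖ ≤ |A n| := fun n => by
    simp only [A₁]; split_ifs <;> simp
  have hnA₂ : ∀ n, ‖A₂ n‖ ≤ |A n| := fun n => by
    simp only [A₂]; split_ifs <;> simp
  have hnh₁ : ∀ n, ‖h₁ n‖ ≤ |h n| := fun n => by
    simp only [h₁]; split_ifs <;> simp
  have hnh : ∀ n, ‖(h n : ℂ)‖ ≤ |h n| := fun n => by simp
  have hXN : ∀ N, 1 ≤ N → N ≤ s → 1 ≤ X / N := fun N hN hNs =>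
    Nat.div_pos (hNs.trans (Nat.sqrt_le_self X)) hN
  have b1 := norm_bilinear_sum_le A₁ (fun n => (h n : ℂ)) E hE (X := X) (by omega) hU hδ hC hUδ
    (Q := H ^ 2) (Q' := H ^ 3) (by positivity) (fun n hn => by simp only [A₁]; rw [hA0 n hn, Complex.ofReal_zero, ite_self])
    (fun n hn => if_neg (not_le.2 hn))
    (fun N hN hNs => by
      refine (hA2 _ (Ioc_subset_Ioc (Nat.zero_le _) ?_) A₁ hnA₁).trans (le_of_eq ?_)
      · nlinarith
      · rw [Nat.card_Ioc]
        congr 2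
        omega)
    (fun N hN hNs => (hh2 _ (hXN N hN hNs) (Nat.div_le_self _ _) _ hnh).trans
      (mul_le_mul_of_nonneg_right Nat.cast_div_le (by positivity))) hII
  have b2 := norm_bilinear_sum_le h₁ A₂ E hE (X := X) (by omega) hU hδ hC hUδ
    (Q := 2 * H ^ 3) (Q' := H ^ 2) (by positivity) (fun n hn => by simp only [h₁]; rw [hh0 n hn, Complex.ofReal_zero, ite_self])
    (fun n hn => if_neg (not_le.2 hn))
    (fun N hN hNs => by
      have h1 := hh2 (2 * N) (by omega) (by nlinarith) h₁ hnh₁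
      have h2 : ∑ n ∈ Ioc N (2 * N), ‖h₁ n‖ ^ 2 ≤ ∑ n ∈ Ioc 0 (2 * N), ‖h₁ n‖ ^ 2 :=
        sum_le_sum_of_subset_of_nonneg (Ioc_subset_Ioc (Nat.zero_le _) le_rfl)
          fun _ _ _ => by positivity
      refine (h2.trans h1).trans (le_of_eq ?_)
      push_cast
      ring)
    (fun N hN hNs => by
      refine (hA2 _ (Ioc_subset_Ioc le_rfl (Nat.div_le_self _ _)) A₂ hnA₂).trans ?_
      rw [Nat.card_Ioc, tsub_zero]
      exact mul_le_mul_of_nonneg_right Nat.cast_div_le (by positivity)) hII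
  have hsplit : ∑ n ∈ Ioc (X / 4) X, (((A * h) n : ℝ) : ℂ) * E n =
      ∑ n ∈ Ioc 0 X, A₁ n * ∑ m ∈ Ioc (X / 4 / n) (X / n), (h m : ℂ) * E (n * m) +
      ∑ n ∈ Ioc 0 X, h₁ n * ∑ m ∈ Ioc (X / 4 / n) (X / n), A₂ m * E (n * m) := by
    have e1 : ∑ n ∈ Ioc 0 X, h₁ n * ∑ m ∈ Ioc (X / 4 / n) (X / n), A₂ m * E (n * m) =
        ∑ n ∈ Ioc 0 X, (h n : ℂ) * ∑ m ∈ Ioc (X / 4 / n) (X / n), A₂ m * E (n * m) := by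
      refine sum_congr rfl fun n hn => ?_
      simp only [h₁]
      split_ifs with hns
      · rfl
      · rw [zero_mul, sum_eq_zero, mul_zero]
        intro m hm
        have hm2 := (mem_Ioc.1 hm).2
        have hn0 := (mem_Ioc.1 hn).1
        have : m ≤ s := by
          rw [Nat.le_div_iff_mul_le hn0] at hm2
          by_contra hc
          have h3 : (s + 1) * (s + 1) ≤ m * n := Nat.mul_le_mul (by omega) (by omega)
          have h4 : X < (s + 1) * (s + 1) := Nat.lt_succ_sqrt X
          omega
        simp only [A₂, if_pos this, zero_mul]
    rw [e1, ← sum_mul_antidiagonal, ← sum_mul_antidiagonal, ← sum_add_distrib]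
    refine sum_congr rfl fun n _ => ?_
    rw [← add_mul]
    congr 1
    have e2 : ∑ p ∈ n.divisorsAntidiagonal, (h p.1 : ℂ) * A₂ p.2 =
        ∑ p ∈ n.divisorsAntidiagonal, (h p.2 : ℂ) * A₂ p.1 :=
      sum_nbij' Prod.swap Prod.swap (fun p hp => Nat.swap_mem_divisorsAntidiagonal.2 hp)
        (fun p hp => Nat.swap_mem_divisorsAntidiagonal.2 hp) (fun _ _ => rfl) (fun _ _ => rfl)
        fun _ _ => rfl
    rw [e2, ← sum_add_distrib, mul_apply]
    push_cast
    refine sum_congr rfl fun p _ => ?_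
    simp only [A₁, A₂]
    split_ifs <;> ring
  rw [hsplit]
  refine (norm_add_le _ _).trans ?_
  have s1 : √((C + 3) * δ * H ^ 2 * H ^ 3) ≤ √((C + 3) * δ * 2 * H ^ 5) := by
    refine Real.sqrt_le_sqrt ?_
    have : 0 ≤ (C + 3) * δ * H ^ 5 := by positivity
    linarith
  have s2 : √((C + 3) * δ * (2 * H ^ 3) * H ^ 2) = √((C + 3) * δ * 2 * H ^ 5) := by
    congr 1
    ring
  rw [s2] at b2
  have b3 := mul_le_mul_of_nonneg_left (mul_le_mul_of_nonneg_left s1 (Nat.cast_nonneg X))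
    (show 0 ≤ 2 * (1 + Real.log X) by positivity)
  linarith

open ArithmeticFunction in
/-- Vaughan's method for exponential sums weighted by the von Mangoldt function. -/
theorem norm_vonMangoldt_sum_le (E : ℕ → ℂ) (hE : ∀ n, ‖E n‖ ≤ 1) {X U : ℕ} (hX : 4 ≤ X)
    (hU : 1 ≤ U) (hUX : U ≤ X / 4) {δ C D : ℝ} (hδ : 0 < δ) (hC : 0 ≤ C) (hD : 0 ≤ D)
    (hUδ : 1 ≤ U * δ)
    (hI : ∀ v, 1 ≤ v → v ≤ U * U → ∀ A B, X / 4 / v ≤ A → B ≤ X / v →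
      ‖∑ m ∈ Ioc A B, E (v * m)‖ ≤ D * (X / v))
    (hII : ∀ N n₁ n₂ : ℕ, 1 ≤ N → N ≤ X.sqrt → N < n₂ → n₁ ≤ 2 * N →
      N * δ ≤ (n₁ : ℝ) - n₂ →
      ‖∑ m ∈ Ioc (X / 4 / n₂) (X / n₁), E (n₁ * m) * starRingEnd ℂ (E (n₂ * m))‖ ≤
        C * (X / N) * δ) :
    ‖∑ n ∈ Ioc (X / 4) X, ((vonMangoldt n : ℝ) : ℂ) * E n‖ ≤
      4 * (1 + Real.log X) ^ 2 * D * X +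
      4 * (1 + Real.log X) * (X * √((C + 3) * δ * 2 * (1 + Real.log X) ^ 5)) := by
  have hII' := norm_typeII_part_le E hE hX hU hδ hC hUδ hII
  have hlogX : 0 ≤ Real.log X := Real.log_natCast_nonneg X
  have hlogmono : MonotoneOn (fun n : ℕ => Real.log n) (Set.Ici 1) := fun a ha b _ hab =>
    Real.log_le_log (by exact_mod_cast Set.mem_Ici.1 ha) (by exact_mod_cast hab)
  have t1 := norm_typeI_sum_le (fun v => ((trunc moebiusR U v : ℝ) : ℂ)) (fun n => Real.log n) E
    hlogmono (fun n => Real.log_natCast_nonneg n) (X := X) (V := U * U) (L := 1)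
    (G := Real.log X) (D := D) (by omega) zero_le_one hD
    (fun v _ _ => by
      rw [Complex.norm_real, Real.norm_eq_abs]
      exact (abs_trunc_le _ U v).trans (abs_moebiusR_le v))
    (fun v hv => by
      have : ¬ v ≤ U := by nlinarith
      rw [trunc_apply, if_neg this, Complex.ofReal_zero])
    (fun n hn => by
      rcases Nat.eq_zero_or_pos n with rfl | h0
      · simpa using hlogX
      · exact Real.log_le_log (by exact_mod_cast h0) (by exact_mod_cast hn)) hI
  have t2 := norm_typeI_sum_le
    (fun v => (((trunc vonMangoldt U * trunc moebiusR U) v : ℝ) : ℂ)) (fun _ => 1) E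
    (fun _ _ _ _ _ => le_rfl) (fun n => zero_le_one) (X := X) (V := U * U) (L := Real.log X)
    (G := 1) (D := D) (by omega) hlogX hD
    (fun v h1 h2 => by
      rw [Complex.norm_real, Real.norm_eq_abs]
      exact abs_trunc_mul_trunc_le U h1 h2)
    (fun v hv => by rw [trunc_mul_trunc_eq_zero _ _ hv, Complex.ofReal_zero])
    (fun n _ => le_rfl) hI
  have hid : ∑ n ∈ Ioc (X / 4) X, ((vonMangoldt n : ℝ) : ℂ) * E n =
      ∑ v ∈ Ioc 0 X, ((trunc moebiusR U v : ℝ) : ℂ) *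
        ∑ l ∈ Ioc (X / 4 / v) (X / v), ((Real.log l : ℝ) : ℂ) * E (v * l) -
      ∑ v ∈ Ioc 0 X, (((trunc vonMangoldt U * trunc moebiusR U) v : ℝ) : ℂ) *
        ∑ l ∈ Ioc (X / 4 / v) (X / v), ((1 : ℝ) : ℂ) * E (v * l) +
      ∑ n ∈ Ioc (X / 4) X, ((((vonMangoldt - trunc vonMangoldt U) *
        ((moebiusR - trunc moebiusR U) * zetaR)) n : ℝ) : ℂ) * E n := by
    have e1 := sum_arithmeticMul (trunc moebiusR U) log E (X / 4) X
    have e2 := sum_arithmeticMul (trunc vonMangoldt U * trunc moebiusR U) zetaR E (X / 4) X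
    have e3 : ∑ v ∈ Ioc 0 X, (((trunc vonMangoldt U * trunc moebiusR U) v : ℝ) : ℂ) *
        ∑ l ∈ Ioc (X / 4 / v) (X / v), ((zetaR l : ℝ) : ℂ) * E (v * l) =
        ∑ v ∈ Ioc 0 X, (((trunc vonMangoldt U * trunc moebiusR U) v : ℝ) : ℂ) *
        ∑ l ∈ Ioc (X / 4 / v) (X / v), ((1 : ℝ) : ℂ) * E (v * l) :=
      sum_congr rfl fun v _ => congrArg _ (sum_congr rfl fun l hl => by
        rw [zetaR_apply (((Nat.zero_le _).trans_lt (mem_Ioc.1 hl).1).ne')])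
    rw [e3] at e2
    simp only [log_apply] at e1
    rw [← e1, ← e2, ← sum_sub_distrib, ← sum_add_distrib]
    refine sum_congr rfl fun n hn => ?_
    rw [← sub_mul, ← add_mul]
    congr 1
    have hn' : ¬ n ≤ U := by have := (mem_Ioc.1 hn).1; omega
    have := congrArg (fun f : ArithmeticFunction ℝ => f n) (vaughan_identity U)
    simp only [ArithmeticFunction.add_apply, arithmetic_sub_apply] at this
    rw [trunc_apply vonMangoldt, if_neg hn', zero_add] at this
    rw [this]
    push_cast
    rfl
  rw [hid]
  refine (norm_add_le _ _).trans (add_le_add ?_ hII')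
  refine (norm_sub_le _ _).trans ?_
  have : 0 ≤ D * X * (1 + Real.log X) := by positivity
  nlinarith

end

section

variable {d : ℕ} {α θ : Fin (d + 1) → ℝ}

lemma eventually_one_add_log_le {ε : ℝ} (hε : 0 < ε) :
    ∀ᶠ X : ℝ in atTop, 1 + Real.log X ≤ X ^ ε := by
  have h1 := (isLittleO_log_rpow_atTop hε).bound (c := 1 / 2) (by norm_num)
  filter_upwards [h1, (tendsto_rpow_atTop hε).eventually_ge_atTop 2, eventually_ge_atTop 1]
    with X hX h2 hX1
  have h0 := Real.log_nonneg hX1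
  rw [Real.norm_of_nonneg h0, Real.norm_of_nonneg (by positivity)] at hX
  linarith

lemma exp_sum_vonMangoldt (h : IsData α θ) {ε : ℝ} (hε : 0 < ε) : ∀ᶠ X : ℕ in atTop, ∀ β,
    FreqRange (θ (Fin.last d)) X β →
      ‖∑ n ∈ Ioc (X / 4) X, ((ArithmeticFunction.vonMangoldt n : ℝ) : ℂ) * e (β * ppol α θ n)‖ ≤
        (X : ℝ) ^ (1 - 11 / 10 * rho (θ (Fin.last d)) + ε) := by
  obtain ⟨C, hC, hI⟩ := exp_sum_typeI h
  obtain ⟨D, hD, hII⟩ := exp_sum_typeII h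
  set Θ := θ (Fin.last d) with hΘ
  have h3 : 3 < Θ := h.three_lt
  have hr0 := rho_pos Θ
  have hr1 := rho_le h3
  set r := rho Θ with hr
  have hcast := tendsto_natCast_atTop_atTop (R := ℝ)
  have hK0 : 0 ≤ √(2 * (D + 3)) := Real.sqrt_nonneg _
  set K := √(2 * (D + 3)) with hK
  filter_upwards [hI, hII, hcast.eventually (eventually_one_add_log_le (ε := ε / 8) (by positivity)),
    hcast.eventually (eventually_mul_rpow_le 4 (a := 1 / 10) (b := 1) (by norm_num)),
    hcast.eventually (eventually_mul_rpow_le 2 (a := 11 / 5 * r) (b := 1 / 10) (by linarith)),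
    hcast.eventually (eventually_mul_rpow_le (4 * (C + K)) (a := 1 - 11 / 10 * r + ε / 2)
      (b := 1 - 11 / 10 * r + ε) (by linarith)),
    eventually_ge_atTop 4] with X hI hII hlog hU4 hUδ hfin hX4 β hβ
  have hX4' : (4 : ℝ) ≤ X := by exact_mod_cast hX4
  have hX0 : (0 : ℝ) < X := by linarith
  have hX1 : (1 : ℝ) ≤ X := by linarith
  have hUge1 : (1 : ℝ) ≤ (X : ℝ) ^ (1 / 10 : ℝ) := Real.one_le_rpow hX1 (by norm_num)
  have hUle := Nat.floor_le (show (0 : ℝ) ≤ (X : ℝ) ^ (1 / 10 : ℝ) by positivity)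
  have hUlt := Nat.lt_floor_add_one ((X : ℝ) ^ (1 / 10 : ℝ))
  have hU1 : 1 ≤ ⌊(X : ℝ) ^ (1 / 10 : ℝ)⌋₊ := Nat.le_floor (by exact_mod_cast hUge1)
  set U := ⌊(X : ℝ) ^ (1 / 10 : ℝ)⌋₊ with hU
  have hU1' : (1 : ℝ) ≤ U := by exact_mod_cast hU1
  set Y := (X : ℝ) ^ (-(11 / 10 * r)) with hY
  have hY0 : 0 < Y := Real.rpow_pos_of_pos hX0 _
  have hY1 : Y ≤ 1 := Real.rpow_le_one_of_one_le_of_nonpos hX1 (by linarith)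
  have hY2 : (X : ℝ) ^ (-(11 / 5 * r)) = Y ^ 2 := by
    rw [hY, ← Real.rpow_natCast, ← Real.rpow_mul hX0.le]
    congr 1
    push_cast
    ring
  have hY3 : (X : ℝ) ^ (-(33 / 10 * r)) = Y ^ 3 := by
    rw [hY, ← Real.rpow_natCast, ← Real.rpow_mul hX0.le]
    congr 1
    push_cast
    ring
  rw [hY2] at hII
  rw [hY3] at hI
  have key := norm_vonMangoldt_sum_le (fun n => e (β * ppol α θ n)) (fun n => (norm_e _).le) hX4 hU1
    (U := U) (by
      rw [Nat.le_div_iff_mul_le (by norm_num)]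
      have : (U : ℝ) * 4 ≤ X := by
        rw [Real.rpow_one] at hU4
        linarith
      exact_mod_cast this)
    (δ := Y ^ 2) (C := D) (D := C * Y ^ 3) (by positivity) (by linarith) (by positivity)
    (by
      rw [← hY2, Real.rpow_neg hX0.le, ← div_eq_mul_inv, one_le_div (by positivity)]
      linarith)
    (fun v hv1 hv2 A B hA hB => by
      have hv : (v : ℝ) ≤ (X : ℝ) ^ (1 / 5 : ℝ) := by
        have : (v : ℝ) ≤ U * U := by exact_mod_cast hv2
        rw [show (1 / 5 : ℝ) = 1 / 10 + 1 / 10 by norm_num, Real.rpow_add hX0]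
        exact this.trans (mul_le_mul hUle hUle (by positivity) (by positivity))
      have := hI β hβ v hv1 hv A B hA hB
      push_cast
      linarith)
    (fun N n₁ n₂ hN hNX h2 h1 hd => by
      have hNX' : (N : ℝ) ≤ √X := Real.le_sqrt_of_sq_le (by
        have := Nat.le_sqrt.1 hNX
        rw [pow_two]
        exact_mod_cast this)
      have := hII β hβ N n₁ n₂ hN hNX' h2 h1 hd _ _ le_rfl le_rfl
      refine le_trans (le_of_eq ?_) this
      congr 1
      refine sum_congr rfl fun m _ => ?_
      rw [conj_e, ← e_add]
      push_cast
      congr 1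
      ring)
  refine key.trans ?_
  have hH1 : 1 ≤ 1 + Real.log X := by linarith [Real.log_nonneg hX1]
  set H := 1 + Real.log X with hH
  have hs : √((D + 3) * Y ^ 2 * 2 * H ^ 5) ≤ K * (Y * H ^ 3) := by
    rw [← Real.sqrt_sq (show 0 ≤ Y * H ^ 3 by positivity), hK, ← Real.sqrt_mul (by linarith)]
    refine Real.sqrt_le_sqrt ?_
    have : H ^ 5 ≤ H ^ 6 := pow_le_pow_right₀ hH1 (by norm_num)
    calc (D + 3) * Y ^ 2 * 2 * H ^ 5 ≤ (D + 3) * Y ^ 2 * 2 * H ^ 6 :=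
          mul_le_mul_of_nonneg_left this (by positivity)
      _ = _ := by ring
  calc 4 * H ^ 2 * (C * Y ^ 3) * X + 4 * H * (X * √((D + 3) * Y ^ 2 * 2 * H ^ 5))
      ≤ 4 * H ^ 4 * (C * Y) * X + 4 * H * (X * (K * (Y * H ^ 3))) := by
        refine add_le_add (mul_le_mul_of_nonneg_right ?_ hX0.le)
          (mul_le_mul_of_nonneg_left (mul_le_mul_of_nonneg_left hs hX0.le) (by positivity))
        have e1 : H ^ 2 ≤ H ^ 4 := pow_le_pow_right₀ hH1 (by norm_num)
        have e2 : Y ^ 3 ≤ Y := by simpa using pow_le_pow_of_le_one hY0.le hY1 (show 1 ≤ 3 by norm_num)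
        exact mul_le_mul (by linarith) (mul_le_mul_of_nonneg_left e2 (by linarith)) (by positivity)
          (by positivity)
    _ = 4 * (C + K) * (H ^ 4 * (X * Y)) := by ring
    _ ≤ 4 * (C + K) * ((X : ℝ) ^ (ε / 2) * (X * Y)) := by
        refine mul_le_mul_of_nonneg_left (mul_le_mul_of_nonneg_right ?_ (by positivity))
          (by positivity)
        calc H ^ 4 ≤ ((X : ℝ) ^ (ε / 8)) ^ 4 := pow_le_pow_left₀ (by linarith) hlog 4
          _ = _ := by
            rw [← Real.rpow_natCast, ← Real.rpow_mul hX0.le]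
            congr 1
            push_cast
            ring
    _ = 4 * (C + K) * (X : ℝ) ^ (1 - 11 / 10 * r + ε / 2) := by
        rw [show 1 - 11 / 10 * r + ε / 2 = ε / 2 + (1 + -(11 / 10 * r)) by ring,
          Real.rpow_add hX0 (ε / 2), Real.rpow_add hX0 1, Real.rpow_one]
    _ ≤ _ := hfin

/-- Exponential sums over primes. -/
theorem exp_sum_primes (h : IsData α θ) {ε : ℝ} (hε : 0 < ε) : ∀ᶠ X : ℕ in atTop, ∀ β,
    FreqRange (θ (Fin.last d)) X β →
      ‖∑ p ∈ Ioc (X / 4) X with p.Prime, (Real.log p : ℂ) * e (β * ppol α θ p)‖ ≤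
        (X : ℝ) ^ (1 - 11 / 10 * rho (θ (Fin.last d)) + ε) := by
  have h3 : 3 < θ (Fin.last d) := h.three_lt
  have hr0 := rho_pos (θ (Fin.last d))
  have hr1 := rho_le h3
  have hcast := tendsto_natCast_atTop_atTop (R := ℝ)
  filter_upwards [exp_sum_vonMangoldt h (half_pos hε),
    hcast.eventually (eventually_one_add_log_le (ε := 1 / 10) (by norm_num)),
    hcast.eventually (eventually_mul_rpow_le 2
      (a := 1 - 11 / 10 * rho (θ (Fin.last d)) + ε / 2)
      (b := 1 - 11 / 10 * rho (θ (Fin.last d)) + ε) (by linarith)),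
    hcast.eventually (eventually_mul_rpow_le 2
      (a := 3 / 5) (b := 1 - 11 / 10 * rho (θ (Fin.last d)) + ε / 2) (by linarith)),
    eventually_ge_atTop 4] with X hX hlog h2 h35 hX4 β hβ
  have hX1 : (1 : ℝ) ≤ X := by exact_mod_cast (show 1 ≤ X by omega)
  have hX0 : (0 : ℝ) < X := by linarith
  have h1 := hX β hβ
  set S := ∑ n ∈ Ioc (X / 4) X,
    ((ArithmeticFunction.vonMangoldt n : ℝ) : ℂ) * e (β * ppol α θ n) with hS
  have hsplit : ∑ p ∈ Ioc (X / 4) X with p.Prime, (Real.log p : ℂ) * e (β * ppol α θ p) =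
      S - ∑ n ∈ Ioc (X / 4) X with ¬ n.Prime,
        ((ArithmeticFunction.vonMangoldt n : ℝ) : ℂ) * e (β * ppol α θ n) := by
    rw [hS, ← sum_filter_add_sum_filter_not (Ioc (X / 4) X) Nat.Prime, add_sub_cancel_right]
    refine sum_congr rfl fun p hp => ?_
    rw [ArithmeticFunction.vonMangoldt_apply_prime (mem_filter.1 hp).2]
  have hrest : ‖∑ n ∈ Ioc (X / 4) X with ¬ n.Prime,
      ((ArithmeticFunction.vonMangoldt n : ℝ) : ℂ) * e (β * ppol α θ n)‖ ≤
      2 * √X * Real.log X := by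
    refine le_trans ?_ (Chebyshev.psi_sub_theta_le hX1)
    rw [Chebyshev.psi_sub_theta_eq_sum_not_prime]
    refine (norm_sum_le _ _).trans ?_
    simp only [norm_mul, norm_e, mul_one, Complex.norm_real, Real.norm_eq_abs,
      abs_of_nonneg ArithmeticFunction.vonMangoldt_nonneg, Nat.floor_natCast]
    exact sum_le_sum_of_subset_of_nonneg
      (filter_subset_filter _ (Ioc_subset_Ioc (Nat.zero_le _) le_rfl))
      fun _ _ _ => ArithmeticFunction.vonMangoldt_nonneg
  rw [hsplit]
  refine (norm_sub_le _ _).trans ?_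
  have h4 : 2 * √X * Real.log X ≤ 2 * (X : ℝ) ^ (3 / 5 : ℝ) := by
    rw [show (3 / 5 : ℝ) = 1 / 2 + 1 / 10 by norm_num, Real.rpow_add hX0, ← Real.sqrt_eq_rpow,
      mul_assoc]
    exact mul_le_mul_of_nonneg_left
      (mul_le_mul_of_nonneg_left (by linarith) (Real.sqrt_nonneg _)) (by norm_num)
  linarith

end

section

/-- The Fourier transform of `s (1 - s)` on the unit interval. -/
def bumpCoeff (β : ℝ) : ℂ := ∫ s in (0 : ℝ)..1, ((s * (1 - s) : ℝ) : ℂ) * e (-(β * s))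

lemma bumpCoeff_zero : bumpCoeff 0 = 1 / 6 := by
  have h : ∀ s : ℝ, HasDerivAt (fun s : ℝ => s ^ 2 / 2 - s ^ 3 / 3) (s * (1 - s)) s := fun s => by
    have := ((hasDerivAt_pow 2 s).div_const 2).sub ((hasDerivAt_pow 3 s).div_const 3)
    refine this.congr_deriv ?_
    push_cast
    ring
  have := intervalIntegral.integral_eq_sub_of_hasDerivAt (fun s _ => h s)
    (Continuous.intervalIntegrable (by fun_prop) (0 : ℝ) 1)
  unfold bumpCoeff
  simp only [zero_mul, neg_zero, e_zero, mul_one]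
  rw [intervalIntegral.integral_ofReal, this]
  norm_num

lemma continuous_e : Continuous e := by
  unfold e
  fun_prop

lemma norm_bumpCoeff_le_one (β : ℝ) : ‖bumpCoeff β‖ ≤ 1 := by
  have := intervalIntegral.norm_integral_le_of_norm_le_const (a := 0) (b := 1) (C := 1)
    (f := fun s : ℝ => ((s * (1 - s) : ℝ) : ℂ) * e (-(β * s))) (fun s hs => by
      rw [Set.uIoc_of_le zero_le_one] at hs
      rw [norm_mul, norm_e, mul_one, Complex.norm_real, Real.norm_eq_abs, abs_le]
      constructor <;> nlinarith [hs.1, hs.2])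
  rwa [sub_zero, abs_one, mul_one] at this

lemma norm_bumpCoeff_le {β : ℝ} (hβ : 1 / 2 ≤ |β|) : ‖bumpCoeff β‖ ≤ 1 / β ^ 2 := by
  have hb0 : β ≠ 0 := by
    rintro rfl
    norm_num at hβ
  set w : ℂ := -(2 * Real.pi * Complex.I * β) with hw
  have hw0 : w ≠ 0 := by
    simp [hw, hb0, Real.pi_ne_zero]
  have hnw : ‖w‖ = 2 * Real.pi * |β| := by
    simp [hw, abs_of_pos Real.pi_pos]
  have he : ∀ s : ℝ, e (-(β * s)) = Complex.exp (w * s) := fun s => by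
    unfold e
    congr 1
    rw [hw]
    push_cast
    ring
  have hder : ∀ s : ℝ, HasDerivAt (fun s : ℝ => Complex.exp (w * s) *
      ((s * (1 - s)) / w - (1 - 2 * s) / w ^ 2 - 2 / w ^ 3))
      (((s * (1 - s) : ℝ) : ℂ) * e (-(β * s))) s := fun s => by
    have hs : HasDerivAt (fun s : ℝ => (s : ℂ)) 1 s := Complex.ofRealCLM.hasDerivAt
    have h1 := (hs.const_mul w).cexp
    have h2 : HasDerivAt (fun s : ℝ => ((s : ℂ) * (1 - s)) / w - (1 - 2 * s) / w ^ 2 - 2 / w ^ 3)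
        ((1 - 2 * s) / w + 2 / w ^ 2) s := by
      have a1 := (hs.mul (hs.const_sub 1)).div_const w
      have a2 := ((hs.const_mul 2).const_sub 1).div_const (w ^ 2)
      refine ((a1.sub a2).sub_const (2 / w ^ 3)).congr_deriv ?_
      ring
    refine (h1.mul h2).congr_deriv ?_
    rw [he]
    push_cast
    field_simp
    ring
  have hcont : Continuous fun s : ℝ => ((s * (1 - s) : ℝ) : ℂ) * e (-(β * s)) := by
    have := continuous_e
    fun_prop
  have hI := intervalIntegral.integral_eq_sub_of_hasDerivAt (fun s _ => hder s)
    (hcont.intervalIntegrable 0 1)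
  have hI' : bumpCoeff β = Complex.exp w * (1 / w ^ 2 - 2 / w ^ 3) + (1 / w ^ 2 + 2 / w ^ 3) := by
    unfold bumpCoeff
    rw [hI]
    simp only [Complex.ofReal_one, Complex.ofReal_zero, mul_one, mul_zero, Complex.exp_zero]
    ring
  have hexp : ‖Complex.exp w‖ = 1 := by
    have := norm_e (-(β * 1))
    rwa [he, Complex.ofReal_one, mul_one] at this
  have hw3 : 3 ≤ ‖w‖ := by
    rw [hnw]
    nlinarith [Real.pi_gt_three]
  have hwp : 0 < ‖w‖ := by linarith
  have hb : ∀ z : ℂ, ‖z‖ ≤ 1 / ‖w‖ ^ 2 + 2 / ‖w‖ ^ 3 → ‖z‖ ≤ 2 / ‖w‖ ^ 2 := fun z hz => by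
    refine hz.trans ?_
    have : 2 / ‖w‖ ^ 3 ≤ 1 / ‖w‖ ^ 2 := by
      rw [div_le_div_iff₀ (by positivity) (by positivity)]
      nlinarith [pow_pos hwp 2]
    calc 1 / ‖w‖ ^ 2 + 2 / ‖w‖ ^ 3 ≤ 1 / ‖w‖ ^ 2 + 1 / ‖w‖ ^ 2 := by linarith
      _ = _ := by ring
  have h1 : ‖(1 / w ^ 2 - 2 / w ^ 3 : ℂ)‖ ≤ 2 / ‖w‖ ^ 2 := hb _ (by
    refine (norm_sub_le _ _).trans (le_of_eq ?_)
    simp)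
  have h2 : ‖(1 / w ^ 2 + 2 / w ^ 3 : ℂ)‖ ≤ 2 / ‖w‖ ^ 2 := hb _ (by
    refine (norm_add_le _ _).trans (le_of_eq ?_)
    simp)
  rw [hI']
  refine (norm_add_le _ _).trans ?_
  rw [norm_mul, hexp, one_mul]
  calc _ ≤ 2 / ‖w‖ ^ 2 + 2 / ‖w‖ ^ 2 := add_le_add h1 h2
    _ = 4 / ‖w‖ ^ 2 := by ring
    _ ≤ 1 / β ^ 2 := by
      rw [hnw, div_le_div_iff₀ (by positivity) (by positivity), mul_pow, sq_abs]
      have : 4 ≤ (2 * Real.pi) ^ 2 := by nlinarith [Real.pi_gt_three]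
      nlinarith [sq_nonneg β]

lemma norm_bumpCoeff_add_le {η : ℝ} (hη : |η| ≤ 1 / 2) {k : ℤ} (hk : k ≠ 0) :
    ‖bumpCoeff (η + k)‖ ≤ 4 / (k : ℝ) ^ 2 := by
  have hk1 : (1 : ℝ) ≤ |(k : ℝ)| := by exact_mod_cast Int.one_le_abs hk
  have h1 : |(k : ℝ)| - |η| ≤ |η + k| := by
    have := abs_sub_abs_le_abs_sub (k : ℝ) (-η)
    rw [abs_neg, sub_neg_eq_add, add_comm (k : ℝ)] at this
    exact this
  refine (norm_bumpCoeff_le (by linarith)).trans ?_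
  rw [div_le_div_iff₀ (by rw [← sq_abs]; exact pow_pos (by linarith) 2)
    (by rw [← sq_abs]; positivity), ← sq_abs (k : ℝ), ← sq_abs (η + k)]
  have h2 : |(k : ℝ)| ≤ 2 * |η + k| := by linarith
  have := pow_le_pow_left₀ (abs_nonneg _) h2 2
  linarith

lemma sum_inv_sq_int_le {K : ℕ} (hK : K ≠ 0) (F : Finset ℤ) (hF : ∀ k ∈ F, K < k.natAbs) :
    ∑ k ∈ F, 4 / (k : ℝ) ^ 2 ≤ 8 / (K : ℝ) := by
  set N := max K (F.sup Int.natAbs) with hN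
  have hmaps : ∀ k ∈ F, k.natAbs ∈ Ioc K N := fun k hk =>
    mem_Ioc.2 ⟨hF k hk, (le_sup (f := Int.natAbs) hk).trans (le_max_right _ _)⟩
  rw [← sum_fiberwise_of_maps_to hmaps]
  have h1 : ∀ n ∈ Ioc K N, ∑ k ∈ F with k.natAbs = n, 4 / (k : ℝ) ^ 2 ≤
      8 * ((n : ℝ) ^ 2)⁻¹ := fun n _ => by
    have hsub : {k ∈ F | k.natAbs = n} ⊆ {(n : ℤ), -(n : ℤ)} := fun k hk => by
      have := (mem_filter.1 hk).2
      simp only [mem_insert, mem_singleton]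
      omega
    have hcard : #{k ∈ F | k.natAbs = n} ≤ 2 := (card_le_card hsub).trans card_le_two
    have hc : ∑ k ∈ F with k.natAbs = n, 4 / (k : ℝ) ^ 2 =
        ∑ k ∈ F with k.natAbs = n, 4 / (n : ℝ) ^ 2 := sum_congr rfl fun k hk => by
      have : |(k : ℝ)| = n := by
        rw [← (mem_filter.1 hk).2, Nat.cast_natAbs, Int.cast_abs]
      rw [← sq_abs (k : ℝ), this]
    rw [hc, sum_const, nsmul_eq_mul]
    have : ((#{k ∈ F | k.natAbs = n} : ℕ) : ℝ) ≤ 2 := by exact_mod_cast hcard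
    calc _ ≤ 2 * (4 / (n : ℝ) ^ 2) := mul_le_mul_of_nonneg_right this (by positivity)
      _ = _ := by ring
  refine (sum_le_sum h1).trans ?_
  rw [← mul_sum]
  have h2 := sum_Ioc_inv_sq_le_sub (α := ℝ) hK (le_max_left K (F.sup Int.natAbs))
  rw [← hN] at h2
  have h3 : (0 : ℝ) ≤ (N : ℝ)⁻¹ := by positivity
  calc 8 * ∑ n ∈ Ioc K N, ((n : ℝ) ^ 2)⁻¹ ≤ 8 * (K : ℝ)⁻¹ := by linarith
    _ = _ := by ring

lemma sum_norm_bumpCoeff_le {η : ℝ} (hη : |η| ≤ 1 / 2) (F : Finset ℤ) :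
    ∑ k ∈ F, ‖bumpCoeff (η + k)‖ ≤ 11 := by
  rw [← sum_filter_add_sum_filter_not F (fun k => 1 < k.natAbs)]
  have h1 : ∑ k ∈ F with 1 < k.natAbs, ‖bumpCoeff (η + k)‖ ≤ 8 := by
    refine (sum_le_sum fun k hk => norm_bumpCoeff_add_le hη ?_).trans
      ((sum_inv_sq_int_le one_ne_zero {k ∈ F | 1 < k.natAbs} fun k hk =>
        (mem_filter.1 hk).2).trans (show (8 : ℝ) / (1 : ℕ) ≤ 8 by norm_num))
    have := (mem_filter.1 hk).2
    omega
  have h2 : ∑ k ∈ F with ¬ 1 < k.natAbs, ‖bumpCoeff (η + k)‖ ≤ 3 := by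
    have hsub : {k ∈ F | ¬ 1 < k.natAbs} ⊆ Icc (-1) 1 := fun k hk => by
      have := (mem_filter.1 hk).2
      rw [mem_Icc]
      omega
    have hc : (#{k ∈ F | ¬ 1 < k.natAbs} : ℝ) ≤ 3 := by
      have := card_le_card hsub
      rw [Int.card_Icc] at this
      exact_mod_cast this
    refine (sum_le_card_nsmul _ _ 1 fun k _ => norm_bumpCoeff_le_one _).trans ?_
    rwa [nsmul_eq_mul, mul_one]
  linarith

/-- Fourier expansion of `s (1 - s) e (-η s)` in the fractional part of `u`. -/
lemma hasSum_bumpCoeff {η : ℝ} (hη : |η| ≤ 1 / 2) (u : ℝ) :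
    HasSum (fun k : ℤ => bumpCoeff (η + k) * e ((η + k) * u))
      (((Int.fract u * (1 - Int.fract u) : ℝ) : ℂ) * e (η * ⌊u⌋)) := by
  let φ : ℝ → ℂ := fun s => ((s * (1 - s) : ℝ) : ℂ) * e (-(η * s))
  have hφc : Continuous φ := by
    have := continuous_e
    simp only [φ]
    fun_prop
  have hφ01 : φ 0 = φ (0 + 1) := by simp [φ]
  have : Fact ((0 : ℝ) < 1) := ⟨one_pos⟩
  let f : C(AddCircle (1 : ℝ), ℂ) :=
    ⟨AddCircle.liftIco 1 0 φ, AddCircle.liftIco_continuous hφ01 hφc.continuousOn⟩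
  have hcoeff : ∀ k : ℤ, fourierCoeff f k = bumpCoeff (η + k) := fun k => by
    change fourierCoeff (AddCircle.liftIco 1 0 φ) k = _
    rw [fourierCoeff_liftIco_eq, fourierCoeffOn_eq_integral]
    unfold bumpCoeff
    simp only [zero_add, sub_zero, one_div, inv_one, one_smul]
    refine intervalIntegral.integral_congr fun s _ => ?_
    simp only [fourier_coe_apply, smul_eq_mul, φ]
    rw [mul_left_comm]
    congr 1
    rw [show -((η + k) * s) = -(k * s) + -(η * s) by ring, e_add]
    congr 1
    unfold e
    congr 1
    push_cast
    ring
  have hsum : Summable (fourierCoeff f) := by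
    refine summable_of_sum_le (c := 11) (f := fun k => ‖fourierCoeff f k‖)
      (fun _ => norm_nonneg _) (fun F => ?_) |>.of_norm
    simp only [hcoeff]
    exact sum_norm_bumpCoeff_le hη F
  have h := has_pointwise_sum_fourier_series_of_summable hsum ((Int.fract u : ℝ) : AddCircle (1 : ℝ))
  have hval : f ((Int.fract u : ℝ) : AddCircle (1 : ℝ)) = φ (Int.fract u) := by
    change AddCircle.liftIco 1 0 φ _ = _
    exact AddCircle.liftIco_coe_apply ⟨Int.fract_nonneg u, by
      rw [zero_add]
      exact Int.fract_lt_one u⟩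
  rw [hval] at h
  have h2 := h.mul_right (e (η * u))
  have e1 : (fun k : ℤ => bumpCoeff (η + k) * e ((η + k) * u)) = fun k : ℤ =>
      fourierCoeff f k • fourier k ((Int.fract u : ℝ) : AddCircle (1 : ℝ)) * e (η * u) := by
    funext k
    rw [hcoeff, fourier_coe_apply, smul_eq_mul, mul_assoc]
    congr 1
    rw [add_mul, add_comm, e_add]
    congr 1
    have hu : (k : ℝ) * u = k * Int.fract u + ((k * ⌊u⌋ : ℤ) : ℝ) := by
      push_cast
      rw [← mul_add, Int.fract_add_floor]
    rw [hu, e_add_int]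
    unfold e
    congr 1
    push_cast
    ring
  have e2 : ((Int.fract u * (1 - Int.fract u) : ℝ) : ℂ) * e (η * ⌊u⌋) =
      φ (Int.fract u) * e (η * u) := by
    simp only [φ]
    rw [mul_assoc, ← e_add]
    congr 2
    have := Int.fract_add_floor u
    linear_combination η * this
  rw [e1, e2]
  exact h2

lemma norm_bump_sub_sum_le {η : ℝ} (hη : |η| ≤ 1 / 2) (u : ℝ) {K : ℕ} (hK : K ≠ 0) :
    ‖((Int.fract u * (1 - Int.fract u) : ℝ) : ℂ) * e (η * ⌊u⌋) -
      ∑ k ∈ Icc (-(K : ℤ)) K, bumpCoeff (η + k) * e ((η + k) * u)‖ ≤ 8 / K := by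
  set s := Icc (-(K : ℤ)) K with hs
  have h := (hasSum_bumpCoeff hη u).sub_const
    (∑ k ∈ s, bumpCoeff (η + k) * e ((η + k) * u)) |>.norm
  refine le_of_tendsto h ?_
  filter_upwards [eventually_ge_atTop s] with F hF
  rw [← sum_sdiff hF, add_sub_cancel_right]
  refine (norm_sum_le _ _).trans ?_
  have hmem : ∀ k ∈ F \ s, K < k.natAbs := fun k hk => by
    have := (mem_sdiff.1 hk).2
    rw [hs, mem_Icc] at this
    omega
  refine le_trans (sum_le_sum fun k hk => ?_) (sum_inv_sq_int_le hK _ hmem)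
  rw [norm_mul, norm_e, mul_one]
  refine norm_bumpCoeff_add_le hη ?_
  have := hmem k hk
  omega

end

section

variable {d : ℕ} {α θ : Fin (d + 1) → ℝ}

/-- Primes `p` are weighted by `log p`, damped when `ppol α θ p` is near an integer. -/
def wt (α θ : Fin (d + 1) → ℝ) (p : ℕ) : ℝ :=
  Real.log p * (Int.fract (ppol α θ p) * (1 - Int.fract (ppol α θ p)))

/-- The primes in `(X / 4, X]`. -/
def primesIoc (X : ℕ) : Finset ℕ := {p ∈ Ioc (X / 4) X | p.Prime}

lemma wt_nonneg (α θ : Fin (d + 1) → ℝ) (p : ℕ) : 0 ≤ wt α θ p :=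
  mul_nonneg (Real.log_natCast_nonneg p) (mul_nonneg (Int.fract_nonneg _)
    (sub_nonneg.2 (Int.fract_lt_one _).le))

lemma sum_log_primesIoc_le (X : ℕ) : ∑ p ∈ primesIoc X, Real.log p ≤ 2 * X := by
  have h1 : ∑ p ∈ primesIoc X, Real.log p ≤ Chebyshev.theta X := by
    unfold Chebyshev.theta primesIoc
    rw [Nat.floor_natCast]
    exact sum_le_sum_of_subset_of_nonneg
      (filter_subset_filter _ (Ioc_subset_Ioc (Nat.zero_le _) le_rfl))
      fun p _ _ => Real.log_natCast_nonneg p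
  have h2 := Chebyshev.theta_le_log4_mul_x (Nat.cast_nonneg (α := ℝ) X)
  have h3 : Real.log 4 ≤ 2 := by
    rw [show (4 : ℝ) = 2 ^ 2 by norm_num, Real.log_pow]
    push_cast
    linarith [Real.log_two_lt_d9]
  have := mul_le_mul_of_nonneg_right h3 (Nat.cast_nonneg (α := ℝ) X)
  linarith

lemma eventually_le_sum_log_primesIoc :
    ∀ᶠ X : ℕ in atTop, (X : ℝ) / 4 ≤ ∑ p ∈ primesIoc X, Real.log p := by
  have hcast := tendsto_natCast_atTop_atTop (R := ℝ)
  filter_upwards [hcast.eventually (eventually_one_add_log_le (ε := 1 / 10) (by norm_num)),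
    hcast.eventually (eventually_mul_rpow_le 40 (a := 3 / 5) (b := 1) (by norm_num)),
    eventually_ge_atTop 1] with X hlog hX hX1
  have hX1' : (1 : ℝ) ≤ X := by exact_mod_cast hX1
  have hX0 : (0 : ℝ) < X := by linarith
  have h1 : ∑ p ∈ primesIoc X, Real.log p = Chebyshev.theta X - Chebyshev.theta (X / 4 : ℕ) := by
    unfold Chebyshev.theta primesIoc
    rw [Nat.floor_natCast, Nat.floor_natCast, eq_sub_iff_add_eq, add_comm,
      ← sum_union (disjoint_filter_filter (Ioc_disjoint_Ioc_of_le le_rfl)), ← filter_union,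
      Ioc_union_Ioc_eq_Ioc (Nat.zero_le _) (Nat.div_le_self X 4)]
  have h2 := Chebyshev.theta_ge X
  have h3 := Chebyshev.theta_le_log4_mul_x (Nat.cast_nonneg (α := ℝ) (X / 4))
  have h4 : Real.log 4 = 2 * Real.log 2 := by
    rw [show (4 : ℝ) = 2 ^ 2 by norm_num, Real.log_pow]
    push_cast
    ring
  have hl1 := Real.log_two_gt_d9
  have hl2 := Real.log_two_lt_d9
  have h5 : Real.log 4 * (X / 4 : ℕ) ≤ Real.log 4 * (X / 4) := by
    refine mul_le_mul_of_nonneg_left ?_ (by linarith)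
    exact_mod_cast Nat.cast_div_le (α := ℝ) (m := X) (n := 4)
  have hL := Real.log_nonneg hX1'
  have h6 : Real.log (X + 1) ≤ 1 + Real.log X := by
    have : Real.log (X + 1) ≤ Real.log (2 * X) := Real.log_le_log (by linarith) (by linarith)
    rw [Real.log_mul (by norm_num) hX0.ne'] at this
    linarith
  have h7 : √X * (1 + Real.log X) ≤ (X : ℝ) ^ (3 / 5 : ℝ) := by
    rw [show (3 / 5 : ℝ) = 1 / 2 + 1 / 10 by norm_num, Real.rpow_add hX0, ← Real.sqrt_eq_rpow]
    exact mul_le_mul_of_nonneg_left hlog (Real.sqrt_nonneg _)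
  have hs : 1 ≤ √X := Real.one_le_sqrt.2 hX1'
  have h8 : 1 + Real.log X ≤ √X * (1 + Real.log X) := le_mul_of_one_le_left (by linarith) hs
  have h9 : √X * Real.log X ≤ √X * (1 + Real.log X) :=
    mul_le_mul_of_nonneg_left (by linarith) (by linarith)
  rw [Real.rpow_one] at hX
  rw [h1]
  nlinarith

lemma eventually_norm_weighted_sum_sub_le (h : IsData α θ) {ε : ℝ} (hε : 0 < ε) :
    ∀ᶠ X : ℕ in atTop, ∀ η : ℝ, |η| ≤ 1 / 2 →
      ‖∑ p ∈ primesIoc X, (wt α θ p : ℂ) * e (η * ⌊ppol α θ p⌋) -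
        bumpCoeff η * ∑ p ∈ primesIoc X, (Real.log p : ℂ) * e (η * ppol α θ p)‖ ≤
        (X : ℝ) ^ (1 - 11 / 10 * rho (θ (Fin.last d)) + ε) := by
  have hP := exp_sum_primes h (half_pos hε)
  set Θ := θ (Fin.last d) with hΘ
  have h3 : 3 < Θ := h.three_lt
  have hr0 := rho_pos Θ
  have hr1 := rho_le h3
  set r := rho Θ with hr
  have hcast := tendsto_natCast_atTop_atTop (R := ℝ)
  filter_upwards [hP,
    hcast.eventually (eventually_mul_rpow_le 2 (a := -Θ + (121 / 5 * r + 1 / 500)) (b := 0)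
      (by linarith)),
    hcast.eventually (eventually_mul_rpow_le 4 (a := 0) (b := 2 * r) (by linarith)),
    hcast.eventually (eventually_mul_rpow_le 75 (a := 1 - 11 / 10 * r + ε / 2)
      (b := 1 - 11 / 10 * r + ε) (by linarith)),
    eventually_ge_atTop 1] with X hP hlo hhi hfin hX1 η hη
  have hX1' : (1 : ℝ) ≤ X := by exact_mod_cast hX1
  have hX0 : (0 : ℝ) < X := by linarith
  rw [Real.rpow_zero] at hlo hhi
  have hKle := Nat.floor_le (show (0 : ℝ) ≤ (X : ℝ) ^ (2 * r) / 2 by positivity)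
  have hKlt := Nat.lt_floor_add_one ((X : ℝ) ^ (2 * r) / 2)
  set K := ⌊(X : ℝ) ^ (2 * r) / 2⌋₊ with hK
  have hK4 : (X : ℝ) ^ (2 * r) / 4 ≤ K := by linarith
  have hKpos : (0 : ℝ) < K := by linarith
  have hK0 : K ≠ 0 := by
    intro h0
    rw [h0, Nat.cast_zero] at hKpos
    exact lt_irrefl _ hKpos
  set B := (X : ℝ) ^ (1 - 11 / 10 * r + ε / 2) with hB
  set S := primesIoc X with hS
  set I := Icc (-(K : ℤ)) K with hI
  have h0I : (0 : ℤ) ∈ I := by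
    rw [hI, mem_Icc]
    omega
  have e1 : ∑ p ∈ S, (wt α θ p : ℂ) * e (η * ⌊ppol α θ p⌋) -
      bumpCoeff η * ∑ p ∈ S, (Real.log p : ℂ) * e (η * ppol α θ p) =
      ∑ p ∈ S, (Real.log p : ℂ) * (((Int.fract (ppol α θ p) * (1 - Int.fract (ppol α θ p)) : ℝ) : ℂ)
        * e (η * ⌊ppol α θ p⌋) - ∑ k ∈ I, bumpCoeff (η + k) * e ((η + k) * ppol α θ p)) +
      ∑ k ∈ I.erase 0, bumpCoeff (η + k) *
        ∑ p ∈ S, (Real.log p : ℂ) * e ((η + k) * ppol α θ p) := by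
    have e2 : ∑ p ∈ S, (Real.log p : ℂ) * ∑ k ∈ I, bumpCoeff (η + k) * e ((η + k) * ppol α θ p) =
        ∑ k ∈ I, bumpCoeff (η + k) *
          ∑ p ∈ S, (Real.log p : ℂ) * e ((η + k) * ppol α θ p) := by
      simp only [mul_sum]
      rw [sum_comm]
      exact sum_congr rfl fun k _ => sum_congr rfl fun p _ => by ring
    simp only [mul_sub, sum_sub_distrib]
    rw [e2, ← add_sum_erase _ _ h0I, Int.cast_zero, add_zero]
    have e3 : ∑ p ∈ S, (wt α θ p : ℂ) * e (η * ⌊ppol α θ p⌋) = ∑ p ∈ S, (Real.log p : ℂ) *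
        (((Int.fract (ppol α θ p) * (1 - Int.fract (ppol α θ p)) : ℝ) : ℂ)
        * e (η * ⌊ppol α θ p⌋)) := sum_congr rfl fun p _ => by
      unfold wt
      push_cast
      ring
    rw [e3]
    ring_nf
  have b1 : ‖∑ p ∈ S, (Real.log p : ℂ) *
      (((Int.fract (ppol α θ p) * (1 - Int.fract (ppol α θ p)) : ℝ) : ℂ)
        * e (η * ⌊ppol α θ p⌋) - ∑ k ∈ I, bumpCoeff (η + k) * e ((η + k) * ppol α θ p))‖ ≤
      64 * B := by
    calc _ ≤ ∑ p ∈ S, Real.log p * (8 / K) := by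
          refine norm_sum_le_of_le _ fun p _ => ?_
          rw [norm_mul, Complex.norm_real, Real.norm_of_nonneg (Real.log_natCast_nonneg p)]
          exact mul_le_mul_of_nonneg_left (norm_bump_sub_sum_le hη _ hK0)
            (Real.log_natCast_nonneg p)
      _ ≤ 2 * X * (8 / K) := by
          rw [← sum_mul]
          exact mul_le_mul_of_nonneg_right (sum_log_primesIoc_le X) (by positivity)
      _ ≤ 2 * X * (32 * (X : ℝ) ^ (-(2 * r))) := by
          refine mul_le_mul_of_nonneg_left ?_ (by positivity)
          rw [Real.rpow_neg hX0.le, ← div_eq_mul_inv, div_le_div_iff₀ hKpos (by positivity)]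
          linarith
      _ = 64 * (X : ℝ) ^ (1 + -(2 * r)) := by
          rw [Real.rpow_add hX0, Real.rpow_one]
          ring
      _ ≤ 64 * B := by
          refine mul_le_mul_of_nonneg_left ?_ (by norm_num)
          exact Real.rpow_le_rpow_of_exponent_le hX1' (by linarith)
  have b2 : ‖∑ k ∈ I.erase 0, bumpCoeff (η + k) *
        ∑ p ∈ S, (Real.log p : ℂ) * e ((η + k) * ppol α θ p)‖ ≤ 11 * B := by
    calc _ ≤ ∑ k ∈ I.erase 0, ‖bumpCoeff (η + k)‖ * B := by
          refine norm_sum_le_of_le _ fun k hk => ?_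
          rw [norm_mul]
          refine mul_le_mul_of_nonneg_left (hP _ ?_) (norm_nonneg _)
          obtain ⟨hk0, hk⟩ := mem_erase.1 hk
          rw [hI, mem_Icc] at hk
          have hk1 : (1 : ℝ) ≤ |(k : ℝ)| := by exact_mod_cast Int.one_le_abs hk0
          have hk2 : |(k : ℝ)| ≤ K := by
            have : |k| ≤ (K : ℤ) := abs_le.2 hk
            exact_mod_cast this
          have t1 := abs_sub_abs_le_abs_sub (k : ℝ) (-η)
          rw [abs_neg, sub_neg_eq_add, add_comm (k : ℝ)] at t1
          have t2 := abs_add_le η (k : ℝ)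
          refine ⟨?_, ?_⟩
          · linarith
          · linarith
      _ ≤ 11 * B := by
          rw [← sum_mul]
          exact mul_le_mul_of_nonneg_right (sum_norm_bumpCoeff_le hη _) (by positivity)
  rw [e1]
  refine (norm_add_le _ _).trans ?_
  linarith

lemma eventually_norm_weighted_sum_le (h : IsData α θ) : ∀ᶠ X : ℕ in atTop, ∀ t : ℝ,
    (X : ℝ) ^ (-θ (Fin.last d) + (121 / 5 * rho (θ (Fin.last d)) + 1 / 500)) ≤ |t - round t| →
      ‖∑ p ∈ primesIoc X, (wt α θ p : ℂ) * e (t * ⌊ppol α θ p⌋)‖ ≤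
        (X : ℝ) ^ (1 - 21 / 20 * rho (θ (Fin.last d))) := by
  have hr0 := rho_pos (θ (Fin.last d))
  have hcast := tendsto_natCast_atTop_atTop (R := ℝ)
  have hε : 0 < rho (θ (Fin.last d)) / 40 := by positivity
  filter_upwards [eventually_norm_weighted_sum_sub_le h hε, exp_sum_primes h hε,
    hcast.eventually (eventually_mul_rpow_le 2
      (a := 1 - 11 / 10 * rho (θ (Fin.last d)) + rho (θ (Fin.last d)) / 40)
      (b := 1 - 21 / 20 * rho (θ (Fin.last d))) (by linarith)),
    eventually_ge_atTop 1] with X h1 h2 h3 hX1 t ht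
  have hX1' : (1 : ℝ) ≤ X := by exact_mod_cast hX1
  have hη := abs_sub_round t
  have e1 : ∑ p ∈ primesIoc X, (wt α θ p : ℂ) * e (t * ⌊ppol α θ p⌋) =
      ∑ p ∈ primesIoc X, (wt α θ p : ℂ) * e ((t - round t) * ⌊ppol α θ p⌋) :=
    sum_congr rfl fun p _ => by
      have : t * ⌊ppol α θ p⌋ = (t - round t) * ⌊ppol α θ p⌋ +
          ((round t * ⌊ppol α θ p⌋ : ℤ) : ℝ) := by
        push_cast
        ring
      rw [this, e_add_int]
  have a1 := h1 _ hη
  have a2 := h2 (t - round t) ⟨ht, by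
    have : (1 : ℝ) ≤ (X : ℝ) ^ (2 * rho (θ (Fin.last d))) := Real.one_le_rpow hX1' (by linarith)
    linarith⟩
  have a3 : ‖bumpCoeff (t - round t) *
      ∑ p ∈ primesIoc X, (Real.log p : ℂ) * e ((t - round t) * ppol α θ p)‖ ≤
      (X : ℝ) ^ (1 - 11 / 10 * rho (θ (Fin.last d)) + rho (θ (Fin.last d)) / 40) := by
    rw [norm_mul]
    calc _ ≤ 1 * _ := mul_le_mul (norm_bumpCoeff_le_one _) a2 (norm_nonneg _) zero_le_one
      _ = _ := one_mul _
  rw [e1]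
  have a4 := norm_sub_norm_le
    (∑ p ∈ primesIoc X, (wt α θ p : ℂ) * e ((t - round t) * ⌊ppol α θ p⌋))
    (bumpCoeff (t - round t) *
      ∑ p ∈ primesIoc X, (Real.log p : ℂ) * e ((t - round t) * ppol α θ p))
  linarith

lemma eventually_le_sum_wt (h : IsData α θ) :
    ∀ᶠ X : ℕ in atTop, (X : ℝ) / 48 ≤ ∑ p ∈ primesIoc X, wt α θ p := by
  have hr0 := rho_pos (θ (Fin.last d))
  have hcast := tendsto_natCast_atTop_atTop (R := ℝ)
  have hε : 0 < rho (θ (Fin.last d)) / 40 := by positivity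
  filter_upwards [eventually_norm_weighted_sum_sub_le h hε, eventually_le_sum_log_primesIoc,
    hcast.eventually (eventually_mul_rpow_le 48
      (a := 1 - 11 / 10 * rho (θ (Fin.last d)) + rho (θ (Fin.last d)) / 40)
      (b := 1) (by linarith))] with X h1 h2 h3
  have a1 := h1 0 (by norm_num)
  simp only [zero_mul, e_zero, mul_one, bumpCoeff_zero] at a1
  rw [← Complex.ofReal_sum, ← Complex.ofReal_sum,
    show (1 / 6 : ℂ) = ((1 / 6 : ℝ) : ℂ) by push_cast; ring, ← Complex.ofReal_mul,
    ← Complex.ofReal_sub, Complex.norm_real, Real.norm_eq_abs] at a1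
  rw [Real.rpow_one] at h3
  have := (abs_le.1 a1).1
  linarith

end

section

lemma card_sq_le_mul_card_collisions {Ω : Type*} (s : Finset Ω) (a : Ω → ℕ) {N : ℕ}
    (ha : ∀ x ∈ s, a x < N) :
    (#s : ℝ) ^ 2 ≤ N * ∑ x ∈ s, ∑ y ∈ s, if a x = a y then (1 : ℝ) else 0 := by
  have h1 : (#s : ℝ) = ∑ n ∈ range N, (#{x ∈ s | a x = n} : ℝ) := by
    rw [card_eq_sum_card_fiberwise (f := a) (t := range N) fun x hx => by
      simpa using ha x hx]
    push_cast
    rfl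
  have h2 : ∑ x ∈ s, ∑ y ∈ s, (if a x = a y then (1 : ℝ) else 0) =
      ∑ n ∈ range N, (#{x ∈ s | a x = n} : ℝ) ^ 2 := by
    rw [← sum_fiberwise_of_maps_to (g := a) (t := range N) fun x hx => by simpa using ha x hx]
    refine sum_congr rfl fun n _ => ?_
    have : ∀ x ∈ s.filter (a · = n), ∑ y ∈ s, (if a x = a y then (1 : ℝ) else 0) =
        (#{x ∈ s | a x = n} : ℝ) := fun x hx => by
      rw [(mem_filter.1 hx).2, sum_boole]
      simp only [eq_comm]
    rw [sum_congr rfl this, sum_const, nsmul_eq_mul, sq]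
  rw [h1, h2]
  simpa using sq_sum_le_card_mul_sum_sq (s := range N)
    (f := fun n => (#{x ∈ s | a x = n} : ℝ))

lemma geo_pow (H r : ℕ) (t : ℝ) : geo H t ^ r =
    ∑ x ∈ Fintype.piFinset fun _ : Fin r => range H, e (t * (∑ i, x i : ℕ)) := by
  unfold geo
  rw [sum_pow']
  refine sum_congr rfl fun x _ => ?_
  push_cast
  rw [mul_sum, e_sum]

lemma geo_sub_int (H : ℕ) (t : ℝ) (n : ℤ) : geo H (t - n) = geo H t := by
  unfold geo
  refine sum_congr rfl fun i _ => ?_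
  rw [← e_add_int _ (n * i)]
  congr 1
  push_cast
  ring

lemma norm_geo_le_of_le_abs_sub_round {H : ℕ} {t Δ : ℝ} (hΔ : 0 < Δ) (h : Δ ≤ |t - round t|) :
    ‖geo H t‖ ≤ 1 / (2 * Δ) := by
  rw [← geo_sub_int H t (round t)]
  exact (norm_geo_le H (abs_sub_round t) (hΔ.trans_le h)).trans
    (one_div_le_one_div_of_le (by positivity) (by linarith))

/-- If no `ξ * m p` is within `Δ` of an integer, the exponential sums at the integer multiples of
`ξ` cannot all be small. -/
lemma sum_weight_div_le {ι : Type*} {S : Finset ι} {w : ι → ℝ} (hw : ∀ p ∈ S, 0 ≤ w p)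
    (m : ι → ℤ) (ξ : ℝ) {Δ B : ℝ} {H r : ℕ} (hH : 0 < H) (hr : 0 < r) (hΔ : 0 < Δ)
    (hfar : ∀ p ∈ S, Δ ≤ |ξ * m p - round (ξ * m p)|) (hB : 0 ≤ B)
    (hsup : ∀ j : ℤ, j ≠ 0 → |j| < r * H → ‖∑ p ∈ S, (w p : ℂ) * e (j * ξ * m p)‖ ≤ B) :
    (∑ p ∈ S, w p) / (r * H) ≤ (1 / (2 * H * Δ)) ^ (2 * r) * ∑ p ∈ S, w p + B := by
  set Ω := Fintype.piFinset fun _ : Fin r => range H with hΩ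
  set a : (Fin r → ℕ) → ℕ := fun x => ∑ i, x i with ha
  set T : ℤ → ℂ := fun j => ∑ p ∈ S, (w p : ℂ) * e (j * ξ * m p) with hT
  set W := ∑ p ∈ S, w p with hW
  have hcard : (#Ω : ℝ) = (H : ℝ) ^ r := by
    rw [hΩ, Fintype.card_piFinset]
    simp
  have halt : ∀ x ∈ Ω, a x < r * H := fun x hx => by
    have : a x < ∑ _i : Fin r, H := by
      refine sum_lt_sum_of_nonempty ⟨⟨0, hr⟩, mem_univ _⟩ fun i _ => ?_
      simpa using Fintype.mem_piFinset.1 hx i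
    simpa using this
  have hT0 : T 0 = (W : ℂ) := by
    simp [hT, hW]
  have hW0 : 0 ≤ W := sum_nonneg hw
  have h1 : ∑ x ∈ Ω, ∑ y ∈ Ω, T (a x - a y) =
      ((∑ p ∈ S, w p * (‖geo H (ξ * m p)‖ ^ (2 * r)) : ℝ) : ℂ) := by
    have : ∀ p, ((‖geo H (ξ * m p)‖ ^ (2 * r) : ℝ) : ℂ) =
        ∑ x ∈ Ω, ∑ y ∈ Ω, e (((a x - a y : ℤ) : ℝ) * ξ * m p) := fun p => by
      rw [mul_comm 2 r, pow_mul, ← norm_pow, Complex.ofReal_pow, ← Complex.mul_conj', geo_pow,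
        map_sum, sum_mul_sum]
      refine sum_congr rfl fun x _ => sum_congr rfl fun y _ => ?_
      rw [conj_e, ← e_add]
      congr 1
      simp only [ha]
      push_cast
      ring
    push_cast at this ⊢
    simp only [this, mul_sum, hT]
    rw [sum_comm (s := S)]
    refine sum_congr rfl fun x _ => ?_
    rw [sum_comm]
    push_cast
    rfl
  have h2 : ∑ p ∈ S, w p * ‖geo H (ξ * m p)‖ ^ (2 * r) ≤ (1 / (2 * Δ)) ^ (2 * r) * W := by
    rw [hW, mul_sum]
    refine sum_le_sum fun p hp => ?_
    rw [mul_comm]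
    exact mul_le_mul_of_nonneg_right (pow_le_pow_left₀ (norm_nonneg _)
      (norm_geo_le_of_le_abs_sub_round hΔ (hfar p hp)) _) (hw p hp)
  have h3 : (∑ x ∈ Ω, ∑ y ∈ Ω, if a x = a y then (1 : ℝ) else 0) * W - (#Ω : ℝ) ^ 2 * B ≤
      (∑ x ∈ Ω, ∑ y ∈ Ω, T (a x - a y)).re := by
    have : ∀ x ∈ Ω, ∀ y ∈ Ω, (if a x = a y then (1 : ℝ) else 0) * W - B ≤
        (T (a x - a y)).re := fun x hx y hy => by
      split_ifs with hxy
      · rw [hxy, sub_self, hT0, Complex.ofReal_re]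
        linarith
      · have hx' := halt x hx
        have hy' := halt y hy
        have := hsup (a x - a y) (sub_ne_zero.2 (by exact_mod_cast hxy)) (by
          rw [abs_lt]
          zify at hx' hy'
          constructor <;> linarith [Int.natCast_nonneg (a x), Int.natCast_nonneg (a y)])
        have h5 := (abs_le.1 ((Complex.abs_re_le_norm _).trans this)).1
        simp only [hT]
        linarith
    rw [Complex.re_sum]
    simp only [Complex.re_sum]
    calc _ = ∑ x ∈ Ω, ∑ y ∈ Ω, ((if a x = a y then (1 : ℝ) else 0) * W - B) := by
          simp only [sum_sub_distrib, sum_mul, sum_const, nsmul_eq_mul]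
          ring
      _ ≤ _ := sum_le_sum fun x hx => sum_le_sum fun y hy => this x hx y hy
  rw [h1, Complex.ofReal_re] at h3
  have h4 := card_sq_le_mul_card_collisions Ω a halt
  have hH' : (0 : ℝ) < H := by exact_mod_cast hH
  have hr' : (0 : ℝ) < r := by exact_mod_cast hr
  have hΩ0 : (0 : ℝ) < (#Ω : ℝ) ^ 2 := by
    rw [hcard]
    positivity
  refine le_of_mul_le_mul_left ?_ hΩ0
  have h5 : (1 / (2 * H * Δ)) ^ (2 * r) * (#Ω : ℝ) ^ 2 = (1 / (2 * Δ)) ^ (2 * r) := by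
    rw [hcard, ← pow_mul, mul_comm r 2, ← mul_pow]
    congr 1
    field_simp
  have h6 : (#Ω : ℝ) ^ 2 * (W / (r * H)) ≤
      (∑ x ∈ Ω, ∑ y ∈ Ω, if a x = a y then (1 : ℝ) else 0) * W := by
    rw [← mul_div_assoc, div_le_iff₀ (by positivity)]
    push_cast at h4
    calc _ ≤ _ := mul_le_mul_of_nonneg_right h4 hW0
      _ = _ := by ring
  calc _ ≤ _ := h6
    _ ≤ (1 / (2 * Δ)) ^ (2 * r) * W + (#Ω : ℝ) ^ 2 * B := by linarith
    _ = _ := by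
      rw [← h5]
      ring

end

section

lemma one_div_le_abs_div_sub {q : ℕ} (hq : 0 < q) {z : ℤ} (hz : ¬(q : ℤ) ∣ z) (k : ℤ) :
    1 / (q : ℝ) ≤ |(z : ℝ) / q - k| := by
  have hq' : (0 : ℝ) < q := by exact_mod_cast hq
  have h0 : z - q * k ≠ 0 := fun h => hz ⟨k, by linarith⟩
  have h1 : (1 : ℝ) ≤ |((z - q * k : ℤ) : ℝ)| := by exact_mod_cast Int.one_le_abs h0
  rw [show (z : ℝ) / q - k = ((z - q * k : ℤ) : ℝ) / q by push_cast; field_simp, abs_div,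
    abs_of_pos hq']
  exact div_le_div_of_nonneg_right h1 hq'.le

lemma sum_e_div_eq_zero {q : ℕ} (hq : 0 < q) {z : ℤ} (hz : ¬(q : ℤ) ∣ z) :
    ∑ h ∈ range q, e ((h : ℝ) / q * z) = 0 := by
  have hq' : (q : ℝ) ≠ 0 := by exact_mod_cast hq.ne'
  have h1 : ∀ h : ℕ, e ((h : ℝ) / q * z) = e ((z : ℝ) / q) ^ h := fun h => by
    rw [← e_mul_nat]
    congr 1
    ring
  simp only [h1]
  have h2 := geom_sum_mul (e ((z : ℝ) / q)) q
  rw [← e_mul_nat, div_mul_cancel₀ _ hq', e_int, sub_self] at h2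
  exact (mul_eq_zero.1 h2).resolve_right (sub_ne_zero.2 (e_div_ne_one hq hz))

lemma exists_dvd_of_exp_sum_le {ι : Type*} {S : Finset ι} {w : ι → ℝ} (m : ι → ℤ) {q : ℕ}
    (hq : 0 < q) {B : ℝ} (hB : 0 ≤ B)
    (hsup : ∀ h : ℕ, 0 < h → h < q → ‖∑ p ∈ S, (w p : ℂ) * e ((h : ℝ) / q * m p)‖ ≤ B)
    (hW : q * B < ∑ p ∈ S, w p) : ∃ p ∈ S, (q : ℤ) ∣ m p := by
  by_contra! hne
  have h1 : ∑ h ∈ range q, ∑ p ∈ S, (w p : ℂ) * e ((h : ℝ) / q * m p) = 0 := by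
    rw [sum_comm]
    refine sum_eq_zero fun p hp => ?_
    rw [← mul_sum, sum_e_div_eq_zero hq (hne p hp), mul_zero]
  rw [← add_sum_erase _ _ (mem_range.2 hq)] at h1
  simp only [Nat.cast_zero, zero_div, zero_mul, e_zero, mul_one] at h1
  have h2 : ‖∑ h ∈ (range q).erase 0, ∑ p ∈ S, (w p : ℂ) * e ((h : ℝ) / q * m p)‖ ≤ q * B := by
    refine (norm_sum_le_of_le (f := fun h : ℕ => ∑ p ∈ S, (w p : ℂ) * e ((h : ℝ) / q * m p)) _
      (n := fun _ => B) fun h hh => ?_).trans ?_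
    · obtain ⟨h0, hlt⟩ := mem_erase.1 hh
      exact hsup h (Nat.pos_of_ne_zero h0) (mem_range.1 hlt)
    · rw [sum_const, nsmul_eq_mul]
      refine mul_le_mul_of_nonneg_right ?_ hB
      exact_mod_cast (card_erase_le.trans_eq (card_range q))
  have h3 : ‖∑ p ∈ S, (w p : ℂ)‖ ≤ q * B := by
    rw [eq_neg_of_add_eq_zero_left h1, norm_neg]
    exact h2
  rw [← Complex.ofReal_sum, Complex.norm_real] at h3
  linarith [Real.le_norm_self (∑ p ∈ S, w p)]

variable {d : ℕ} {α θ : Fin (d + 1) → ℝ}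

lemma prime_of_mem_primesIoc {X p : ℕ} (hp : p ∈ primesIoc X) : p.Prime :=
  (mem_filter.1 hp).2

lemma le_of_mem_primesIoc {X p : ℕ} (hp : p ∈ primesIoc X) : p ≤ X :=
  (mem_Ioc.1 (mem_filter.1 hp).1).2

lemma IsData.ppol_nonneg (h : IsData α θ) {x : ℝ} (hx : 0 ≤ x) : 0 ≤ ppol α θ x :=
  sum_nonneg fun j _ => mul_nonneg (h.pos j).le (Real.rpow_nonneg hx _)

lemma IsData.ppol_le (h : IsData α θ) {x : ℝ} (hx : 1 ≤ x) :
    ppol α θ x ≤ (∑ j, α j) * x ^ θ (Fin.last d) := by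
  rw [ppol, sum_mul]
  exact sum_le_sum fun j _ => mul_le_mul_of_nonneg_left
    (Real.rpow_le_rpow_of_exponent_le hx (h.mono.monotone (Fin.le_last j))) (h.pos j).le

lemma abs_sub_round_mul_le_of_dvd {ξ : ℝ} {a m : ℤ} {q : ℕ} (hq : 0 < q) (hm : (q : ℤ) ∣ m) :
    |ξ * m - round (ξ * m)| ≤ |ξ - a / q| * |(m : ℝ)| := by
  obtain ⟨k, rfl⟩ := hm
  have hq' : (q : ℝ) ≠ 0 := by exact_mod_cast hq.ne'
  refine (round_le _ (a * k)).trans_eq ?_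
  rw [← abs_mul]
  congr 1
  push_cast
  field_simp

/-- The loss exponent in the major arcs. -/
def arcLoss (Θ : ℝ) : ℝ := 243 / 10 * rho Θ + 1 / 500

lemma arcLoss_pos (Θ : ℝ) : 0 < arcLoss Θ := by
  have := rho_pos Θ
  unfold arcLoss
  positivity

lemma eventually_exists_dvd (h : IsData α θ) : ∀ᶠ X : ℕ in atTop, ∀ q : ℕ, 0 < q →
    (q : ℝ) ≤ (X : ℝ) ^ rho (θ (Fin.last d)) →
    ∃ p : ℕ, p.Prime ∧ (p : ℝ) ≤ (X : ℝ) ^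
      (1 - (arcLoss (θ (Fin.last d)) + rho (θ (Fin.last d))) / θ (Fin.last d)) ∧
      (q : ℤ) ∣ ⌊ppol α θ p⌋ := by
  have hr0 := rho_pos (θ (Fin.last d))
  have hr1 := rho_le h.three_lt
  have hl0 := arcLoss_pos (θ (Fin.last d))
  have h3 := h.three_lt
  set Θ := θ (Fin.last d) with hΘ
  set r := rho Θ with hr
  set γ := (arcLoss Θ + r) / Θ with hγ
  have hγ0 : 0 < γ := by positivity
  have hγ1 : γ ≤ 1 / 40 := by
    rw [hγ, div_le_iff₀ (by linarith), arcLoss]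
    linarith
  have hcast := tendsto_natCast_atTop_atTop (R := ℝ)
  have hP : Tendsto (fun X : ℕ => ⌊(X : ℝ) ^ (1 - γ)⌋₊) atTop atTop :=
    tendsto_nat_floor_atTop.comp ((tendsto_rpow_atTop (by linarith)).comp hcast)
  filter_upwards [hP.eventually (eventually_norm_weighted_sum_le h),
    hP.eventually (eventually_le_sum_wt h),
    hcast.eventually (eventually_mul_rpow_le 2 (a := 97 / 100) (b := 1 - γ) (by linarith)),
    hcast.eventually (eventually_mul_rpow_le 49 (a := r) (b := 97 / 100 * (21 / 20 * r))
      (by linarith)),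
    eventually_ge_atTop 1] with X h1 h2 h4 h5 hX1 q hq hqX
  have hX1' : (1 : ℝ) ≤ X := by exact_mod_cast hX1
  have hX0 : (0 : ℝ) < X := by linarith
  set P := ⌊(X : ℝ) ^ (1 - γ)⌋₊ with hPdef
  have hPX : (X : ℝ) ^ (97 / 100 : ℝ) ≤ P := by
    have a1 := Nat.lt_floor_add_one ((X : ℝ) ^ (1 - γ))
    have a2 : (1 : ℝ) ≤ (X : ℝ) ^ (97 / 100 : ℝ) := Real.one_le_rpow hX1' (by norm_num)
    linarith
  have hP1 : (1 : ℝ) ≤ P := (Real.one_le_rpow hX1' (by norm_num)).trans hPX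
  have hP0 : (0 : ℝ) < P := by linarith
  have hPle : (P : ℝ) ≤ (X : ℝ) ^ (1 - γ) := Nat.floor_le (by positivity)
  have hq' : (0 : ℝ) < q := by exact_mod_cast hq
  obtain ⟨p, hp, hdvd⟩ := exists_dvd_of_exp_sum_le (S := primesIoc P) (w := wt α θ)
    (fun p => ⌊ppol α θ p⌋) hq (B := (P : ℝ) ^ (1 - 21 / 20 * r)) (by positivity)
    (fun k hk0 hkq => by
      refine h1 _ (le_trans ?_ (one_div_le_abs_div_sub hq (z := k) (fun hd => ?_) _))
      · calc (P : ℝ) ^ (-Θ + (121 / 5 * r + 1 / 500)) ≤ (P : ℝ) ^ (-(1 / 97 * 100) : ℝ) := by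
              refine Real.rpow_le_rpow_of_exponent_le hP1 ?_
              linarith
          _ ≤ ((X : ℝ) ^ (97 / 100 : ℝ)) ^ (-(1 / 97 * 100) : ℝ) :=
              Real.rpow_le_rpow_of_nonpos (by positivity) hPX (by norm_num)
          _ = (X : ℝ) ^ (-1 : ℝ) := by
              rw [← Real.rpow_mul hX0.le]
              norm_num
          _ ≤ (X : ℝ) ^ (-r) := Real.rpow_le_rpow_of_exponent_le hX1' (by linarith)
          _ = 1 / (X : ℝ) ^ r := by rw [Real.rpow_neg hX0.le, one_div]
          _ ≤ 1 / q := one_div_le_one_div_of_le hq' hqX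
      · have := Nat.le_of_dvd hk0 (Int.natCast_dvd_natCast.1 hd)
        omega)
    (lt_of_lt_of_le (by
      have b1 : 49 * (X : ℝ) ^ r ≤ (P : ℝ) ^ (21 / 20 * r) := by
        refine h5.trans ?_
        rw [Real.rpow_mul hX0.le]
        exact Real.rpow_le_rpow (by positivity) hPX (by positivity)
      have b2 : (P : ℝ) ^ (1 - 21 / 20 * r) * (P : ℝ) ^ (21 / 20 * r) = P := by
        rw [← Real.rpow_add hP0, sub_add_cancel, Real.rpow_one]
      have b3 : 0 < (P : ℝ) ^ (1 - 21 / 20 * r) := by positivity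
      have b4 : (P : ℝ) ^ (1 - 21 / 20 * r) * (49 * q) ≤ P := by
        refine (mul_le_mul_of_nonneg_left ?_ b3.le).trans_eq b2
        linarith
      have b5 : 0 < (q : ℝ) * (P : ℝ) ^ (1 - 21 / 20 * r) := by positivity
      show (q : ℝ) * (P : ℝ) ^ (1 - 21 / 20 * r) < (P : ℝ) / 48
      linarith) h2)
  refine ⟨p, prime_of_mem_primesIoc hp, ?_, hdvd⟩
  exact le_trans (by exact_mod_cast le_of_mem_primesIoc hp) hPle

end

section

variable {d : ℕ} {α θ : Fin (d + 1) → ℝ}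

lemma eventually_exists_near_of_large_den (h : IsData α θ) {ε : ℝ} (hε : 0 < ε)
    (hεr : ε < rho (θ (Fin.last d))) : ∀ᶠ X : ℕ in atTop, ∀ (ξ : ℝ) (a : ℤ) (q n : ℕ),
    IsCoprime a (q : ℤ) → (X : ℝ) ^ rho (θ (Fin.last d)) ≤ q → q ≤ n →
    (n : ℝ) ≤ (X : ℝ) ^ (θ (Fin.last d) - arcLoss (θ (Fin.last d))) →
    (X : ℝ) ^ (θ (Fin.last d) - arcLoss (θ (Fin.last d))) ≤ n + 1 →
    |ξ - a / q| ≤ 1 / ((n + 1) * q) →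
    ∃ p ∈ primesIoc X, |ξ * ⌊ppol α θ p⌋ - round (ξ * ⌊ppol α θ p⌋)| ≤
      (X : ℝ) ^ (-rho (θ (Fin.last d)) + ε) := by
  have hr0 := rho_pos (θ (Fin.last d))
  have hr1 := rho_le h.three_lt
  have hl0 := arcLoss_pos (θ (Fin.last d))
  have h3 := h.three_lt
  set Θ := θ (Fin.last d) with hΘ
  set r := rho Θ with hr
  have hl1 : arcLoss Θ ≤ 1 / 10 := by
    rw [arcLoss]
    linarith
  have hcast := tendsto_natCast_atTop_atTop (R := ℝ)
  obtain ⟨R, hR⟩ := exists_nat_gt (r / ε)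
  have hRε : r < R * ε := (div_lt_iff₀ hε).1 hR
  have hR0 : 0 < R := by
    rcases Nat.eq_zero_or_pos R with h0 | h0
    · rw [h0] at hRε
      simp only [Nat.cast_zero, zero_mul] at hRε
      linarith
    · exact h0
  have hR0' : (0 : ℝ) < R := by exact_mod_cast hR0
  filter_upwards [eventually_norm_weighted_sum_le h, eventually_le_sum_wt h,
    hcast.eventually (eventually_mul_rpow_le 2 (a := 0) (b := r - ε / 2) (by linarith)),
    hcast.eventually (eventually_mul_rpow_le (2 * R) (a := r - ε / 2) (b := r) (by linarith)),
    hcast.eventually (eventually_mul_rpow_le 2 (a := -Θ + (121 / 5 * r + 1 / 500))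
      (b := -(Θ - arcLoss Θ)) (by rw [arcLoss]; linarith)),
    hcast.eventually (eventually_mul_rpow_le (97 * R) (a := r - ε / 2) (b := 21 / 20 * r)
      (by linarith)),
    eventually_ge_atTop 1] with X h1 h2 hc1 hc2 hc3 hc4 hX1 ξ a q n haq hq hqn hn1 hn2 hξ
  have hX1' : (1 : ℝ) ≤ X := by exact_mod_cast hX1
  have hX0 : (0 : ℝ) < X := by linarith
  rw [Real.rpow_zero] at hc1
  by_contra! hfar
  set H := ⌊(X : ℝ) ^ (r - ε / 2)⌋₊ with hHdef
  have hHle : (H : ℝ) ≤ (X : ℝ) ^ (r - ε / 2) := Nat.floor_le (by positivity)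
  have hHge : (X : ℝ) ^ (r - ε / 2) ≤ 2 * H := by
    have := Nat.lt_floor_add_one ((X : ℝ) ^ (r - ε / 2))
    linarith
  have hH0' : (0 : ℝ) < H := by linarith
  have hH0 : 0 < H := by exact_mod_cast hH0'
  have hRH : (2 * R * H : ℝ) ≤ (X : ℝ) ^ r :=
    (mul_le_mul_of_nonneg_left hHle (by positivity)).trans hc2
  have hq0' : (0 : ℝ) < q := lt_of_lt_of_le (by positivity) hq
  have hq0 : 0 < q := by exact_mod_cast hq0'
  have hqn' : (q : ℝ) ≤ n := by exact_mod_cast hqn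
  have hn0 : (0 : ℝ) < n := by linarith
  have key := sum_weight_div_le (S := primesIoc X) (w := wt α θ) (fun p _ => wt_nonneg α θ p)
    (fun p => ⌊ppol α θ p⌋) ξ (H := H) (r := R) hH0 hR0 (Δ := (X : ℝ) ^ (-r + ε))
    (by positivity) (fun p hp => (hfar p hp).le)
    (B := (X : ℝ) ^ (1 - 21 / 20 * r)) (by positivity) (fun j hj0 hjlt => by
      refine h1 _ ?_
      have hjlt' : |(j : ℝ)| < R * H := by exact_mod_cast hjlt
      have hjq : |(j : ℝ)| < q := by
        have : 0 ≤ |(j : ℝ)| := abs_nonneg _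
        linarith
      have hdvd : ¬(q : ℤ) ∣ j * a := fun hd => by
        have h6 : (q : ℤ) ∣ j := haq.symm.dvd_of_dvd_mul_right hd
        have h7 := Int.le_of_dvd (abs_pos.2 hj0) ((dvd_abs _ _).2 h6)
        have h8 : (q : ℝ) ≤ |(j : ℝ)| := by exact_mod_cast h7
        linarith
      have a1 := one_div_le_abs_div_sub hq0 hdvd (round (j * ξ))
      have a2 : |(j : ℝ) * (ξ - a / q)| ≤ 1 / (2 * q) := by
        rw [abs_mul]
        calc _ ≤ ((n + 1) / 2 : ℝ) * (1 / ((n + 1) * q)) := by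
              refine mul_le_mul ?_ hξ (abs_nonneg _) (by positivity)
              linarith
          _ = 1 / (2 * q) := by
              field_simp
      have a3 : ((j * a : ℤ) : ℝ) / q - round (j * ξ) =
          (j * ξ - round (j * ξ)) - j * (ξ - a / q) := by
        push_cast
        ring
      rw [a3] at a1
      have a4 := abs_sub (j * ξ - round (j * ξ)) (j * (ξ - a / q))
      have a5 : 1 / (q : ℝ) = 2 * (1 / (2 * q)) := by
        field_simp
      have a6 : (X : ℝ) ^ (-(Θ - arcLoss Θ)) ≤ 1 / n := by
        rw [Real.rpow_neg hX0.le, ← one_div]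
        exact one_div_le_one_div_of_le hn0 hn1
      have a7 : 1 / (n : ℝ) ≤ 1 / q := one_div_le_one_div_of_le hq0' hqn'
      linarith)
  have hb1 : (X : ℝ) ^ (ε / 2) ≤ 2 * H * (X : ℝ) ^ (-r + ε) := by
    calc (X : ℝ) ^ (ε / 2) = (X : ℝ) ^ (r - ε / 2) * (X : ℝ) ^ (-r + ε) := by
          rw [← Real.rpow_add hX0]
          ring_nf
      _ ≤ _ := mul_le_mul_of_nonneg_right hHge (by positivity)
  have hb2 : (1 / (2 * H * (X : ℝ) ^ (-r + ε))) ^ (2 * R) ≤ 1 / (2 * (R * H)) := by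
    calc _ ≤ (1 / (X : ℝ) ^ (ε / 2)) ^ (2 * R) :=
          pow_le_pow_left₀ (by positivity) (one_div_le_one_div_of_le (by positivity) hb1) _
      _ = 1 / (X : ℝ) ^ (R * ε) := by
          rw [div_pow, one_pow, ← Real.rpow_mul_natCast hX0.le]
          congr 2
          push_cast
          ring
      _ ≤ 1 / (2 * (R * H)) := by
          refine one_div_le_one_div_of_le (by positivity) ?_
          have := Real.rpow_le_rpow_of_exponent_le hX1' hRε.le
          linarith
  set W := ∑ p ∈ primesIoc X, wt α θ p with hW
  have hW0 : 0 ≤ W := sum_nonneg fun p _ => wt_nonneg α θ p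
  have hb3 : W / (2 * (R * H)) ≤ (X : ℝ) ^ (1 - 21 / 20 * r) := by
    have b1 := mul_le_mul_of_nonneg_right hb2 hW0
    have b2 : W / (R * H) = 2 * (W / (2 * (R * H))) := by
      field_simp
    have b3 : 1 / (2 * (R * H)) * W = W / (2 * (R * H)) := by ring
    linarith
  rw [div_le_iff₀ (by positivity)] at hb3
  have hb4 : (X : ℝ) ^ (1 - 21 / 20 * r) * (97 * R * H) ≤ X := by
    calc _ ≤ (X : ℝ) ^ (1 - 21 / 20 * r) * (X : ℝ) ^ (21 / 20 * r) := by
          refine mul_le_mul_of_nonneg_left ?_ (by positivity)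
          exact (mul_le_mul_of_nonneg_left hHle (by positivity)).trans hc4
      _ = X := by rw [← Real.rpow_add hX0, sub_add_cancel, Real.rpow_one]
  have hb5 : 0 < (X : ℝ) ^ (1 - 21 / 20 * r) * (R * H) := by positivity
  linarith

lemma eventually_exists_prime_near (h : IsData α θ) (ξ : ℝ) {ε : ℝ} (hε : 0 < ε)
    (hεr : ε < rho (θ (Fin.last d))) : ∀ᶠ X : ℕ in atTop, ∃ p : ℕ, p.Prime ∧ p ≤ X ∧
    |ξ * ⌊ppol α θ p⌋ - round (ξ * ⌊ppol α θ p⌋)| ≤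
      (1 + ∑ j, α j) * (X : ℝ) ^ (-rho (θ (Fin.last d)) + ε) := by
  have hr0 := rho_pos (θ (Fin.last d))
  have hr1 := rho_le h.three_lt
  have hl0 := arcLoss_pos (θ (Fin.last d))
  have h3 := h.three_lt
  have hα : 0 ≤ ∑ j, α j := sum_nonneg fun j _ => (h.pos j).le
  filter_upwards [eventually_exists_dvd h, eventually_exists_near_of_large_den h hε hεr,
    eventually_ge_atTop 1] with X h1 h2 hX1
  have hX1' : (1 : ℝ) ≤ X := by exact_mod_cast hX1
  have hX0 : (0 : ℝ) < X := by linarith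
  set Θ := θ (Fin.last d) with hΘ
  set r := rho Θ with hr
  have hl1 : arcLoss Θ ≤ 1 / 10 := by
    rw [arcLoss]
    linarith
  set n := ⌊(X : ℝ) ^ (Θ - arcLoss Θ)⌋₊ with hn
  have hnle : (n : ℝ) ≤ (X : ℝ) ^ (Θ - arcLoss Θ) := Nat.floor_le (by positivity)
  have hnlt : (X : ℝ) ^ (Θ - arcLoss Θ) < n + 1 := Nat.lt_floor_add_one _
  have hn0 : 0 < n := Nat.floor_pos.2 (Real.one_le_rpow hX1' (by linarith))
  obtain ⟨x, hx, hxn⟩ := Real.exists_rat_abs_sub_le_and_den_le ξ hn0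
  rw [Rat.cast_def] at hx
  have hexp : (X : ℝ) ^ (-r) ≤ (X : ℝ) ^ (-r + ε) :=
    Real.rpow_le_rpow_of_exponent_le hX1' (by linarith)
  rcases le_total (x.den : ℝ) ((X : ℝ) ^ r) with hq | hq
  · obtain ⟨p, hp, hpX, hdvd⟩ := h1 x.den x.pos hq
    have hp1 : (1 : ℝ) ≤ p := by exact_mod_cast hp.one_le
    have hd1 : (1 : ℝ) ≤ x.den := by exact_mod_cast x.pos
    refine ⟨p, hp, ?_, ?_⟩
    · have : (p : ℝ) ≤ X := hpX.trans ((Real.rpow_le_rpow_of_exponent_le hX1' (by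
        have : 0 ≤ (arcLoss Θ + r) / Θ := by positivity
        linarith)).trans_eq (Real.rpow_one _))
      exact_mod_cast this
    · have hm : |((⌊ppol α θ p⌋ : ℤ) : ℝ)| ≤ (∑ j, α j) * (X : ℝ) ^ (Θ - arcLoss Θ - r) := by
        have h0 : (0 : ℝ) ≤ (⌊ppol α θ p⌋ : ℤ) := by
          exact_mod_cast Int.floor_nonneg.2 (h.ppol_nonneg p.cast_nonneg)
        rw [abs_of_nonneg h0]
        refine (Int.floor_le _).trans ((h.ppol_le hp1).trans (mul_le_mul_of_nonneg_left ?_ hα))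
        refine (Real.rpow_le_rpow (by linarith) hpX (by linarith)).trans_eq ?_
        rw [← Real.rpow_mul hX0.le]
        congr 1
        have : Θ ≠ 0 := by linarith
        field_simp
        ring
      calc _ ≤ _ := abs_sub_round_mul_le_of_dvd x.pos hdvd
        _ ≤ 1 / (X : ℝ) ^ (Θ - arcLoss Θ) * ((∑ j, α j) * (X : ℝ) ^ (Θ - arcLoss Θ - r)) := by
            refine mul_le_mul (hx.trans (one_div_le_one_div_of_le (by positivity) ?_)) hm
              (abs_nonneg _) (by positivity)
            nlinarith
        _ = (∑ j, α j) * (X : ℝ) ^ (-r) := by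
            rw [one_div, ← Real.rpow_neg hX0.le, mul_left_comm, ← Real.rpow_add hX0]
            ring_nf
        _ ≤ (1 + ∑ j, α j) * (X : ℝ) ^ (-r + ε) :=
            mul_le_mul (by linarith) hexp (by positivity) (by linarith)
  · obtain ⟨p, hp, hle⟩ := h2 ξ x.num x.den n
      (Int.isCoprime_iff_gcd_eq_one.2 x.reduced) hq hxn hnle hnlt.le hx
    refine ⟨p, prime_of_mem_primesIoc hp, le_of_mem_primesIoc hp, hle.trans ?_⟩
    exact le_mul_of_one_le_left (by positivity) (by linarith)

end

end PseudoPoly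

theorem min_frac_part_dominant_pseudo_poly_along_primes
    (f : ℝ → ℝ) (Θ : ℝ) (hf : IsDominantPseudoPoly f Θ) (hΘ : 3 < Θ)
    (ξ : ℝ) (ε : ℝ) (hε : 0 < ε) :
    ∃ C > (0 : ℝ), ∀ᶠ X : ℕ in atTop, ∃ p : ℕ, p.Prime ∧ 2 ≤ p ∧ p ≤ X ∧
      nearestIntDist (ξ * (⌊f p⌋ : ℝ)) ≤
        C * (X : ℝ) ^ (-(1 / (3 * (8 * Θ ^ 2 + 12 * Θ + 10))) + ε) := by
  obtain ⟨d, α, θ, hα, hmono, hone, rfl, hint, hf⟩ := hf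
  have h : PseudoPoly.IsData α θ := ⟨hα, hmono, hone, hint, hΘ⟩
  have hρ := PseudoPoly.rho_pos (θ (Fin.last d))
  have hpos : 0 < 1 + ∑ j, α j := by
    have : 0 ≤ ∑ j, α j := sum_nonneg fun j _ => (hα j).le
    linarith
  refine ⟨1 + ∑ j, α j, hpos, ?_⟩
  filter_upwards [PseudoPoly.eventually_exists_prime_near h ξ
    (ε := min ε (PseudoPoly.rho (θ (Fin.last d)) / 2)) (lt_min hε (half_pos hρ))
    ((min_le_right _ _).trans_lt (half_lt_self hρ)), eventually_ge_atTop 1] with X hX hX1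
  obtain ⟨p, hp, hpX, hle⟩ := hX
  refine ⟨p, hp, hp.two_le, hpX, ?_⟩
  rw [nearestIntDist, hf p]
  refine hle.trans (mul_le_mul_of_nonneg_left ?_ hpos.le)
  exact Real.rpow_le_rpow_of_exponent_le (by exact_mod_cast hX1)
    (add_le_add le_rfl (min_le_left _ _))
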